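/- arXiv:2602.15175 — 2 statements merged into one kernel-verified Lean document; each statement's English description precedes it below -/
import Mathlib

section
/- For every integer k ≥ b, the ℂ-vector space { P ∈ S : P is homogeneous of degree k and α(P) = 0 } (the degree-k component of ker α) has dimension C(d+k, d) − C(ak+b, b), where C(·,·) denotes the binomial coefficient. In particular, for a,b ≥ 2 the degree-(b+1) component of ker α has dimension C(d+b+1, b+1) − C(d+a+b, b). -/
open MvPolynomial

/-- The generic binary form `G = ∑_{i=0}^{b} u_i x^i y^{b-i}` of degree `b`,
viewed as a polynomial in two variables `x = X 0`, `y = X 1` with coefficients in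
`R = MvPolynomial (Fin (b+1)) ℂ`. -/
noncomputable def genForm (b : ℕ) : MvPolynomial (Fin 2) (MvPolynomial (Fin (b + 1)) ℂ) :=
  ∑ i : Fin (b + 1),
    MvPolynomial.C (MvPolynomial.X i) *
      MvPolynomial.X (0 : Fin 2) ^ (i : ℕ) * MvPolynomial.X (1 : Fin 2) ^ (b - (i : ℕ))

/-- The coefficient `c_j ∈ R` of `x^j y^{ab-j}` in `G^a`. -/
noncomputable def coeffC (a b j : ℕ) : MvPolynomial (Fin (b + 1)) ℂ :=
  MvPolynomial.coeff
    (Finsupp.single (0 : Fin 2) j + Finsupp.single (1 : Fin 2) (a * b - j))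
    (genForm b ^ a)

/-- The Foulkes–Howe homomorphism `α : S → R`, `z_j ↦ c_j`. -/
noncomputable def FH (a b : ℕ) :
    MvPolynomial (Fin (a * b + 1)) ℂ →ₐ[ℂ] MvPolynomial (Fin (b + 1)) ℂ :=
  MvPolynomial.aeval fun j : Fin (a * b + 1) => coeffC a b (j : ℕ)

namespace FoulkesHowe

section Homogeneous

variable {ι A : Type*} [CommRing A]

theorem homogeneousComponent_mul_of_isHomogeneous {f : MvPolynomial ι A} {m : ℕ}
    (hf : f.IsHomogeneous m) (n : ℕ) (w : MvPolynomial ι A) :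
    homogeneousComponent n (f * w) =
      if m ≤ n then f * homogeneousComponent (n - m) w else 0 := by
  conv_lhs => rw [← sum_homogeneousComponent w, Finset.mul_sum, map_sum]
  have key : ∀ k, homogeneousComponent n (f * homogeneousComponent k w) =
      if m + k = n then f * homogeneousComponent k w else 0 := fun k =>
    homogeneousComponent_of_mem (hf.mul (homogeneousComponent_isHomogeneous k w)) |>.trans
      (by simp only [eq_comm])
  simp_rw [key]
  split_ifs with h
  · obtain ⟨e, rfl⟩ := Nat.exists_eq_add_of_le h
    simp only [add_right_inj, Nat.add_sub_cancel_left, Finset.sum_ite_eq', Finset.mem_range]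
    split_ifs with h'
    · rfl
    · rw [homogeneousComponent_eq_zero _ _ (by omega), mul_zero]
  · refine Finset.sum_eq_zero fun k _ => if_neg (by omega)

theorem isHomogeneous_of_mul_left [IsDomain A] {f g : MvPolynomial ι A} {m n : ℕ} (hf0 : f ≠ 0)
    (hf : f.IsHomogeneous m) (hfg : (f * g).IsHomogeneous (m + n)) : g.IsHomogeneous n := by
  have : homogeneousComponent n g = g := by
    apply mul_left_cancel₀ hf0
    have := homogeneousComponent_mul_of_isHomogeneous hf (m + n) g
    rw [if_pos (by omega), Nat.add_sub_cancel_left] at this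
    rw [← this]
    rw [homogeneousComponent_of_mem hfg, if_pos rfl]
  rw [← this]
  exact homogeneousComponent_isHomogeneous n g

end Homogeneous

section DividedDifference

variable {ι : Type*} [DecidableEq ι] {A : Type*} [CommRing A]

theorem X_sub_X_dvd_sub_rename_swap (i j : ι) (p : MvPolynomial ι A) :
    (X i - X j : MvPolynomial ι A) ∣ p - rename (Equiv.swap i j) p := by
  induction p using MvPolynomial.induction_on with
  | C a => simp
  | add p q hp hq =>
    have : p + q - rename (Equiv.swap i j) (p + q) =
        (p - rename (Equiv.swap i j) p) + (q - rename (Equiv.swap i j) q) := by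
      rw [map_add]; ring
    rw [this]
    exact dvd_add hp hq
  | mul_X p l hp =>
    have h1 : (X i - X j : MvPolynomial ι A) ∣ X l - X (Equiv.swap i j l) := by
      rcases eq_or_ne l i with rfl | hi
      · simp
      · rcases eq_or_ne l j with rfl | hj
        · rw [Equiv.swap_apply_right, ← dvd_neg, neg_sub]
        · simp [Equiv.swap_apply_of_ne_of_ne hi hj]
    have : p * X l - rename (Equiv.swap i j) (p * X l) =
        (p - rename (Equiv.swap i j) p) * X l +
          rename (Equiv.swap i j) p * (X l - X (Equiv.swap i j l)) := by
      rw [map_mul, rename_X]; ring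
    rw [this]
    exact dvd_add (hp.mul_right _) (h1.mul_left _)

variable [IsDomain A]

omit [DecidableEq ι] in
theorem X_sub_X_ne_zero {i j : ι} (h : i ≠ j) : (X i - X j : MvPolynomial ι A) ≠ 0 :=
  sub_ne_zero.2 fun h' => h (X_injective h')

/-- The divided difference `(p - s_{ij} p) / (x_i - x_j)`; it is `0` for `i = j`. -/
noncomputable def divDiff (i j : ι) : MvPolynomial ι A →ₗ[A] MvPolynomial ι A :=
  if h : i = j then 0 else
  { toFun := fun p => (X_sub_X_dvd_sub_rename_swap i j p).choose
    map_add' := fun p q => by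
      apply mul_left_cancel₀ (X_sub_X_ne_zero (A := A) h)
      rw [mul_add, ← (X_sub_X_dvd_sub_rename_swap i j (p + q)).choose_spec,
        ← (X_sub_X_dvd_sub_rename_swap i j p).choose_spec,
        ← (X_sub_X_dvd_sub_rename_swap i j q).choose_spec, map_add]
      ring
    map_smul' := fun a p => by
      apply mul_left_cancel₀ (X_sub_X_ne_zero (A := A) h)
      rw [RingHom.id_apply, mul_smul_comm,
        ← (X_sub_X_dvd_sub_rename_swap i j (a • p)).choose_spec,
        ← (X_sub_X_dvd_sub_rename_swap i j p).choose_spec, map_smul, smul_sub] }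

theorem X_sub_X_mul_divDiff {i j : ι} (h : i ≠ j) (p : MvPolynomial ι A) :
    (X i - X j) * divDiff i j p = p - rename (Equiv.swap i j) p := by
  rw [divDiff, dif_neg h]
  exact (X_sub_X_dvd_sub_rename_swap i j p).choose_spec.symm

theorem divDiff_eq_iff {i j : ι} (h : i ≠ j) (p q : MvPolynomial ι A) :
    divDiff i j p = q ↔ (X i - X j) * q = p - rename (Equiv.swap i j) p := by
  rw [← X_sub_X_mul_divDiff h p]
  constructor
  · rintro rfl; rfl
  · intro h'; exact (mul_left_cancel₀ (X_sub_X_ne_zero h) h').symm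

theorem divDiff_mul {i j : ι} (h : i ≠ j) (p q : MvPolynomial ι A) :
    divDiff i j (p * q) = p * divDiff i j q + divDiff i j p * rename (Equiv.swap i j) q := by
  rw [divDiff_eq_iff h, mul_add, mul_left_comm, X_sub_X_mul_divDiff h, ← mul_assoc,
    X_sub_X_mul_divDiff h, map_mul]
  ring

theorem divDiff_eq_zero {i j : ι} (h : i ≠ j) {p : MvPolynomial ι A}
    (hp : rename (Equiv.swap i j) p = p) : divDiff i j p = 0 := by
  rw [divDiff_eq_iff h, hp]; simp

theorem divDiff_X_left {i j : ι} (h : i ≠ j) : divDiff i j (X i : MvPolynomial ι A) = 1 := by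
  rw [divDiff_eq_iff h]; simp

theorem divDiff_X_right {i j : ι} (h : i ≠ j) : divDiff i j (X j : MvPolynomial ι A) = -1 := by
  rw [divDiff_eq_iff h]; simp

theorem divDiff_X_of_ne {i j l : ι} (h : i ≠ j) (hi : l ≠ i) (hj : l ≠ j) :
    divDiff i j (X l : MvPolynomial ι A) = 0 :=
  divDiff_eq_zero h (by rw [rename_X, Equiv.swap_apply_of_ne_of_ne hi hj])

theorem rename_divDiff (w : Equiv.Perm ι) {i j : ι} (h : i ≠ j) (p : MvPolynomial ι A) :
    rename w (divDiff i j p) = divDiff (w i) (w j) (rename w p) := by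
  symm
  rw [divDiff_eq_iff (w.injective.ne h), ← rename_X, ← rename_X, ← map_sub, ← map_mul,
    X_sub_X_mul_divDiff h, map_sub, rename_rename, rename_rename]
  congr 3
  ext l
  simp [Equiv.swap_apply_apply]

theorem map_divDiff {B : Type*} [CommRing B] [IsDomain B] (f : A →+* B) {i j : ι} (h : i ≠ j)
    (p : MvPolynomial ι A) : map f (divDiff i j p) = divDiff i j (map f p) := by
  symm
  rw [divDiff_eq_iff h, ← map_X f i, ← map_X f j, ← map_sub, ← map_mul,
    X_sub_X_mul_divDiff h, map_sub, map_rename]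

theorem isHomogeneous_divDiff {i j : ι} (h : i ≠ j) {p : MvPolynomial ι A} {d : ℕ}
    (hp : p.IsHomogeneous (d + 1)) : (divDiff i j p).IsHomogeneous d := by
  refine isHomogeneous_of_mul_left (X_sub_X_ne_zero (A := A) h)
    ((isHomogeneous_X A i).sub (isHomogeneous_X A j)) ?_
  rw [X_sub_X_mul_divDiff h, add_comm]
  exact hp.sub hp.rename_isHomogeneous

omit [IsDomain A] in
theorem degreeOf_rename_swap (i j l : ι) (p : MvPolynomial ι A) :
    degreeOf l (rename (Equiv.swap i j) p) = degreeOf (Equiv.swap i j l) p := by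
  conv_lhs => rw [← Equiv.swap_apply_self i j l]
  exact degreeOf_rename_of_injective (Equiv.injective _) _

theorem degreeOf_mul_divDiff {i j : ι} (h : i ≠ j) (l : ι) (p : MvPolynomial ι A) :
    degreeOf l ((X i - X j) * divDiff i j p) ≤
      max (degreeOf l p) (degreeOf (Equiv.swap i j l) p) := by
  rw [X_sub_X_mul_divDiff h, ← degreeOf_rename_swap]
  exact degreeOf_sub_le _ _ _

theorem one_le_degreeOf_X_sub_X {i j : ι} (h : i ≠ j) :
    1 ≤ degreeOf i (X i - X j : MvPolynomial ι A) := by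
  have : Finsupp.single i 1 ∈ (X i - X j : MvPolynomial ι A).support := by
    rw [mem_support_iff, coeff_sub, coeff_X, coeff_X, if_pos rfl, if_neg]
    · simp
    · intro h'
      exact h ((Finsupp.single_left_inj one_ne_zero).1 h').symm
  simpa using monomial_le_degreeOf i this

theorem degreeOf_divDiff_lt {i j : ι} (h : i ≠ j) {p : MvPolynomial ι A} {d : ℕ}
    (hi : degreeOf i p ≤ d + 1) (hj : degreeOf j p ≤ d + 1) :
    degreeOf i (divDiff i j p) ≤ d := by
  rcases eq_or_ne (divDiff i j p) 0 with h0 | h0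
  · simp [h0]
  have := degreeOf_mul_divDiff h i p
  rw [degreeOf_mul_eq (X_sub_X_ne_zero h) h0, Equiv.swap_apply_left] at this
  have := one_le_degreeOf_X_sub_X (A := A) h
  omega

theorem degreeOf_divDiff_le {i j : ι} (h : i ≠ j) {p : MvPolynomial ι A} {d : ℕ}
    (hp : ∀ l, degreeOf l p ≤ d) (l : ι) : degreeOf l (divDiff i j p) ≤ d := by
  rcases eq_or_ne (divDiff i j p) 0 with h0 | h0
  · simp [h0]
  have := degreeOf_mul_divDiff h l p
  rw [degreeOf_mul_eq (X_sub_X_ne_zero h) h0] at this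
  have h1 := hp l
  have h2 := hp (Equiv.swap i j l)
  omega

theorem coeff_single_divDiff {i j : ι} (h : i ≠ j) (p : MvPolynomial ι A) (m : ℕ) :
    coeff (Finsupp.single i m) (divDiff i j p) =
      coeff (Finsupp.single i (m + 1)) p - coeff (Finsupp.single j (m + 1)) p := by
  have := congrArg (coeff (Finsupp.single i (m + 1))) (X_sub_X_mul_divDiff h p)
  rw [sub_mul, coeff_sub, coeff_sub, Finsupp.single_add, add_comm, coeff_X_mul, add_comm,
    ← Finsupp.single_add, coeff_X_mul', if_neg, sub_zero] at this
  · rw [this]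
    congr 1
    have h2 := coeff_rename_mapDomain (Equiv.swap i j) (Equiv.injective _) p
      (Finsupp.single j (m + 1))
    rw [Finsupp.mapDomain_single, Equiv.swap_apply_right] at h2
    exact h2
  · simp [h]

end DividedDifference

section Dunkl

variable {ι : Type*} [DecidableEq ι] {A : Type*} [CommRing A] [IsDomain A]

/-- The Dunkl operator in direction `i` for the variables in `s`, with parameter `κ`. -/
noncomputable def dunkl (κ : A) (s : Finset ι) (i : ι) : MvPolynomial ι A →ₗ[A] MvPolynomial ι A :=
  (pderiv (R := A) i).toLinearMap + κ • ∑ j ∈ s.erase i, divDiff i j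

theorem dunkl_apply (κ : A) (s : Finset ι) (i : ι) (p : MvPolynomial ι A) :
    dunkl κ s i p = pderiv i p + κ • ∑ j ∈ s.erase i, divDiff i j p := by
  simp [dunkl]

omit [DecidableEq ι] [IsDomain A] in
theorem rename_pderiv (w : Equiv.Perm ι) (i : ι) (p : MvPolynomial ι A) :
    rename w (pderiv i p) = pderiv (w i) (rename w p) :=
  (pderiv_rename w.injective i p).symm

theorem rename_dunkl (κ : A) {s : Finset ι} {w : Equiv.Perm ι} (hw : ∀ i, w i ∈ s ↔ i ∈ s) (i : ι)
    (p : MvPolynomial ι A) :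
    rename w (dunkl κ s i p) = dunkl κ s (w i) (rename w p) := by
  rw [dunkl_apply, dunkl_apply, map_add, rename_pderiv, map_smul, map_sum]
  congr 2
  refine Finset.sum_bij (fun j _ => w j) ?_ ?_ ?_ ?_
  · intro j hj
    simpa [hw] using hj
  · intro j _ l _ h
    exact w.injective h
  · intro l hl
    refine ⟨w.symm l, ?_, by simp⟩
    rw [Finset.mem_erase] at hl ⊢
    refine ⟨fun h => hl.1 (by rw [← h]; simp), ?_⟩
    rw [← hw]; simpa using hl.2
  · intro j hj
    exact rename_divDiff w (Finset.ne_of_mem_erase hj).symm p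

theorem map_dunkl {B : Type*} [CommRing B] [IsDomain B] (f : A →+* B) (κ : A) (s : Finset ι)
    (i : ι) (p : MvPolynomial ι A) :
    map f (dunkl κ s i p) = dunkl (f κ) s i (map f p) := by
  rw [dunkl_apply, dunkl_apply, map_add, ← pderiv_map, smul_eq_C_mul, map_mul, map_C, map_sum,
    ← smul_eq_C_mul]
  congr 2
  exact Finset.sum_congr rfl fun j hj => map_divDiff f (Finset.ne_of_mem_erase hj).symm p

/-- The commutator of `dunkl κ s i` with multiplication by the variable `l`. -/
noncomputable def dunklComm (κ : A) (s : Finset ι) (i l : ι) :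
    MvPolynomial ι A →ₗ[A] MvPolynomial ι A :=
  if l = i then LinearMap.id + κ • ∑ j ∈ s.erase i, (rename (Equiv.swap i j)).toLinearMap
  else if l ∈ s then -κ • (rename (Equiv.swap i l)).toLinearMap
  else 0

theorem dunkl_X_mul (κ : A) (s : Finset ι) (i l : ι) (p : MvPolynomial ι A) :
    dunkl κ s i (X l * p) = X l * dunkl κ s i p + dunklComm κ s i l p := by
  have h0 : ∀ j ∈ s.erase i, divDiff i j (X l * p) =
      X l * divDiff i j p + divDiff i j (X l) * rename (Equiv.swap i j) p := fun j hj =>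
    divDiff_mul (Finset.ne_of_mem_erase hj).symm _ _
  rw [dunkl_apply, dunkl_apply, Finset.sum_congr rfl h0, Derivation.leibniz, Finset.sum_add_distrib,
    ← Finset.mul_sum, smul_add, mul_add, mul_smul_comm, dunklComm]
  simp only [smul_eq_mul]
  have h1 : p * pderiv i (X l) + κ • ∑ j ∈ s.erase i, divDiff i j (X l) * rename (Equiv.swap i j) p
      = dunklComm κ s i l p := by
    rw [dunklComm]
    split_ifs with hl hs
    · subst hl
      rw [pderiv_X_self, mul_one]
      simp only [LinearMap.add_apply, LinearMap.id_apply, LinearMap.smul_apply,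
        LinearMap.sum_apply, AlgHom.toLinearMap_apply]
      congr 2
      refine Finset.sum_congr rfl fun j hj => ?_
      rw [divDiff_X_left (Finset.ne_of_mem_erase hj).symm, one_mul]
    · rw [pderiv_X_of_ne hl, mul_zero, zero_add,
        Finset.sum_eq_single_of_mem l (Finset.mem_erase.2 ⟨hl, hs⟩),
        divDiff_X_right (Ne.symm hl)]
      · simp
      · intro j hj hjl
        rw [divDiff_X_of_ne (Finset.ne_of_mem_erase hj).symm hl hjl.symm, zero_mul]
    · rw [pderiv_X_of_ne hl, mul_zero, zero_add, Finset.sum_eq_zero]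
      · simp
      · intro j hj
        rw [divDiff_X_of_ne (Finset.ne_of_mem_erase hj).symm hl, zero_mul]
        rintro rfl
        exact hs (Finset.mem_of_mem_erase hj)
  rw [dunklComm] at h1
  rw [← h1]
  ring

theorem swap_mem_iff {s : Finset ι} {i j : ι} (hi : i ∈ s) (hj : j ∈ s) (l : ι) :
    Equiv.swap i j l ∈ s ↔ l ∈ s := by
  rcases eq_or_ne l i with rfl | h
  · simp [hi, hj]
  · rcases eq_or_ne l j with rfl | h'
    · simp [hi, hj]
    · rw [Equiv.swap_apply_of_ne_of_ne h h']

theorem dunkl_one (κ : A) (s : Finset ι) (i : ι) (a : A) : dunkl κ s i (C a) = 0 := by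
  rw [dunkl_apply, pderiv_C, Finset.sum_eq_zero, smul_zero, add_zero]
  intro j hj
  exact divDiff_eq_zero (Finset.ne_of_mem_erase hj).symm (rename_C _ _)

theorem dunklComm_jacobi (κ : A) {s : Finset ι} {i j : ι} (hi : i ∈ s) (hj : j ∈ s) (h : i ≠ j)
    (l : ι) (p : MvPolynomial ι A) :
    dunklComm κ s i l (dunkl κ s j p) + dunkl κ s i (dunklComm κ s j l p) =
      dunklComm κ s j l (dunkl κ s i p) + dunkl κ s j (dunklComm κ s i l p) := by
  have aux : ∀ {i j : ι}, i ∈ s → j ∈ s → i ≠ j → ∀ p,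
      dunklComm κ s i i (dunkl κ s j p) + dunkl κ s i (dunklComm κ s j i p) =
      dunklComm κ s j i (dunkl κ s i p) + dunkl κ s j (dunklComm κ s i i p) := by
    intro i j hi hj h p
    simp only [dunklComm, if_pos, if_neg h, if_pos hi, LinearMap.add_apply, LinearMap.id_apply,
      LinearMap.smul_apply, LinearMap.sum_apply, AlgHom.toLinearMap_apply, map_add, map_smul,
      map_sum, neg_smul, map_neg]
    have hj' : j ∈ s.erase i := Finset.mem_erase.2 ⟨h.symm, hj⟩
    have e1 : ∀ k ∈ (s.erase i).erase j, rename (Equiv.swap i k) (dunkl κ s j p) =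
        dunkl κ s j (rename (Equiv.swap i k) p) := by
      intro k hk
      simp only [Finset.mem_erase] at hk
      rw [rename_dunkl κ (swap_mem_iff hi hk.2.2),
        Equiv.swap_apply_of_ne_of_ne h.symm (Ne.symm hk.1)]
    rw [← Finset.add_sum_erase _ _ hj', ← Finset.add_sum_erase _ _ hj', Finset.sum_congr rfl e1,
      rename_dunkl κ (swap_mem_iff hi hj), Equiv.swap_apply_right, Equiv.swap_comm j i,
      rename_dunkl κ (swap_mem_iff hi hj), Equiv.swap_apply_left]
    simp only [smul_add]
    ring
  rcases eq_or_ne l i with rfl | hli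
  · exact aux hi hj h p
  rcases eq_or_ne l j with rfl | hlj
  · exact (aux hj hi h.symm p).symm
  simp only [dunklComm, if_neg hli, if_neg hlj]
  split_ifs with hl
  · simp only [LinearMap.smul_apply, AlgHom.toLinearMap_apply, map_smul]
    rw [rename_dunkl κ (swap_mem_iff hi hl), rename_dunkl κ (swap_mem_iff hj hl),
      Equiv.swap_apply_of_ne_of_ne h.symm hlj.symm, Equiv.swap_apply_of_ne_of_ne h hli.symm, add_comm]
  · simp

theorem dunkl_comm (κ : A) {s : Finset ι} {i j : ι} (hi : i ∈ s) (hj : j ∈ s)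
    (p : MvPolynomial ι A) :
    dunkl κ s i (dunkl κ s j p) = dunkl κ s j (dunkl κ s i p) := by
  rcases eq_or_ne i j with rfl | h
  · rfl
  induction p using MvPolynomial.induction_on with
  | C a => simp [dunkl_one]
  | add p q hp hq => simp only [map_add, hp, hq]
  | mul_X p l hp =>
    rw [mul_comm, dunkl_X_mul, dunkl_X_mul, map_add, map_add, dunkl_X_mul, dunkl_X_mul, hp,
      add_assoc, add_assoc, dunklComm_jacobi κ hi hj h]

theorem isHomogeneous_dunkl (κ : A) (s : Finset ι) (i : ι) {p : MvPolynomial ι A} {d : ℕ}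
    (hp : p.IsHomogeneous (d + 1)) : (dunkl κ s i p).IsHomogeneous d := by
  rw [dunkl_apply]
  refine IsHomogeneous.add hp.pderiv ?_
  rw [smul_eq_C_mul, ← zero_add d]
  refine (isHomogeneous_C _ _).mul (IsHomogeneous.sum _ _ _ fun j hj => ?_)
  exact isHomogeneous_divDiff (Finset.ne_of_mem_erase hj).symm hp

theorem degreeOf_dunkl_le (κ : A) (s : Finset ι) (i : ι) {p : MvPolynomial ι A} {d : ℕ}
    (hp : ∀ l, degreeOf l p ≤ d) (l : ι) : degreeOf l (dunkl κ s i p) ≤ d := by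
  rw [dunkl_apply]
  refine (degreeOf_add_le _ _ _).trans (max_le ?_ ?_)
  · refine degreeOf_le_iff.2 fun m hm => ?_
    rw [mem_support_iff, coeff_pderiv] at hm
    have := monomial_le_degreeOf l (mem_support_iff.2 (left_ne_zero_of_mul hm))
    rw [Finsupp.add_apply] at this
    exact (Nat.le_add_right _ _).trans (this.trans (hp l))
  · rw [smul_eq_C_mul]
    refine (degreeOf_C_mul_le _ _ _).trans ((degreeOf_sum_le _ _ _).trans (Finset.sup_le ?_))
    intro j hj
    exact degreeOf_divDiff_le (Finset.ne_of_mem_erase hj).symm hp l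

theorem coeff_single_dunkl (κ : A) {s : Finset ι} {i : ι} (hi : i ∈ s) (p : MvPolynomial ι A)
    (m : ℕ) :
    coeff (Finsupp.single i m) (dunkl κ s i p) =
      (m + 1 + κ * s.card) * coeff (Finsupp.single i (m + 1)) p
        - κ * ∑ j ∈ s, coeff (Finsupp.single j (m + 1)) p := by
  rw [dunkl_apply, coeff_add, coeff_smul, coeff_sum, ← Finset.add_sum_erase s _ hi,
    Finset.sum_congr rfl fun j hj => coeff_single_divDiff (Finset.ne_of_mem_erase hj).symm p m,
    Finset.sum_sub_distrib, Finset.sum_const, Finset.card_erase_of_mem hi]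
  have : (s.card : A) = ((s.card - 1 : ℕ) : A) + 1 := by
    rw [← Nat.cast_succ, Nat.succ_eq_add_one, Nat.sub_add_cancel (Finset.card_pos.2 ⟨i, hi⟩)]
  have h2 : coeff (Finsupp.single i m) (pderiv i p) =
      (m + 1) * coeff (Finsupp.single i (m + 1)) p := by
    rw [coeff_pderiv, ← Finsupp.single_add, Finsupp.single_eq_same, mul_comm]
  rw [h2, this, smul_eq_mul, nsmul_eq_mul]
  ring

end Dunkl

section Action

variable {ι : Type*} {A : Type*} [CommRing A]

open scoped IsMulCommutative in
/-- Evaluation of a polynomial at a commuting family of endomorphisms. -/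
noncomputable def aevalCommuting {V : Type*} [AddCommGroup V] [Module A V]
    (T : ι → Module.End A V) (hT : ∀ i j, T i * T j = T j * T i) :
    MvPolynomial ι A →ₐ[A] Module.End A V :=
  haveI : IsMulCommutative (Algebra.adjoin A (Set.range T)) :=
    Algebra.isMulCommutative_adjoin A (by rintro _ ⟨i, rfl⟩ _ ⟨j, rfl⟩; exact hT i j)
  (Subalgebra.val (Algebra.adjoin A (Set.range T))).comp
    (aeval fun i => (⟨T i, Algebra.subset_adjoin ⟨i, rfl⟩⟩ : Algebra.adjoin A (Set.range T)))

theorem aevalCommuting_X {V : Type*} [AddCommGroup V] [Module A V]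
    (T : ι → Module.End A V) (hT : ∀ i j, T i * T j = T j * T i) (i : ι) :
    aevalCommuting T hT (X i) = T i := by
  simp [aevalCommuting]

variable [DecidableEq ι] [IsDomain A]

/-- The Dunkl operator for `i ∈ s`, extended by `0` to the other indices. -/
noncomputable def dunklEnd (κ : A) (s : Finset ι) (i : ι) : Module.End A (MvPolynomial ι A) :=
  if i ∈ s then dunkl κ s i else 0

theorem dunklEnd_of_mem (κ : A) {s : Finset ι} {i : ι} (hi : i ∈ s) :
    dunklEnd κ s i = dunkl κ s i := if_pos hi

theorem dunklEnd_mul_comm (κ : A) (s : Finset ι) (i j : ι) :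
    dunklEnd κ s i * dunklEnd κ s j = dunklEnd κ s j * dunklEnd κ s i := by
  by_cases hi : i ∈ s <;> by_cases hj : j ∈ s
  · rw [dunklEnd_of_mem κ hi, dunklEnd_of_mem κ hj]
    exact LinearMap.ext fun p => dunkl_comm κ hi hj p
  all_goals simp [dunklEnd, hi, hj]

/-- The action of polynomials by substitution of Dunkl operators for the variables. -/
noncomputable def dunklAct (κ : A) (s : Finset ι) :
    MvPolynomial ι A →ₐ[A] Module.End A (MvPolynomial ι A) :=
  aevalCommuting (dunklEnd κ s) (dunklEnd_mul_comm κ s)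

theorem dunklAct_X (κ : A) {s : Finset ι} {i : ι} (hi : i ∈ s) :
    dunklAct κ s (X i) = dunkl κ s i := by
  rw [dunklAct, aevalCommuting_X, dunklEnd_of_mem κ hi]

theorem dunklAct_mul (κ : A) (s : Finset ι) (h k g : MvPolynomial ι A) :
    dunklAct κ s (h * k) g = dunklAct κ s h (dunklAct κ s k g) := by
  rw [map_mul]; rfl

theorem dunklAct_mul_X (κ : A) {s : Finset ι} {i : ι} (hi : i ∈ s) (h g : MvPolynomial ι A) :
    dunklAct κ s (h * X i) g = dunklAct κ s h (dunkl κ s i g) := by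
  rw [dunklAct_mul, dunklAct_X κ hi]

theorem dunklAct_C (κ : A) (s : Finset ι) (a : A) (g : MvPolynomial ι A) :
    dunklAct κ s (C a) g = a • g := by
  rw [← algebraMap_eq, AlgHom.commutes]; rfl

theorem dunklAct_mul_X_of_notMem (κ : A) {s : Finset ι} {i : ι} (hi : i ∉ s)
    (h g : MvPolynomial ι A) : dunklAct κ s (h * X i) g = 0 := by
  rw [dunklAct_mul, dunklAct, aevalCommuting_X, dunklEnd, if_neg hi, LinearMap.zero_apply,
    map_zero]

theorem map_dunklAct {B : Type*} [CommRing B] [IsDomain B] (f : A →+* B) (κ : A) (s : Finset ι)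
    (h g : MvPolynomial ι A) :
    map f (dunklAct κ s h g) = dunklAct (f κ) s (map f h) (map f g) := by
  induction h using MvPolynomial.induction_on generalizing g with
  | C a => rw [dunklAct_C, map_C, dunklAct_C, smul_eq_C_mul, map_mul, map_C, smul_eq_C_mul]
  | add p q hp hq => simp only [map_add, LinearMap.add_apply, hp, hq]
  | mul_X p i hp =>
    rw [map_mul (map f), map_X]
    by_cases hi : i ∈ s
    · rw [dunklAct_mul_X κ hi, dunklAct_mul_X _ hi, hp, map_dunkl]
    · rw [dunklAct_mul_X_of_notMem κ hi, dunklAct_mul_X_of_notMem _ hi, map_zero]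

/-- The Dunkl pairing `[h, g] = (h(D) g)(0)`. -/
noncomputable def pairing (κ : A) (s : Finset ι) (h g : MvPolynomial ι A) : A :=
  constantCoeff (dunklAct κ s h g)

theorem pairing_add_left (κ : A) (s : Finset ι) (h k g : MvPolynomial ι A) :
    pairing κ s (h + k) g = pairing κ s h g + pairing κ s k g := by
  simp [pairing]

theorem pairing_C_mul_left (κ : A) (s : Finset ι) (a : A) (h g : MvPolynomial ι A) :
    pairing κ s (C a * h) g = a * pairing κ s h g := by
  rw [pairing, dunklAct_mul, dunklAct_C]; simp [pairing]

theorem pairing_sum_left {τ : Type*} (κ : A) (s : Finset ι) (t : Finset τ)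
    (h : τ → MvPolynomial ι A) (g : MvPolynomial ι A) :
    pairing κ s (∑ k ∈ t, h k) g = ∑ k ∈ t, pairing κ s (h k) g := by
  simp [pairing, LinearMap.sum_apply]

theorem pairing_mul_X (κ : A) {s : Finset ι} {i : ι} (hi : i ∈ s) (h g : MvPolynomial ι A) :
    pairing κ s (h * X i) g = pairing κ s h (dunkl κ s i g) := by
  rw [pairing, dunklAct_mul_X κ hi, pairing]

theorem pairing_mul (κ : A) (s : Finset ι) (h k g : MvPolynomial ι A) :
    pairing κ s (h * k) g = pairing κ s h (dunklAct κ s k g) := by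
  rw [pairing, dunklAct_mul, pairing]

theorem map_pairing {B : Type*} [CommRing B] [IsDomain B] (f : A →+* B) (κ : A) (s : Finset ι)
    (h g : MvPolynomial ι A) :
    f (pairing κ s h g) = pairing (f κ) s (map f h) (map f g) := by
  rw [pairing, pairing, ← map_dunklAct, constantCoeff_map]

theorem dunklAct_eq_zero (κ : A) (s : Finset ι) {g : MvPolynomial ι A}
    (hg : ∀ i ∈ s, dunkl κ s i g = 0) {h : MvPolynomial ι A} (hh : constantCoeff h = 0) :
    dunklAct κ s h g = 0 := by
  have key : ∀ h : MvPolynomial ι A, dunklAct κ s h g = constantCoeff h • g := by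
    intro h
    induction h using MvPolynomial.induction_on with
    | C a => rw [dunklAct_C, constantCoeff_C]
    | add p q hp hq => rw [map_add, LinearMap.add_apply, hp, hq, map_add, add_smul]
    | mul_X p i _ =>
      by_cases hi : i ∈ s
      · rw [dunklAct_mul_X κ hi, hg i hi]; simp
      · rw [dunklAct_mul_X_of_notMem κ hi]; simp
  rw [key, hh, zero_smul]

theorem degreeOf_dunklAct_le (κ : A) (s : Finset ι) (h : MvPolynomial ι A)
    {g : MvPolynomial ι A} {d : ℕ} (hg : ∀ l, degreeOf l g ≤ d) (l : ι) :
    degreeOf l (dunklAct κ s h g) ≤ d := by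
  induction h using MvPolynomial.induction_on generalizing g with
  | C a => rw [dunklAct_C, smul_eq_C_mul]; exact (degreeOf_C_mul_le _ _ _).trans (hg l)
  | add p q hp hq =>
    rw [map_add, LinearMap.add_apply]
    exact (degreeOf_add_le _ _ _).trans (max_le (hp hg) (hq hg))
  | mul_X p i hp =>
    by_cases hi : i ∈ s
    · rw [dunklAct_mul_X κ hi]
      exact hp (degreeOf_dunkl_le κ s i hg)
    · rw [dunklAct_mul_X_of_notMem κ hi]; simp

theorem dunkl_eq_zero_of_isHomogeneous_zero (κ : A) (s : Finset ι) (i : ι) {g : MvPolynomial ι A}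
    (hg : g.IsHomogeneous 0) : dunkl κ s i g = 0 := by
  rw [← totalDegree_zero_iff_isHomogeneous, totalDegree_eq_zero_iff_eq_C] at hg
  rw [hg, dunkl_one]

theorem homogeneousComponent_dunkl (κ : A) (s : Finset ι) (i : ι) (n : ℕ) (g : MvPolynomial ι A) :
    homogeneousComponent n (dunkl κ s i g) = dunkl κ s i (homogeneousComponent (n + 1) g) := by
  conv_lhs => rw [← sum_homogeneousComponent g, map_sum, map_sum]
  have : ∀ k, homogeneousComponent n (dunkl κ s i (homogeneousComponent k g)) =
      if k = n + 1 then dunkl κ s i (homogeneousComponent k g) else 0 := by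
    intro k
    cases k with
    | zero =>
      rw [dunkl_eq_zero_of_isHomogeneous_zero κ s i (homogeneousComponent_isHomogeneous 0 g)]
      simp
    | succ k =>
      rw [homogeneousComponent_of_mem
        (isHomogeneous_dunkl κ s i (homogeneousComponent_isHomogeneous (k + 1) g))]
      simp [eq_comm]
  simp_rw [this, Finset.sum_ite_eq', Finset.mem_range]
  split_ifs with h'
  · rfl
  · rw [homogeneousComponent_eq_zero _ _ (by omega), map_zero]

theorem pairing_homogeneousComponent (κ : A) (s : Finset ι) (n : ℕ) (h g : MvPolynomial ι A) :
    pairing κ s (homogeneousComponent n h) g = pairing κ s h (homogeneousComponent n g) := by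
  induction h using MvPolynomial.induction_on generalizing g n with
  | C a =>
    rw [homogeneousComponent_of_mem (isHomogeneous_C _ a), pairing, pairing, dunklAct_C]
    split_ifs with h
    · subst h
      rw [dunklAct_C]; simp [homogeneousComponent_zero, constantCoeff_eq]
    · have : (coeff 0) (homogeneousComponent n g) = 0 := by
        rw [coeff_homogeneousComponent, if_neg]
        simpa using Ne.symm h
      rw [smul_eq_C_mul, map_mul, constantCoeff_eq, this]
      simp
  | add p q hp hq => simp only [map_add, pairing_add_left, hp, hq]
  | mul_X p i hp =>
    rw [mul_comm, homogeneousComponent_mul_of_isHomogeneous (isHomogeneous_X A i)]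
    by_cases hi : i ∈ s
    · rw [mul_comm (X i) p, pairing_mul_X κ hi]
      split_ifs with hn
      · obtain ⟨e, rfl⟩ := Nat.exists_eq_add_of_le' hn
        rw [mul_comm, pairing_mul_X κ hi, Nat.add_sub_cancel, hp, homogeneousComponent_dunkl]
      · obtain rfl : n = 0 := by omega
        rw [dunkl_eq_zero_of_isHomogeneous_zero κ s i (homogeneousComponent_isHomogeneous 0 g)]
        simp [pairing]
    · rw [pairing, pairing, mul_comm _ p, dunklAct_mul_X_of_notMem κ hi]
      split_ifs with hn
      · rw [mul_comm, dunklAct_mul_X_of_notMem κ hi]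
      · simp

end Action

section LineFormula

variable {ι : Type*} {A : Type*} [CommRing A]

/-- The power sum of degree `m` in the variables in `s`. -/
noncomputable def powSum (A : Type*) [CommRing A] (s : Finset ι) (m : ℕ) : MvPolynomial ι A :=
  ∑ i ∈ s, X i ^ m

theorem isHomogeneous_powSum (s : Finset ι) (m : ℕ) : (powSum A s m).IsHomogeneous m :=
  IsHomogeneous.sum _ _ _ fun i _ => by simpa using (isHomogeneous_X A i).pow m

variable [Algebra ℚ A]

/-- The coefficients of the power series `∏_{j ∈ s} (1 - y_j z)^{-κ}`. -/
noncomputable def binomSeries (κ : A) (s : Finset ι) : ℕ → MvPolynomial ι A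
  | 0 => 1
  | m + 1 => C (algebraMap ℚ A (1 / (m + 1)) * κ) *
      ∑ k : Fin (m + 1), powSum A s (m + 1 - k) * binomSeries κ s k

theorem binomSeries_zero (κ : A) (s : Finset ι) : binomSeries κ s 0 = 1 := by
  rw [binomSeries]

theorem mul_binomSeries_succ (κ : A) (s : Finset ι) (m : ℕ) :
    C (m + 1 : A) * binomSeries κ s (m + 1) =
      C κ * ∑ k ∈ Finset.range (m + 1), powSum A s (m + 1 - k) * binomSeries κ s k := by
  rw [binomSeries, ← mul_assoc, ← map_mul, ← mul_assoc,
    Finset.sum_range fun k => powSum A s (m + 1 - k) * binomSeries κ s k]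
  have : (m + 1 : A) * algebraMap ℚ A (1 / (m + 1)) = 1 := by
    rw [← map_natCast (algebraMap ℚ A), ← map_one (algebraMap ℚ A), ← map_add, ← map_mul,
      mul_one_div_cancel (by positivity)]
  rw [this, one_mul]

/-- The coefficients of the power series `(1 - y_i z)⁻¹ ∏_{j ∈ s} (1 - y_j z)^{-κ}`. -/
noncomputable def lineSeries (κ : A) (s : Finset ι) (i : ι) : ℕ → MvPolynomial ι A
  | 0 => 1
  | m + 1 => X i * lineSeries κ s i m + binomSeries κ s (m + 1)

theorem lineSeries_eq_sum (κ : A) (s : Finset ι) (i : ι) (m : ℕ) :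
    lineSeries κ s i m = ∑ k ∈ Finset.range (m + 1), X i ^ (m - k) * binomSeries κ s k := by
  induction m with
  | zero => simp [lineSeries, binomSeries_zero]
  | succ m ih =>
    rw [lineSeries, ih, Finset.sum_range_succ _ (m + 1), Finset.mul_sum]
    simp only [Nat.sub_self, pow_zero, one_mul, add_left_inj]
    refine Finset.sum_congr rfl fun k hk => ?_
    rw [Nat.sub_add_comm (Nat.lt_succ_iff.1 (Finset.mem_range.1 hk)), pow_succ', mul_assoc]

theorem sum_lineSeries (κ : A) (s : Finset ι) (m : ℕ) :
    ∑ i ∈ s, lineSeries κ s i m =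
      ∑ k ∈ Finset.range (m + 1), powSum A s (m - k) * binomSeries κ s k := by
  simp_rw [lineSeries_eq_sum]
  rw [Finset.sum_comm]
  exact Finset.sum_congr rfl fun k _ => by rw [powSum, Finset.sum_mul]

theorem lineSeries_recurrence (κ : A) (s : Finset ι) (i : ι) (m : ℕ) :
    C (m + 1 + κ * s.card) * (X i * lineSeries κ s i m) =
      C (m + 1 + κ * s.card) * lineSeries κ s i (m + 1)
        - C κ * ∑ j ∈ s, lineSeries κ s j (m + 1) := by
  have h := mul_binomSeries_succ κ s m
  have h0 : powSum A s 0 = C (s.card : A) := by simp [powSum]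
  rw [sum_lineSeries, Finset.sum_range_succ, Nat.sub_self, h0, mul_add, ← h, lineSeries,
    map_add C (m + 1 : A), C_mul]
  ring

variable [DecidableEq ι] [IsDomain A]

theorem pairing_lineSeries (κ : A) (s : Finset ι) (hκ : ∀ m : ℕ, (m + 1 + κ * s.card : A) ≠ 0)
    [CharZero A] (m : ℕ) (g : MvPolynomial ι A) :
    ∀ i ∈ s, pairing κ s (lineSeries κ s i m) g =
      (∏ j ∈ Finset.range m, (j + 1 + κ * s.card : A)) * coeff (Finsupp.single i m) g := by
  induction m generalizing g with
  | zero =>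
    intro i _
    rw [lineSeries, pairing, map_one]
    simp [constantCoeff_eq]
  | succ m ih =>
    set P : A := ∏ j ∈ Finset.range (m + 1), (j + 1 + κ * s.card : A) with hP
    set v : ι → A := fun i => pairing κ s (lineSeries κ s i (m + 1)) g -
      P * coeff (Finsupp.single i (m + 1)) g with hv
    have key : ∀ i ∈ s, (m + 1 + κ * s.card : A) * v i = κ * ∑ j ∈ s, v j := by
      intro i hi
      have h1 := congrArg (fun f => pairing κ s f g) (lineSeries_recurrence κ s i m)
      simp only [sub_eq_add_neg, ← neg_mul, ← C_neg, pairing_add_left, pairing_C_mul_left,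
        pairing_sum_left] at h1
      rw [mul_comm (X i), pairing_mul_X κ hi, ih _ i hi, coeff_single_dunkl κ hi] at h1
      rw [hv, Finset.sum_sub_distrib, ← Finset.mul_sum, hP, Finset.prod_range_succ]
      linear_combination -h1
    have hsum : ∑ j ∈ s, v j = 0 := by
      have h2 : ∑ i ∈ s, (m + 1 + κ * s.card : A) * v i = ∑ i ∈ s, κ * ∑ j ∈ s, v j :=
        Finset.sum_congr rfl key
      rw [← Finset.mul_sum, Finset.sum_const, nsmul_eq_mul] at h2
      have h3 : ((m + 1 : ℕ) : A) * ∑ j ∈ s, v j = 0 := by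
        push_cast
        linear_combination h2
      exact (mul_eq_zero.1 h3).resolve_left (Nat.cast_ne_zero.2 (Nat.succ_ne_zero m))
    intro i hi
    have := key i hi
    rw [hsum, mul_zero] at this
    exact sub_eq_zero.1 ((mul_eq_zero.1 this).resolve_left (hκ m))

end LineFormula

section Perturbation

variable {ι : Type*} {A : Type*} [CommRing A] [Algebra ℚ A]

/-- The derivative of `binomSeries κ s` with respect to `κ`. -/
noncomputable def binomDeriv (κ : A) (s : Finset ι) : ℕ → MvPolynomial ι A
  | 0 => 0
  | m + 1 => C (algebraMap ℚ A (1 / (m + 1))) *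
      ∑ k : Fin (m + 1), powSum A s (m + 1 - k) * (binomSeries κ s k + C κ * binomDeriv κ s k)

/-- The derivative of `lineSeries κ s i` with respect to `κ`. -/
noncomputable def lineDeriv (κ : A) (s : Finset ι) (i : ι) : ℕ → MvPolynomial ι A
  | 0 => 0
  | m + 1 => X i * lineDeriv κ s i m + binomDeriv κ s (m + 1)

theorem mul_binomDeriv_succ (κ : A) (s : Finset ι) (m : ℕ) :
    C (m + 1 : A) * binomDeriv κ s (m + 1) = ∑ k ∈ Finset.range (m + 1),
      powSum A s (m + 1 - k) * (binomSeries κ s k + C κ * binomDeriv κ s k) := by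
  rw [binomDeriv, ← mul_assoc, ← map_mul, Finset.sum_range fun k =>
    powSum A s (m + 1 - k) * (binomSeries κ s k + C κ * binomDeriv κ s k)]
  have : (m + 1 : A) * algebraMap ℚ A (1 / (m + 1)) = 1 := by
    rw [← map_natCast (algebraMap ℚ A), ← map_one (algebraMap ℚ A), ← map_add, ← map_mul,
      mul_one_div_cancel (by positivity)]
  rw [this, map_one, one_mul]

theorem isHomogeneous_binomSeries (κ : A) (s : Finset ι) (m : ℕ) :
    (binomSeries κ s m).IsHomogeneous m := by
  induction m using Nat.strong_induction_on with
  | _ m ih =>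
    cases m with
    | zero => rw [binomSeries]; exact isHomogeneous_one _ _
    | succ m =>
      rw [binomSeries]
      refine (IsHomogeneous.sum _ _ _ fun k _ => ?_).C_mul _
      have := (isHomogeneous_powSum (A := A) s (m + 1 - k)).mul (ih k k.2)
      rwa [Nat.sub_add_cancel k.2.le] at this

theorem isHomogeneous_binomDeriv (κ : A) (s : Finset ι) (m : ℕ) :
    (binomDeriv κ s m).IsHomogeneous m := by
  induction m using Nat.strong_induction_on with
  | _ m ih =>
    cases m with
    | zero => rw [binomDeriv]; exact isHomogeneous_zero _ _ _
    | succ m =>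
      rw [binomDeriv]
      refine (IsHomogeneous.sum _ _ _ fun k _ => ?_).C_mul _
      have h2 : (C κ * binomDeriv κ s k).IsHomogeneous (k : ℕ) := by
        simpa using (isHomogeneous_C ι κ).mul (ih k k.2)
      have := (isHomogeneous_powSum (A := A) s (m + 1 - k)).mul
        ((isHomogeneous_binomSeries κ s k).add h2)
      rwa [Nat.sub_add_cancel k.2.le] at this

theorem isHomogeneous_lineDeriv (κ : A) (s : Finset ι) (i : ι) (m : ℕ) :
    (lineDeriv κ s i m).IsHomogeneous m := by
  induction m with
  | zero => rw [lineDeriv]; exact isHomogeneous_zero _ _ _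
  | succ m ih =>
    rw [lineDeriv]
    refine IsHomogeneous.add ?_ (isHomogeneous_binomDeriv κ s (m + 1))
    rw [add_comm]
    exact (isHomogeneous_X A i).mul ih

omit [Algebra ℚ A] in
theorem map_powSum {B : Type*} [CommRing B] (f : A →+* B) (s : Finset ι) (m : ℕ) :
    map f (powSum A s m) = powSum B s m := by
  simp [powSum]

theorem exists_binomSeries_eq (κ : A) (s : Finset ι) (m : ℕ) :
    ∃ r, binomSeries (Polynomial.C κ + Polynomial.X) s m =
      map Polynomial.C (binomSeries κ s m) +
        C Polynomial.X * map Polynomial.C (binomDeriv κ s m) + C Polynomial.X ^ 2 * r := by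
  induction m using Nat.strong_induction_on with
  | _ m ih =>
    cases m with
    | zero => exact ⟨0, by simp [binomSeries, binomDeriv]⟩
    | succ m =>
      choose r hr using fun k : Fin (m + 1) => ih k k.2
      set P := powSum (Polynomial A) s with hP
      refine ⟨C (algebraMap ℚ (Polynomial A) (1 / (m + 1))) * (∑ k : Fin (m + 1),
        P (m + 1 - k) * ((C (Polynomial.C κ) + C Polynomial.X) * r k +
          map Polynomial.C (binomDeriv κ s k))), ?_⟩
      rw [binomSeries, binomSeries, binomDeriv]
      simp only [hr, map_mul, map_sum, map_add, map_C, map_powSum, ← hP, Finset.mul_sum,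
        ← Finset.sum_add_distrib]
      refine Finset.sum_congr rfl fun k _ => ?_
      have : Polynomial.C (algebraMap ℚ A (1 / (m + 1))) =
        algebraMap ℚ (Polynomial A) (1 / (m + 1)) := rfl
      rw [this]
      ring

theorem exists_lineSeries_eq (κ : A) (s : Finset ι) (i : ι) (m : ℕ) :
    ∃ r, lineSeries (Polynomial.C κ + Polynomial.X) s i m =
      map Polynomial.C (lineSeries κ s i m) +
        C Polynomial.X * map Polynomial.C (lineDeriv κ s i m) + C Polynomial.X ^ 2 * r := by
  induction m with
  | zero => exact ⟨0, by simp [lineSeries, lineDeriv]⟩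
  | succ m ih =>
    obtain ⟨r, hr⟩ := ih
    obtain ⟨r', hr'⟩ := exists_binomSeries_eq κ s (m + 1)
    refine ⟨X i * r + r', ?_⟩
    rw [lineSeries, hr, hr', lineSeries, lineDeriv]
    simp only [map_add, map_mul, map_X]
    ring

theorem pairing_lineDeriv [DecidableEq ι] [IsDomain A] [CharZero A] {s : Finset ι} {c : ℕ}
    (hc : 1 ≤ c)
    {i : ι} (hi : i ∈ s) (h0 : lineSeries (-c : A) s i (c * s.card) = 0) :
    ∃ ρ : A, ρ ≠ 0 ∧ ∀ g, pairing (-c : A) s (lineDeriv (-c : A) s i (c * s.card)) g =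
      ρ * coeff (Finsupp.single i (c * s.card)) g := by
  have hn : 1 ≤ s.card := Finset.card_pos.2 ⟨i, hi⟩
  obtain ⟨N, hN⟩ : ∃ N, c * s.card = N + 1 :=
    ⟨c * s.card - 1, (Nat.sub_add_cancel (Nat.mul_pos hc hn)).symm⟩
  have hNA : (c * s.card : A) = N + 1 := by exact_mod_cast hN
  set κ : Polynomial A := Polynomial.C (-c : A) + Polynomial.X with hκ
  have h1 : ∀ m : ℕ, (m + 1 + κ * s.card : Polynomial A) ≠ 0 := by
    intro m hm
    have := congrArg (Polynomial.coeff · 1) hm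
    rw [hκ] at this
    rw [add_mul, ← Polynomial.C_eq_natCast, ← Polynomial.C_eq_natCast] at this
    simp [Polynomial.coeff_one] at this
    simp [this] at hn
  obtain ⟨r, hr⟩ := exists_lineSeries_eq (-c : A) s i (c * s.card)
  rw [h0, map_zero, zero_add] at hr
  refine ⟨s.card * ∏ j ∈ Finset.range N, (j + 1 + (-c : A) * s.card), ?_, fun g => ?_⟩
  · refine mul_ne_zero (Nat.cast_ne_zero.2 (by omega)) (Finset.prod_ne_zero_iff.2 fun j hj => ?_)
    rw [neg_mul, hNA]
    intro h
    have h' : (j : A) = N := by linear_combination h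
    rw [Nat.cast_inj] at h'
    simp [h'] at hj
  · have h2 := pairing_lineSeries κ s h1 (c * s.card) (map Polynomial.C g) i hi
    rw [hr, pow_two, mul_assoc, ← mul_add, pairing_C_mul_left, hN, Finset.prod_range_succ] at h2
    have h3 : ((N : Polynomial A) + 1 + κ * (s.card : Polynomial A)) = Polynomial.X * (s.card : Polynomial A) := by
      have : (c * s.card : Polynomial A) = N + 1 := by exact_mod_cast hN
      rw [hκ, ← this, Polynomial.C_neg, map_natCast]
      ring
    rw [h3, mul_comm (Finset.prod _ _), mul_assoc, mul_assoc] at h2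
    have h4 := congrArg (Polynomial.evalRingHom (0 : A)) (mul_left_cancel₀ Polynomial.X_ne_zero h2)
    rw [map_pairing] at h4
    have e1 : Polynomial.evalRingHom (0 : A) κ = -c := by simp [hκ]
    have e2 : ∀ p : MvPolynomial ι A, map (Polynomial.evalRingHom (0 : A)) (map Polynomial.C p) = p := by
      intro p
      rw [map_map]
      convert map_id p
      ext; simp
    rw [e1, map_add (map _), e2, e2, map_mul (map _), map_C] at h4
    simp only [coeff_map, map_mul, map_prod, map_add _ _ (1 : Polynomial A),
      map_add _ _ (_ * _ : Polynomial A), e1, map_natCast, map_one] at h4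
    rw [hN]
    simp at h4
    simp [h4, mul_assoc]

end Perturbation

section PolynomialODE

/-- A polynomial identity forced by residues: `T / H ^ c` cannot be a rational primitive
of `- H' / H`. -/
theorem natDegree_eq_zero_of_derivative_eq {K : Type*} [Field K] [CharZero K]
    {H T : Polynomial K} {c : ℕ}
    (h : H * T.derivative = H.derivative * ((c : Polynomial K) * T - H ^ c)) : H.natDegree = 0 := by
  by_contra hd
  have hH : H ≠ 0 := by rintro rfl; simp at hd
  set d := H.natDegree with hdd
  set t := T.natDegree with ht
  set N := max t (c * d) with hN
  have hc : ∀ p : Polynomial K, ∀ n, (Polynomial.X * p.derivative).coeff n = n * p.coeff n := by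
    intro p n
    cases n with
    | zero => simp
    | succ n => rw [Polynomial.coeff_X_mul, Polynomial.coeff_derivative]; push_cast; ring
  have hdeg : ∀ p : Polynomial K, (Polynomial.X * p.derivative).natDegree ≤ p.natDegree := by
    intro p
    rw [Polynomial.natDegree_le_iff_coeff_eq_zero]
    intro n hn
    rw [hc, Polynomial.coeff_eq_zero_of_natDegree_lt hn, mul_zero]
  have hHc : (H ^ c).natDegree = c * d := Polynomial.natDegree_pow H c
  have h2 : H * (Polynomial.X * T.derivative) =
      (Polynomial.X * H.derivative) * ((c : Polynomial K) * T - H ^ c) := by linear_combination Polynomial.X * h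
  have h3 := congrArg (Polynomial.coeff · (d + N)) h2
  rw [Polynomial.coeff_mul_add_eq_of_natDegree_le le_rfl ((hdeg T).trans (le_max_left _ _)),
    Polynomial.coeff_mul_add_eq_of_natDegree_le (hdeg H), hc, hc, Polynomial.coeff_sub,
    ← Polynomial.C_eq_natCast, Polynomial.coeff_C_mul] at h3
  · have hlead : H.coeff d ≠ 0 := by
      rw [hdd, Polynomial.coeff_natDegree]; exact Polynomial.leadingCoeff_ne_zero.2 hH
    have h4 : ((N : K) - c * d) * T.coeff N = - (d * (H ^ c).coeff N) := by
      apply mul_left_cancel₀ hlead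
      linear_combination h3
    rcases le_or_gt t (c * d) with hle | hlt
    · have hNe : N = c * d := max_eq_right hle
      rw [hNe] at h4
      push_cast at h4
      rw [sub_self, zero_mul, eq_comm, neg_eq_zero, ← hHc, Polynomial.coeff_natDegree,
        Polynomial.leadingCoeff_pow] at h4
      refine mul_ne_zero (Nat.cast_ne_zero.2 hd) (pow_ne_zero c ?_) h4
      exact Polynomial.leadingCoeff_ne_zero.2 hH
    · have hNe : N = t := max_eq_left hlt.le
      rw [hNe, Polynomial.coeff_eq_zero_of_natDegree_lt (hHc.trans_lt hlt), mul_zero, neg_zero,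
        mul_eq_zero] at h4
      rcases h4 with h4 | h4
      · have : (t : K) = (c * d : ℕ) := by push_cast; linear_combination h4
        rw [Nat.cast_inj] at this
        omega
      · rw [ht, Polynomial.coeff_natDegree, Polynomial.leadingCoeff_eq_zero] at h4
        rw [ht, h4] at hlt
        simp at hlt
  · refine (Polynomial.natDegree_sub_le _ _).trans (max_le ?_ (hHc.le.trans (le_max_right _ _)))
    rw [← Polynomial.C_eq_natCast]
    exact (Polynomial.natDegree_C_mul_le _ _).trans (le_max_left _ _)

end PolynomialODE

section GeneratingSeries

variable {ι : Type*} {A : Type*} [CommRing A]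

/-- The polynomial `∏_{j ∈ s} (1 - y_j z)`. -/
noncomputable def denom (A : Type*) [CommRing A] (s : Finset ι) : Polynomial (MvPolynomial ι A) :=
  ∏ j ∈ s, (1 - Polynomial.C (X j) * Polynomial.X)

/-- The power series `∑_{j ∈ s} y_j / (1 - y_j z)`. -/
noncomputable def powSumSeries (A : Type*) [CommRing A] (s : Finset ι) :
    PowerSeries (MvPolynomial ι A) :=
  PowerSeries.mk fun m => powSum A s (m + 1)

theorem powSum_insert [DecidableEq ι] {s : Finset ι} {j : ι} (hj : j ∉ s) (m : ℕ) :
    powSum A (insert j s) m = X j ^ m + powSum A s m := Finset.sum_insert hj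

theorem derivative_denom [DecidableEq ι] (s : Finset ι) :
    PowerSeries.derivative (MvPolynomial ι A) (denom A s : PowerSeries (MvPolynomial ι A)) =
      - ((denom A s : PowerSeries (MvPolynomial ι A)) * powSumSeries A s) := by
  induction s using Finset.induction_on with
  | empty =>
    have : powSumSeries A (∅ : Finset ι) = 0 := by ext m; simp [powSumSeries, powSum]
    simp [denom, this]
  | insert j s hj ih =>
    have h1 : powSumSeries A (insert j s) =
        PowerSeries.mk (fun m => X j ^ (m + 1)) + powSumSeries A s := by
      ext1 m; simp [powSumSeries, powSum_insert hj]
    have h2 : ((1 : PowerSeries (MvPolynomial ι A)) - PowerSeries.C (X j) * PowerSeries.X) *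
        PowerSeries.mk (fun m => X j ^ (m + 1)) = PowerSeries.C (X j : MvPolynomial ι A) := by
      ext1 m
      rw [sub_mul, one_mul, mul_assoc, map_sub, PowerSeries.coeff_C_mul]
      cases m with
      | zero => simp
      | succ m => rw [PowerSeries.coeff_succ_X_mul]; simp [pow_succ']
    have h3 : (denom A (insert j s) : PowerSeries (MvPolynomial ι A)) =
        ((1 : PowerSeries (MvPolynomial ι A)) - PowerSeries.C (X j) * PowerSeries.X) *
          (denom A s : PowerSeries (MvPolynomial ι A)) := by
      rw [denom, Finset.prod_insert hj, ← denom]; simp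
    rw [h3, h1, Derivation.leibniz, ih, mul_add, mul_right_comm, h2]
    simp [Derivation.leibniz]
    ring

variable [Algebra ℚ A]

theorem derivative_mk_binomSeries (κ : A) (s : Finset ι) :
    PowerSeries.derivative (MvPolynomial ι A) (PowerSeries.mk (binomSeries κ s)) =
      PowerSeries.C (C κ) * (powSumSeries A s * PowerSeries.mk (binomSeries κ s)) := by
  ext1 m
  rw [PowerSeries.coeff_derivative, PowerSeries.coeff_mk, PowerSeries.coeff_C_mul, mul_comm,
    mul_comm (powSumSeries A s), PowerSeries.coeff_mul,
    Finset.Nat.sum_antidiagonal_eq_sum_range_succ_mk]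
  have h := mul_binomSeries_succ κ s m
  simp only [map_add, map_natCast, map_one] at h
  rw [h]
  congr 1
  refine Finset.sum_congr rfl fun k hk => ?_
  rw [Finset.mem_range] at hk
  simp only [powSumSeries, PowerSeries.coeff_mk]
  rw [mul_comm, Nat.sub_add_comm (Nat.lt_succ_iff.1 hk)]

theorem derivative_mk_binomDeriv (κ : A) (s : Finset ι) :
    PowerSeries.derivative (MvPolynomial ι A) (PowerSeries.mk (binomDeriv κ s)) =
      powSumSeries A s * (PowerSeries.mk (binomSeries κ s) +
        PowerSeries.C (C κ) * PowerSeries.mk (binomDeriv κ s)) := by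
  ext1 m
  rw [PowerSeries.coeff_derivative, PowerSeries.coeff_mk, mul_comm,
    mul_comm (powSumSeries A s), PowerSeries.coeff_mul,
    Finset.Nat.sum_antidiagonal_eq_sum_range_succ_mk]
  have h := mul_binomDeriv_succ κ s m
  simp only [map_add, map_natCast, map_one] at h
  rw [h]
  refine Finset.sum_congr rfl fun k hk => ?_
  rw [Finset.mem_range] at hk
  simp only [powSumSeries, PowerSeries.coeff_mk, map_add, PowerSeries.coeff_C_mul]
  rw [mul_comm, Nat.sub_add_comm (Nat.lt_succ_iff.1 hk)]

omit [Algebra ℚ A] in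
theorem eq_zero_of_derivative_eq_mul {R : Type*} [CommRing R] [IsDomain R] [CharZero R]
    {f P : PowerSeries R} (h : PowerSeries.derivative R f = P * f)
    (h0 : PowerSeries.coeff 0 f = 0) : f = 0 := by
  ext1 m
  rw [map_zero]
  induction m using Nat.strong_induction_on with
  | _ m ih =>
    cases m with
    | zero => exact h0
    | succ m =>
      have := congrArg (PowerSeries.coeff m) h
      rw [PowerSeries.coeff_derivative, PowerSeries.coeff_mul, Finset.sum_eq_zero] at this
      · exact (mul_eq_zero.1 this).resolve_right (by exact_mod_cast Nat.succ_ne_zero m)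
      · intro x hx
        rw [ih x.2, mul_zero]
        have := Finset.HasAntidiagonal.mem_antidiagonal.1 hx
        omega

variable [DecidableEq ι] [IsDomain A] [CharZero A]

theorem mk_binomSeries_neg (c : ℕ) (s : Finset ι) :
    PowerSeries.mk (binomSeries (-c : A) s) =
      (denom A s : PowerSeries (MvPolynomial ι A)) ^ c := by
  rw [← sub_eq_zero]
  refine eq_zero_of_derivative_eq_mul
    (P := PowerSeries.C (C (-c : A)) * powSumSeries A s) ?_ ?_
  · rw [map_sub, derivative_mk_binomSeries, PowerSeries.derivative_pow, derivative_denom]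
    cases c with
    | zero => simp
    | succ c =>
      simp only [map_neg, map_natCast, Nat.add_sub_cancel]
      ring
  · rw [map_sub, PowerSeries.coeff_mk, binomSeries_zero, ← Polynomial.coe_pow,
      Polynomial.coeff_coe, sub_eq_zero]
    simp [Polynomial.coeff_zero_eq_eval_zero, denom, Polynomial.eval_prod]

omit [Algebra ℚ A] [IsDomain A] [CharZero A] [DecidableEq ι] in
theorem natDegree_denom_le (s : Finset ι) : (denom A s).natDegree ≤ s.card := by
  refine (Polynomial.natDegree_prod_le _ _).trans ?_
  refine (Finset.sum_le_card_nsmul _ _ 1 fun j _ => ?_).trans (by simp)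
  compute_degree

theorem lineSeries_neg_eq_zero {c : ℕ} (hc : 1 ≤ c) {s : Finset ι} {i : ι} (hi : i ∈ s) {m : ℕ}
    (hm : c * s.card ≤ m) : lineSeries (-c : A) s i m = 0 := by
  set L : Polynomial (MvPolynomial ι A) := 1 - Polynomial.C (X i) * Polynomial.X with hL
  obtain ⟨e, rfl⟩ : ∃ e, c = e + 1 := ⟨c - 1, by omega⟩
  have hd : denom A s = L * denom A (s.erase i) := by
    rw [denom, ← Finset.mul_prod_erase s _ hi, denom]
  have h1 : (L : PowerSeries (MvPolynomial ι A)) *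
      PowerSeries.mk (lineSeries (-(e + 1 : ℕ) : A) s i) =
      PowerSeries.mk (binomSeries (-(e + 1 : ℕ) : A) s) := by
    ext1 n
    rw [hL, Polynomial.coe_sub, Polynomial.coe_one, Polynomial.coe_mul, Polynomial.coe_C,
      Polynomial.coe_X, sub_mul, one_mul, mul_assoc, map_sub, PowerSeries.coeff_C_mul]
    cases n with
    | zero => simp [lineSeries, binomSeries_zero]
    | succ n => rw [PowerSeries.coeff_succ_X_mul]; simp [lineSeries]
  have hL0 : L ≠ 0 := by
    intro h
    have := congrArg (Polynomial.coeff · 0) h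
    simp [hL] at this
  have h2 : PowerSeries.mk (lineSeries (-(e + 1 : ℕ) : A) s i) =
      ((L ^ e * denom A (s.erase i) ^ (e + 1) : Polynomial (MvPolynomial ι A)) :
        PowerSeries (MvPolynomial ι A)) := by
    have hL1 : (L : PowerSeries (MvPolynomial ι A)) ≠ 0 := by simpa using hL0
    apply mul_left_cancel₀ hL1
    rw [h1, mk_binomSeries_neg, hd]
    push_cast
    ring
  have h3 := congrArg (PowerSeries.coeff m) h2
  rw [PowerSeries.coeff_mk, Polynomial.coeff_coe] at h3
  rw [h3]
  apply Polynomial.coeff_eq_zero_of_natDegree_lt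
  refine lt_of_le_of_lt (Polynomial.natDegree_mul_le.trans (add_le_add
    (Polynomial.natDegree_pow_le_of_le e (m := 1) ?_)
    (Polynomial.natDegree_pow_le_of_le (e + 1) (natDegree_denom_le _)))) ?_
  · rw [hL]; compute_degree
  · rw [Finset.card_erase_of_mem hi]
    have : 1 ≤ s.card := Finset.card_pos.2 ⟨i, hi⟩
    obtain ⟨n, hn⟩ : ∃ n, s.card = n + 1 := ⟨s.card - 1, by omega⟩
    rw [hn] at hm ⊢
    simp only [Nat.add_sub_cancel, mul_one]
    nlinarith

omit [IsDomain A] [CharZero A] [DecidableEq ι] in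
theorem lineDeriv_eq_sum (κ : A) (s : Finset ι) (i : ι) (m : ℕ) :
    lineDeriv κ s i m = ∑ k ∈ Finset.range (m + 1), X i ^ (m - k) * binomDeriv κ s k := by
  induction m with
  | zero => simp [lineDeriv, binomDeriv]
  | succ m ih =>
    rw [lineDeriv, ih, Finset.sum_range_succ _ (m + 1), Finset.mul_sum]
    simp only [Nat.sub_self, pow_zero, one_mul, add_left_inj]
    refine Finset.sum_congr rfl fun k hk => ?_
    rw [Nat.sub_add_comm (Nat.lt_succ_iff.1 (Finset.mem_range.1 hk)), pow_succ', mul_assoc]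

omit [IsDomain A] [CharZero A] [DecidableEq ι] in
theorem sum_lineDeriv (κ : A) (s : Finset ι) (m : ℕ) :
    ∑ i ∈ s, lineDeriv κ s i m =
      ∑ k ∈ Finset.range (m + 1), powSum A s (m - k) * binomDeriv κ s k := by
  simp_rw [lineDeriv_eq_sum]
  rw [Finset.sum_comm]
  exact Finset.sum_congr rfl fun k _ => by rw [powSum, Finset.sum_mul]

theorem mul_binomDeriv_neg {c : ℕ} (hc : 1 ≤ c) {s : Finset ι} (hs : s.Nonempty) {m : ℕ}
    (hm : c * s.card ≤ m) : C (m + 1 - c * s.card : A) * binomDeriv (-c : A) s (m + 1) =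
      - C (c : A) * ∑ j ∈ s, lineDeriv (-c : A) s j (m + 1) := by
  obtain ⟨i, hi⟩ := hs
  have h0 : powSum A s 0 = C (s.card : A) := by simp [powSum]
  have hb : binomSeries (-c : A) s (m + 1) = 0 := by
    have := lineSeries_neg_eq_zero (A := A) hc hi (hm.trans (Nat.le_succ m))
    rw [lineSeries, lineSeries_neg_eq_zero hc hi hm, mul_zero, zero_add] at this
    exact this
  have h1 := sum_lineSeries (-c : A) s (m + 1)
  rw [Finset.sum_eq_zero fun j hj => lineSeries_neg_eq_zero hc hj (hm.trans (Nat.le_succ m)),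
    Finset.sum_range_succ, hb, mul_zero, add_zero] at h1
  have h2 := mul_binomDeriv_succ (-c : A) s m
  simp only [mul_add, Finset.sum_add_distrib] at h2
  rw [← h1, zero_add] at h2
  rw [sum_lineDeriv, Finset.sum_range_succ, Nat.sub_self, h0, mul_add, Finset.mul_sum]
  simp only [mul_left_comm _ (C (-c : A)), ← Finset.mul_sum] at h2
  simp only [map_add, map_sub, map_neg, map_mul] at h2 ⊢
  rw [← Finset.mul_sum]
  linear_combination h2

end GeneratingSeries

section IsolatedZero

variable {ι : Type*} {K : Type*} [Field K] [CharZero K] [Algebra ℚ K] [DecidableEq ι]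

theorem eval_lineDeriv_eq_zero_of_le {c : ℕ} (hc : 1 ≤ c) {s : Finset ι} (y : ι → K) {m : ℕ}
    (hm : c * s.card ≤ m) (h : ∀ i ∈ s, eval y (lineDeriv (-c : K) s i m) = 0) {m' : ℕ}
    (hm' : m ≤ m') : ∀ i ∈ s, eval y (lineDeriv (-c : K) s i m') = 0 := by
  induction m', hm' using Nat.le_induction with
  | base => exact h
  | succ n hn ih =>
    intro i hi
    have hcn : (n + 1 - c * s.card : K) ≠ 0 := by
      have : c * s.card < n + 1 := by omega
      rw [sub_ne_zero]
      exact_mod_cast this.ne'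
    have h1 := congrArg (eval y) (mul_binomDeriv_neg (A := K) hc ⟨i, hi⟩ (hm.trans hn))
    have h2 : ∀ j ∈ s, eval y (lineDeriv (-c : K) s j (n + 1)) =
        eval y (binomDeriv (-c : K) s (n + 1)) := by
      intro j hj
      rw [lineDeriv, map_add, map_mul, ih j hj, mul_zero, zero_add]
    rw [map_mul, eval_C, map_mul, map_neg, eval_C, map_sum, Finset.sum_congr rfl h2,
      Finset.sum_const, nsmul_eq_mul] at h1
    rw [h2 i hi]
    have h3 : (n + 1 : K) * eval y (binomDeriv (-c : K) s (n + 1)) = 0 := by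
      linear_combination h1
    exact (mul_eq_zero.1 h3).resolve_left (by exact_mod_cast Nat.succ_ne_zero n)

theorem eq_zero_of_eval_lineDeriv_eq_zero {c : ℕ} (hc : 1 ≤ c) {s : Finset ι} (y : ι → K) {m : ℕ}
    (hm : c * s.card ≤ m) (h : ∀ i ∈ s, eval y (lineDeriv (-c : K) s i m) = 0) :
    ∀ i ∈ s, y i = 0 := by
  intro i hi
  set φ : MvPolynomial ι K →+* K := eval y with hφ
  set H : Polynomial K := (denom K s).map φ with hH
  have hT0 : ∀ n, m < n → φ (binomDeriv (-c : K) s n) = 0 := by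
    intro n hn
    obtain ⟨n, rfl⟩ : ∃ k, n = k + 1 := ⟨n - 1, by omega⟩
    have h1 := eval_lineDeriv_eq_zero_of_le hc y hm h (m' := n + 1) (by omega) i hi
    have h2 := eval_lineDeriv_eq_zero_of_le hc y hm h (m' := n) (by omega) i hi
    rwa [lineDeriv, map_add, map_mul, h2, mul_zero, zero_add] at h1
  set T : Polynomial K := PowerSeries.trunc (m + 1)
    (PowerSeries.mk fun n => φ (binomDeriv (-c : K) s n)) with hT
  have hTc : (T : PowerSeries K) = PowerSeries.map φ (PowerSeries.mk (binomDeriv (-c : K) s)) := by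
    ext n
    rw [Polynomial.coeff_coe, hT, PowerSeries.coeff_trunc]
    split_ifs with hn
    · simp
    · simp [hT0 n (by omega)]
  have hHc : (H : PowerSeries K) =
      PowerSeries.map φ (denom K s : PowerSeries (MvPolynomial ι K)) := by
    ext n
    simp [hH]
  have hmap : ∀ f : PowerSeries (MvPolynomial ι K),
      PowerSeries.derivative K (PowerSeries.map φ f) =
        PowerSeries.map φ (PowerSeries.derivative _ f) := by
    intro f
    ext n
    simp [PowerSeries.coeff_derivative]
  have hode : H * T.derivative = H.derivative * ((c : Polynomial K) * T - H ^ c) := by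
    rw [← Polynomial.coe_inj]
    push_cast
    rw [← PowerSeries.derivative_coe, ← PowerSeries.derivative_coe, hTc, hHc, hmap, hmap,
      derivative_denom, derivative_mk_binomDeriv, mk_binomSeries_neg]
    simp only [map_mul, map_add, map_neg, map_pow, map_natCast]
    have hcc : ((c : Polynomial K) : PowerSeries K) = c := by
      rw [← Polynomial.C_eq_natCast, Polynomial.coe_C, map_natCast]
    rw [hcc]
    ring
  have hdeg := natDegree_eq_zero_of_derivative_eq hode
  rw [Polynomial.natDegree_eq_zero] at hdeg
  obtain ⟨a, ha⟩ := hdeg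
  have hHe : ∀ x, H.eval x = ∏ j ∈ s, (1 - y j * x) := by
    intro x
    simp [hH, denom, Polynomial.map_prod, Polynomial.eval_prod, hφ]
  by_contra hy
  have e1 := hHe 0
  have e2 := hHe (y i)⁻¹
  rw [Finset.prod_eq_zero hi (by rw [mul_inv_cancel₀ hy, sub_self])] at e2
  rw [← ha, Polynomial.eval_C] at e1 e2
  rw [e2] at e1
  simp at e1

end IsolatedZero

section CoefficientIn

variable {ι : Type*} [DecidableEq ι] {A : Type*} [CommRing A]

/-- A polynomial viewed as a univariate polynomial in `X i`. -/
noncomputable def inVariable (i : ι) :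
    MvPolynomial ι A →ₐ[A] Polynomial (MvPolynomial ι A) :=
  aeval fun l => if l = i then Polynomial.X else Polynomial.C (X l)

theorem inVariable_monomial (i : ι) (u : ι →₀ ℕ) (a : A) :
    inVariable i (monomial u a) = Polynomial.monomial (u i) (monomial (u.erase i) a) := by
  rw [inVariable, aeval_monomial, ← Finsupp.mul_prod_erase' u i _ (fun _ => pow_zero _),
    if_pos rfl, ← Polynomial.C_mul_X_pow_eq_monomial, monomial_eq (s := u.erase i)]
  have : (u.erase i).prod (fun l k => (if l = i then Polynomial.X else
      Polynomial.C (X l : MvPolynomial ι A)) ^ k) =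
      Polynomial.C ((u.erase i).prod fun l k => (X l : MvPolynomial ι A) ^ k) := by
    rw [Finsupp.prod, Finsupp.prod, map_prod]
    refine Finset.prod_congr rfl fun l hl => ?_
    rw [if_neg, map_pow]
    rintro rfl
    simp at hl
  rw [this, Polynomial.algebraMap_apply, algebraMap_eq, map_mul]
  ring

theorem coeff_coeff_inVariable (i : ι) (p : ℕ) (f : MvPolynomial ι A) (m : ι →₀ ℕ) :
    coeff m ((inVariable i f).coeff p) =
      if m i = 0 then coeff (m + Finsupp.single i p) f else 0 := by
  induction f using MvPolynomial.induction_on' with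
  | add f g hf hg => rw [map_add, Polynomial.coeff_add, coeff_add, hf, hg]; split_ifs <;> simp
  | monomial u a =>
    rw [inVariable_monomial, Polynomial.coeff_monomial, apply_ite (coeff m), coeff_monomial,
      coeff_monomial, coeff_zero]
    have : u i = p ∧ u.erase i = m ↔ m i = 0 ∧ u = m + Finsupp.single i p := by
      constructor
      · rintro ⟨rfl, rfl⟩
        exact ⟨Finsupp.erase_same, (Finsupp.erase_add_single i u).symm⟩
      · rintro ⟨h1, rfl⟩
        refine ⟨by simp [h1], ?_⟩
        rw [Finsupp.erase_add, Finsupp.erase_single, add_zero, Finsupp.erase_of_notMem_support]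
        simpa using h1
    by_cases h1 : u i = p <;> by_cases h2 : m i = 0 <;> simp_all

theorem inVariable_X_mul {i l : ι} (h : l ≠ i) (f : MvPolynomial ι A) :
    inVariable i (X l * f) = Polynomial.C (X l) * inVariable i f := by
  rw [map_mul, inVariable, aeval_X, if_neg h]

theorem inVariable_rename {i : ι} {w : Equiv.Perm ι} (hw : w i = i) (f : MvPolynomial ι A) :
    inVariable i (rename w f) = (inVariable i f).map (rename (R := A) w).toRingHom := by
  have h : (inVariable i).comp (rename (R := A) w) =
      (Polynomial.mapAlgHom (rename (R := A) w)).comp (inVariable i) := by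
    ext1 l
    simp only [AlgHom.comp_apply, rename_X, inVariable, aeval_X]
    rcases eq_or_ne l i with rfl | hl
    · simp [hw]
    · rw [if_neg hl, if_neg]
      · simp
      · rw [← hw]; exact w.injective.ne hl
  exact congrArg (fun φ => φ f) h

theorem coeff_inVariable_divDiff [IsDomain A] {i j l : ι} (hj : j ≠ i) (hl : l ≠ i) (h : j ≠ l)
    (p : ℕ) (f : MvPolynomial ι A) :
    (inVariable i (divDiff j l f)).coeff p = divDiff j l ((inVariable i f).coeff p) := by
  symm
  rw [divDiff_eq_iff h]
  have h1 := congrArg (fun g => (inVariable i g).coeff p) (X_sub_X_mul_divDiff h f)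
  simp only [sub_mul, map_sub, inVariable_X_mul hj, inVariable_X_mul hl, Polynomial.coeff_sub,
    Polynomial.coeff_C_mul] at h1
  rw [inVariable_rename (Equiv.swap_apply_of_ne_of_ne hj.symm hl.symm), Polynomial.coeff_map] at h1
  rw [sub_mul]
  exact h1

theorem coeff_inVariable_pderiv {i j : ι} (hj : j ≠ i) (p : ℕ) (f : MvPolynomial ι A) :
    (inVariable i (pderiv j f)).coeff p = pderiv j ((inVariable i f).coeff p) := by
  ext m
  rw [coeff_coeff_inVariable, coeff_pderiv, coeff_pderiv, coeff_coeff_inVariable]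
  simp only [Finsupp.add_apply, Finsupp.single_apply, if_neg hj, if_neg hj.symm, add_zero]
  split_ifs
  · rw [add_right_comm]
  · simp

theorem coeff_inVariable_eq_zero {i : ι} {p : ℕ} {f : MvPolynomial ι A} (h : degreeOf i f < p) :
    (inVariable i f).coeff p = 0 := by
  ext m
  rw [coeff_coeff_inVariable, coeff_zero, ite_eq_right_iff]
  intro hm
  by_contra h0
  have := monomial_le_degreeOf i (mem_support_iff.2 h0)
  simp [hm] at this
  omega

theorem coeff_inVariable_degreeOf_ne_zero (i : ι) {f : MvPolynomial ι A} (h : f ≠ 0) :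
    (inVariable i f).coeff (degreeOf i f) ≠ 0 := by
  obtain ⟨u, hu, hd⟩ : ∃ u ∈ f.support, u i = degreeOf i f := by
    rw [degreeOf_eq_sup]
    obtain ⟨u, hu, hd⟩ := Finset.exists_mem_eq_sup _ (support_nonempty.2 h) fun m : ι →₀ ℕ => m i
    exact ⟨u, hu, hd.symm⟩
  intro h0
  have := coeff_coeff_inVariable i (degreeOf i f) f (u.erase i)
  rw [h0, coeff_zero, if_pos Finsupp.erase_same, ← hd, Finsupp.erase_add_single] at this
  exact mem_support_iff.1 hu this.symm

theorem isHomogeneous_coeff_inVariable (i : ι) (p : ℕ) {f : MvPolynomial ι A} {d : ℕ}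
    (hf : f.IsHomogeneous d) : ((inVariable i f).coeff p).IsHomogeneous (d - p) := by
  intro m hm
  rw [coeff_coeff_inVariable] at hm
  have h1 := hf (fun h => hm (by simp [h]) : coeff (m + Finsupp.single i p) f ≠ 0)
  rw [Finsupp.weight_apply, Finsupp.sum_add_index' (by simp) (by simp)] at h1
  simp only [Pi.one_apply, smul_eq_mul, mul_one, Finsupp.sum_single_index] at h1
  rw [Finsupp.weight_apply]
  simp only [Pi.one_apply, smul_eq_mul, mul_one]
  omega

theorem degreeOf_coeff_inVariable_le (i l : ι) (p : ℕ) (f : MvPolynomial ι A) :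
    degreeOf l ((inVariable i f).coeff p) ≤ degreeOf l f := by
  rw [degreeOf_le_iff]
  intro m hm
  rw [mem_support_iff, coeff_coeff_inVariable] at hm
  have := monomial_le_degreeOf l (mem_support_iff.2
    (fun h => hm (by simp [h]) : coeff (m + Finsupp.single i p) f ≠ 0))
  rw [Finsupp.add_apply] at this
  omega

theorem degreeOf_coeff_inVariable_self (i : ι) (p : ℕ) (f : MvPolynomial ι A) :
    degreeOf i ((inVariable i f).coeff p) = 0 := by
  rw [← Nat.le_zero, degreeOf_le_iff]
  intro m hm
  rw [mem_support_iff, coeff_coeff_inVariable] at hm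
  by_contra h
  rw [if_neg (by omega)] at hm
  exact hm rfl

omit [DecidableEq ι] in
theorem degreeOf_le_of_isHomogeneous (i : ι) {f : MvPolynomial ι A} {d : ℕ}
    (hf : f.IsHomogeneous d) : degreeOf i f ≤ d :=
  (degreeOf_le_totalDegree f i).trans hf.totalDegree_le

theorem divDiff_swap [IsDomain A] {i j : ι} (h : i ≠ j) (f : MvPolynomial ι A) :
    divDiff j i f = - divDiff i j f := by
  rw [divDiff_eq_iff h.symm, mul_neg, ← neg_mul, neg_sub, X_sub_X_mul_divDiff h, Equiv.swap_comm]

theorem coeff_inVariable_dunkl [IsDomain A] (κ : A) {s : Finset ι} {i j : ι} (hi : i ∈ s)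
    (hj : j ∈ s.erase i) {p : ℕ} (hp : 0 < p) {f : MvPolynomial ι A} (hfi : degreeOf i f ≤ p)
    (hfj : degreeOf j f ≤ p) :
    (inVariable i (dunkl κ s j f)).coeff p =
      dunkl κ (s.erase i) j ((inVariable i f).coeff p) := by
  have hji := Finset.ne_of_mem_erase hj
  obtain ⟨q, rfl⟩ : ∃ q, p = q + 1 := ⟨p - 1, by omega⟩
  have h0 : (inVariable i (divDiff j i f)).coeff (q + 1) = 0 := by
    apply coeff_inVariable_eq_zero
    rw [divDiff_swap hji.symm, degreeOf_neg]
    exact Nat.lt_succ_of_le (degreeOf_divDiff_lt hji.symm hfi hfj)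
  rw [dunkl_apply, dunkl_apply, map_add, Polynomial.coeff_add, coeff_inVariable_pderiv hji,
    map_smul, Polynomial.coeff_smul, map_sum, Polynomial.finsetSum_coeff,
    ← Finset.add_sum_erase (s.erase j) _ (Finset.mem_erase.2 ⟨hji.symm, hi⟩), h0, zero_add,
    Finset.erase_right_comm]
  congr 2
  refine Finset.sum_congr rfl fun l hl => ?_
  simp only [Finset.mem_erase] at hl
  exact coeff_inVariable_divDiff hji hl.2.1 hl.1.symm _ f

end CoefficientIn

section Nondegenerate

variable {ι : Type*} [DecidableEq ι] {K : Type*} [Field K] [CharZero K] [Algebra ℚ K]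

omit [DecidableEq ι] [CharZero K] [Algebra ℚ K] in
theorem constantCoeff_of_isHomogeneous {f : MvPolynomial ι K} {d : ℕ} (hf : f.IsHomogeneous d)
    (hd : d ≠ 0) : constantCoeff f = 0 := by
  rw [constantCoeff_eq]
  exact hf.coeff_eq_zero (by simpa using hd.symm)

theorem eq_zero_of_dunkl_eq_zero {c : ℕ} (hc : 1 ≤ c) (s : Finset ι) {g : MvPolynomial ι K}
    {d : ℕ} (hd : d ≠ 0) (hg : g.IsHomogeneous d) (hv : ∀ l ∉ s, degreeOf l g = 0)
    (h : ∀ i ∈ s, dunkl (-c : K) s i g = 0) : g = 0 := by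
  induction s using Finset.strongInduction generalizing g d with
  | H s ih =>
  by_contra hg0
  obtain ⟨u, hu⟩ := support_nonempty.2 hg0
  have hud : u.degree = d := by
    by_contra h'
    exact mem_support_iff.1 hu (hg.coeff_eq_zero h')
  have hs : s.Nonempty := by
    rw [Finset.nonempty_iff_ne_empty]
    rintro rfl
    have : u = 0 := by
      ext l
      have := monomial_le_degreeOf l hu
      rw [hv l (by simp)] at this
      simpa using this
    simp [this] at hud
    exact hd hud.symm
  obtain ⟨i, hi, hmax⟩ := Finset.exists_max_image s (fun j => degreeOf j g) hs
  set p := degreeOf i g with hp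
  have hp0 : 0 < p := by
    rw [Nat.pos_iff_ne_zero]
    intro h0
    have : u = 0 := by
      ext l
      have h1 := monomial_le_degreeOf l hu
      by_cases hl : l ∈ s
      · have := hmax l hl
        simp; omega
      · rw [hv l hl] at h1
        simpa using h1
    simp [this] at hud
    exact hd hud.symm
  have hlead : (inVariable i g).coeff p ≠ 0 := coeff_inVariable_degreeOf_ne_zero i hg0
  have hhom := isHomogeneous_coeff_inVariable i p hg
  have hpd : p ≤ d := degreeOf_le_of_isHomogeneous i hg
  have hpd' : p = d := by
    by_contra hne
    refine hlead (ih (s.erase i) (Finset.erase_ssubset hi) (by omega : d - p ≠ 0) hhom ?_ ?_)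
    · intro l hl
      rcases eq_or_ne l i with rfl | hli
      · exact degreeOf_coeff_inVariable_self _ _ _
      · rw [← Nat.le_zero, ← hv l fun hls => hl (Finset.mem_erase.2 ⟨hli, hls⟩)]
        exact degreeOf_coeff_inVariable_le _ _ _ _
    · intro j hj
      have hjs := Finset.mem_of_mem_erase hj
      rw [← coeff_inVariable_dunkl _ hi hj hp0 le_rfl (hmax j hjs), h j hjs]
      simp
  have hci : coeff (Finsupp.single i d) g ≠ 0 := by
    intro h0
    apply hlead
    rw [hpd', Nat.sub_self] at hhom
    rw [hpd']
    ext m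
    rw [coeff_zero]
    by_cases hm : m = 0
    · rw [hm, coeff_coeff_inVariable, if_pos (by simp), zero_add, h0]
    · exact hhom.coeff_eq_zero (by rwa [Ne, Finsupp.degree_eq_zero_iff])
  obtain ⟨e, rfl⟩ : ∃ e, d = e + 1 := ⟨d - 1, by omega⟩
  set S := ∑ j ∈ s, coeff (Finsupp.single j (e + 1)) g with hS
  have h1 : ∀ j ∈ s, ((e + 1 - c * s.card : K)) * coeff (Finsupp.single j (e + 1)) g + c * S = 0 := by
    intro j hj
    have := coeff_single_dunkl (-c : K) hj g e
    rw [h j hj, coeff_zero] at this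
    linear_combination -this
  have h2 : (e + 1 : K) * S = 0 := by
    have := Finset.sum_eq_zero h1
    rw [Finset.sum_add_distrib, ← Finset.mul_sum, Finset.sum_const, nsmul_eq_mul, ← hS] at this
    linear_combination this
  have hS0 : S = 0 := (mul_eq_zero.1 h2).resolve_left (by exact_mod_cast Nat.succ_ne_zero e)
  have h3 := h1 i hi
  rw [hS0, mul_zero, add_zero] at h3
  have h4 := (mul_eq_zero.1 h3).resolve_right hci
  have h5 : c * s.card = e + 1 := by
    have : ((c * s.card : ℕ) : K) = (e + 1 : ℕ) := by push_cast; linear_combination -h4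
    exact_mod_cast this
  obtain ⟨ρ, hρ, hpair⟩ := pairing_lineDeriv hc hi (lineSeries_neg_eq_zero (A := K) hc hi le_rfl)
  have h6 := hpair g
  rw [pairing, dunklAct_eq_zero _ _ h, map_zero, h5] at h6
  · exact mul_ne_zero hρ hci h6.symm
  · exact constantCoeff_of_isHomogeneous (isHomogeneous_lineDeriv _ _ _ _) (by omega)

end Nondegenerate

section Duality

variable {ι : Type*} [DecidableEq ι] [Fintype ι] {K : Type*} [Field K] [CharZero K] [Algebra ℚ K]

/-- The functional `[h, ·]` as a linear map in `h`. -/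
noncomputable def pairingHom (κ : K) (s : Finset ι) :
    MvPolynomial ι K →ₗ[K] MvPolynomial ι K →ₗ[K] K :=
  (LinearMap.compRight K (lcoeff K 0)).comp (dunklAct κ s).toLinearMap

theorem eq_zero_of_pairing_eq_zero {c : ℕ} (hc : 1 ≤ c) {g : MvPolynomial ι K}
    (h : ∀ f, pairing (-c : K) Finset.univ f g = 0) : g = 0 := by
  have key : ∀ e (g : MvPolynomial ι K), (∀ f, pairing (-c : K) Finset.univ f g = 0) →
      homogeneousComponent e g = 0 := by
    intro e
    induction e with
    | zero =>
      intro g h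
      have := h 1
      rw [pairing, map_one, Module.End.one_apply, constantCoeff_eq] at this
      rw [homogeneousComponent_zero, this, C_0]
    | succ e ih =>
      intro g h
      refine eq_zero_of_dunkl_eq_zero hc Finset.univ (Nat.succ_ne_zero e)
        (homogeneousComponent_isHomogeneous (e + 1) g) (fun l hl => (hl (Finset.mem_univ l)).elim) ?_
      intro i _
      rw [← homogeneousComponent_dunkl]
      refine ih _ fun f => ?_
      rw [← pairing_mul_X _ (Finset.mem_univ i), h]
  rw [← sum_homogeneousComponent g]
  exact Finset.sum_eq_zero fun e _ => key e g h

theorem exists_pairing_eq {c : ℕ} (hc : 1 ≤ c) (V : Submodule K (MvPolynomial ι K))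
    [FiniteDimensional K V] (φ : V →ₗ[K] K) :
    ∃ h, ∀ v : V, φ v = pairing (-c : K) Finset.univ h (v : MvPolynomial ι K) := by
  set Φ : MvPolynomial ι K →ₗ[K] Module.Dual K V :=
    (LinearMap.lcomp K K V.subtype).comp (pairingHom (-c : K) Finset.univ) with hΦ
  have h1 : (LinearMap.range Φ).dualCoannihilator = ⊥ := by
    rw [eq_bot_iff]
    intro v hv
    rw [Submodule.mem_dualCoannihilator] at hv
    rw [Submodule.mem_bot, ← Submodule.coe_eq_zero]
    exact eq_zero_of_pairing_eq_zero hc fun f => hv _ ⟨f, rfl⟩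
  have h2 := Subspace.dualCoannihilator_dualAnnihilator_eq (W := LinearMap.range Φ)
  rw [h1, Submodule.dualAnnihilator_bot] at h2
  obtain ⟨h, rfl⟩ : φ ∈ LinearMap.range Φ := h2 ▸ Submodule.mem_top
  exact ⟨h, fun v => rfl⟩

end Duality

section Regular

variable {R : Type*} [CommRing R]

theorem mem_sup_span_singleton_iff {I : Ideal R} {a z : R} :
    z ∈ I ⊔ Ideal.span {a} ↔ ∃ t, z - a * t ∈ I := by
  rw [sup_comm, Ideal.mem_span_singleton_sup]
  constructor
  · rintro ⟨t, b, hb, rfl⟩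
    exact ⟨t, by rwa [mul_comm a, add_sub_cancel_left]⟩
  · rintro ⟨t, ht⟩
    exact ⟨t, _, ht, by ring⟩

/-- Multiplication by `a` is injective on `R ⧸ I`. -/
def RegularMod (I : Ideal R) (a : R) : Prop := ∀ z, a * z ∈ I → z ∈ I

theorem RegularMod.congr {I : Ideal R} {a a' : R} (h : RegularMod I a) (haa' : a - a' ∈ I) :
    RegularMod I a' := fun z hz => h z <| by
  have := I.add_mem (I.mul_mem_right z haa') hz
  rwa [sub_mul, sub_add_cancel] at this

theorem RegularMod.pow {I : Ideal R} {a : R} (h : RegularMod I a) (n : ℕ) :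
    RegularMod I (a ^ n) := by
  induction n with
  | zero => intro z hz; simpa using hz
  | succ n ih => intro z hz; exact ih z (h _ (by rwa [← mul_assoc, ← pow_succ']))

theorem RegularMod.of_mul {I : Ideal R} {a b : R} (h : RegularMod I (a * b)) : RegularMod I b :=
  fun z hz => h z (by rw [mul_assoc]; exact I.mul_mem_left a hz)

/-- `σ` generates the socle of the quotient `R ⧸ I`, which is a Gorenstein ring. -/
def IsSocle (I : Ideal R) (σ : R) : Prop := σ ∉ I ∧ ∀ u ∉ I, ∃ v, u * v - σ ∈ I

theorem IsSocle.pow {I : Ideal R} {y σ : R} (hy : RegularMod I y)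
    (h : IsSocle (I ⊔ Ideal.span {y}) σ) (n : ℕ) :
    IsSocle (I ⊔ Ideal.span {y ^ (n + 1)}) (y ^ n * σ) := by
  refine ⟨fun hmem => h.1 ?_, fun u hu => ?_⟩
  · rw [mem_sup_span_singleton_iff] at hmem ⊢
    obtain ⟨t, ht⟩ := hmem
    refine ⟨t, hy.pow n _ ?_⟩
    convert ht using 1; ring
  · have hex : ∃ k, k ≤ n ∧ u ∈ I ⊔ Ideal.span {y ^ k} ∧ u ∉ I ⊔ Ideal.span {y ^ (k + 1)} := by
      by_contra! hcon
      have : ∀ k, k ≤ n + 1 → u ∈ I ⊔ Ideal.span {y ^ k} := by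
        intro k
        induction k with
        | zero => intro _; simp
        | succ k ih => intro hk; exact hcon k (by omega) (ih (by omega))
      exact hu (this _ le_rfl)
    obtain ⟨k, hk, h1, h2⟩ := hex
    obtain ⟨u', hu'⟩ := mem_sup_span_singleton_iff.1 h1
    have h3 : u' ∉ I ⊔ Ideal.span {y} := by
      intro h3
      obtain ⟨t, ht⟩ := mem_sup_span_singleton_iff.1 h3
      refine h2 (mem_sup_span_singleton_iff.2 ⟨t, ?_⟩)
      have := I.add_mem hu' (I.mul_mem_left (y ^ k) ht)
      convert this using 1; ring
    obtain ⟨v, hv⟩ := h.2 u' h3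
    obtain ⟨t, ht⟩ := mem_sup_span_singleton_iff.1 hv
    refine ⟨y ^ (n - k) * v, mem_sup_span_singleton_iff.2 ⟨t, ?_⟩⟩
    have := I.add_mem (I.mul_mem_left (y ^ (n - k) * v) hu') (I.mul_mem_left (y ^ n) ht)
    convert this using 1
    obtain ⟨e, rfl⟩ := Nat.exists_eq_add_of_le hk
    rw [Nat.add_sub_cancel_left]
    ring

theorem sup_span_singleton_congr {I : Ideal R} {a b : R} (h : a - b ∈ I) :
    I ⊔ Ideal.span {a} = I ⊔ Ideal.span {b} := by
  ext z
  rw [mem_sup_span_singleton_iff, mem_sup_span_singleton_iff]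
  refine exists_congr fun t => ?_
  rw [← I.add_mem_iff_left (I.mul_mem_right t h)]
  ring_nf

theorem mul_mem_sup_span_mul_iff {I : Ideal R} {p w z : R} (hw : RegularMod I w) :
    w * z ∈ I ⊔ Ideal.span {p * w} ↔ z ∈ I ⊔ Ideal.span {p} := by
  rw [mem_sup_span_singleton_iff, mem_sup_span_singleton_iff]
  refine exists_congr fun t => ⟨fun h => hw _ ?_, fun h => ?_⟩
  · convert h using 1; ring
  · convert I.mul_mem_left w h using 1; ring

theorem IsSocle.of_mul {I : Ideal R} {p w τ v : R} (hw : RegularMod I w)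
    (h : IsSocle (I ⊔ Ideal.span {p * w}) τ) (hv : w * v - τ ∈ I ⊔ Ideal.span {p * w}) :
    IsSocle (I ⊔ Ideal.span {p}) v := by
  refine ⟨fun hmem => h.1 ?_, fun u hu => ?_⟩
  · have := sub_mem ((mul_mem_sup_span_mul_iff hw).2 hmem) hv
    rwa [sub_sub_cancel] at this
  · obtain ⟨z, hz⟩ := h.2 _ (mt (mul_mem_sup_span_mul_iff hw).1 hu)
    refine ⟨z, (mul_mem_sup_span_mul_iff hw).1 ?_⟩
    convert sub_mem hz hv using 1; ring

variable {ι : Type*}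

/-- The list of elements `f i`, read from right to left, is a regular sequence on `R ⧸ I`. -/
def RegularSeq (I : Ideal R) (f : ι → R) : List ι → Prop
  | [] => True
  | i :: l => RegularSeq I f l ∧ RegularMod (I ⊔ Ideal.span (f '' {j | j ∈ l})) (f i)

theorem sup_span_image_congr {I : Ideal R} {f f' : ι → R} (s : Set ι)
    (h : ∀ j ∈ s, f j - f' j ∈ I) :
    I ⊔ Ideal.span (f '' s) = I ⊔ Ideal.span (f' '' s) := by
  have key : ∀ f f' : ι → R, (∀ j ∈ s, f j - f' j ∈ I) →
      I ⊔ Ideal.span (f '' s) ≤ I ⊔ Ideal.span (f' '' s) := by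
    intro f f' h
    refine sup_le le_sup_left (Ideal.span_le.2 ?_)
    rintro _ ⟨j, hj, rfl⟩
    have h1 : f' j ∈ I ⊔ Ideal.span (f' '' s) :=
      (le_sup_right : _ ≤ I ⊔ Ideal.span (f' '' s)) (Ideal.subset_span ⟨j, hj, rfl⟩)
    have h2 : f j - f' j ∈ I ⊔ Ideal.span (f' '' s) :=
      (le_sup_left : I ≤ I ⊔ Ideal.span (f' '' s)) (h j hj)
    simpa using add_mem h2 h1
  refine le_antisymm (key f f' h) (key f' f fun j hj => ?_)
  rw [← neg_sub]
  exact neg_mem (h j hj)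

theorem RegularSeq.congr {I : Ideal R} {f f' : ι → R} {l : List ι} (hl : RegularSeq I f l)
    (h : ∀ j ∈ l, f j - f' j ∈ I) : RegularSeq I f' l := by
  induction l with
  | nil => trivial
  | cons i l ih =>
    refine ⟨ih hl.1 fun j hj => h j (List.mem_cons_of_mem _ hj), ?_⟩
    rw [← sup_span_image_congr {j | j ∈ l} fun j hj => h j (List.mem_cons_of_mem _ hj)]
    exact hl.2.congr ((le_sup_left : I ≤ _) (h i List.mem_cons_self))

end Regular

section GradedRegular

variable {ι : Type*} {K : Type*} [Field K]

/-- An ideal containing the homogeneous components of all its elements. -/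
def IsGradedIdeal (I : Ideal (MvPolynomial ι K)) : Prop :=
  ∀ f ∈ I, ∀ n, homogeneousComponent n f ∈ I

theorem mem_of_homogeneousComponent_mem {I : Ideal (MvPolynomial ι K)} {f : MvPolynomial ι K}
    (h : ∀ n, homogeneousComponent n f ∈ I) : f ∈ I := by
  rw [← sum_homogeneousComponent f]
  exact I.sum_mem fun n _ => h n

theorem isGradedIdeal_span {S : Set (MvPolynomial ι K)}
    (hS : ∀ f ∈ S, ∃ n, f.IsHomogeneous n) : IsGradedIdeal (Ideal.span S) := by
  intro f hf n
  rw [← Ideal.submodule_span_eq, Submodule.mem_span_set'] at hf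
  obtain ⟨k, a, g, rfl⟩ := hf
  rw [map_sum]
  refine Ideal.sum_mem _ fun i _ => ?_
  obtain ⟨m, hm⟩ := hS _ (g i).2
  rw [smul_eq_mul, mul_comm, homogeneousComponent_mul_of_isHomogeneous hm]
  split_ifs
  · exact Ideal.mul_mem_right _ _ (Ideal.subset_span (g i).2)
  · exact zero_mem _

theorem isGradedIdeal_sup_span {I : Ideal (MvPolynomial ι K)}
    (hI : IsGradedIdeal I) {S : Set (MvPolynomial ι K)}
    (hS : ∀ f ∈ S, ∃ n, f.IsHomogeneous n) :
    IsGradedIdeal (I ⊔ Ideal.span S) := by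
  intro f hf n
  obtain ⟨g, hg, h, hh, rfl⟩ := Submodule.mem_sup.1 hf
  rw [map_add]
  exact Submodule.add_mem_sup (hI g hg n) (isGradedIdeal_span hS h hh n)

theorem mem_of_forall_mem_sup_span_pow {I : Ideal (MvPolynomial ι K)}
    (hI : IsGradedIdeal I) {a : MvPolynomial ι K} {d : ℕ}
    (ha : a.IsHomogeneous (d + 1)) {z : MvPolynomial ι K}
    (h : ∀ k, z ∈ I ⊔ Ideal.span {a ^ k}) : z ∈ I := by
  refine mem_of_homogeneousComponent_mem fun e => ?_
  obtain ⟨t, ht⟩ := mem_sup_span_singleton_iff.1 (h (e + 1))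
  have := hI _ ht e
  rwa [map_sub, homogeneousComponent_mul_of_isHomogeneous (ha.pow (e + 1)), if_neg, sub_zero]
    at this
  rw [not_le]
  nlinarith

theorem RegularMod.swap {I : Ideal (MvPolynomial ι K)}
    (hI : IsGradedIdeal I) {a b : MvPolynomial ι K} {d : ℕ}
    (had : a.IsHomogeneous (d + 1)) (ha : RegularMod I a)
    (hb : RegularMod (I ⊔ Ideal.span {a}) b) :
    RegularMod I b ∧ RegularMod (I ⊔ Ideal.span {b}) a := by
  constructor
  · have step : ∀ z, b * z ∈ I → ∃ z', b * z' ∈ I ∧ z - a * z' ∈ I := by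
      intro z hz
      obtain ⟨t, ht⟩ := mem_sup_span_singleton_iff.1 (hb z ((le_sup_left : I ≤ _) hz))
      refine ⟨t, ha _ ?_, ht⟩
      have := I.sub_mem hz (I.mul_mem_left b ht)
      convert this using 1; ring
    intro z hz
    refine mem_of_forall_mem_sup_span_pow hI had fun k => ?_
    have : ∃ z', b * z' ∈ I ∧ z - a ^ k * z' ∈ I := by
      induction k with
      | zero => exact ⟨z, hz, by simp⟩
      | succ k ih =>
        obtain ⟨z', h1, h2⟩ := ih
        obtain ⟨z'', h3, h4⟩ := step z' h1
        refine ⟨z'', h3, ?_⟩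
        convert I.add_mem h2 (I.mul_mem_left (a ^ k) h4) using 1; ring
    obtain ⟨z', -, h⟩ := this
    exact mem_sup_span_singleton_iff.2 ⟨z', h⟩
  · intro z hz
    obtain ⟨t, ht⟩ := mem_sup_span_singleton_iff.1 hz
    have h1 : t ∈ I ⊔ Ideal.span {a} := hb t (mem_sup_span_singleton_iff.2 ⟨z, by
      rw [← neg_sub]; exact I.neg_mem ht⟩)
    obtain ⟨t', ht'⟩ := mem_sup_span_singleton_iff.1 h1
    refine mem_sup_span_singleton_iff.2 ⟨t', ha _ ?_⟩
    convert I.add_mem ht (I.mul_mem_left b ht') using 1; ring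

theorem RegularSeq.swap {κ : Type*} {I : Ideal (MvPolynomial ι K)}
    (hI : IsGradedIdeal I) {a : MvPolynomial ι K} {d : ℕ}
    (had : a.IsHomogeneous (d + 1)) (ha : RegularMod I a) {f : κ → MvPolynomial ι K}
    (hf : ∀ j, ∃ n, (f j).IsHomogeneous n) {l : List κ}
    (hl : RegularSeq (I ⊔ Ideal.span {a}) f l) :
    RegularSeq I f l ∧ RegularMod (I ⊔ Ideal.span (f '' {j | j ∈ l})) a := by
  induction l with
  | nil => exact ⟨trivial, by simpa using ha⟩
  | cons i l ih =>
    obtain ⟨h1, h2⟩ := ih hl.1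
    have h3 := hl.2
    rw [sup_right_comm] at h3
    have hI' : IsGradedIdeal (I ⊔ Ideal.span (f '' {j | j ∈ l})) := by
      refine isGradedIdeal_sup_span hI ?_
      rintro _ ⟨j, -, rfl⟩
      exact hf j
    obtain ⟨h4, h5⟩ := h2.swap hI' had h3
    refine ⟨⟨h1, h4⟩, ?_⟩
    have : {j | j ∈ i :: l} = insert i {j | j ∈ l} := by ext; simp
    rwa [this, Set.image_insert_eq, Ideal.span_insert, sup_comm (Ideal.span {f i}), ← sup_assoc]

end GradedRegular

section GradedRegular

variable {ι : Type*} {K : Type*} [Field K]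

/-- Exchanging a linear form for a form with the same zeros preserves regularity and the
existence of a socle generator. -/
theorem IsSocle.exists_of_mem_radical {I : Ideal (MvPolynomial ι K)} (hI : IsGradedIdeal I)
    (hI0 : ∀ f ∈ I, constantCoeff f = 0) {y p σ : MvPolynomial ι K} {m e : ℕ}
    (hy1 : y.IsHomogeneous 1) (hy : RegularMod I y) (hp : p.IsHomogeneous (m + 1))
    (hrad : y ∈ (I ⊔ Ideal.span {p}).radical) (hσ : σ.IsHomogeneous e)
    (h : IsSocle (I ⊔ Ideal.span {y}) σ) :
    RegularMod I p ∧ ∃ σ' : MvPolynomial ι K, σ'.IsHomogeneous (e + m) ∧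
      IsSocle (I ⊔ Ideal.span {p}) σ' := by
  obtain ⟨N, hN⟩ := hrad
  obtain ⟨t, ht⟩ := mem_sup_span_singleton_iff.1
    (Ideal.mul_mem_left _ (y ^ (m + 1)) hN)
  rw [← pow_add] at ht
  set w := homogeneousComponent N t with hw
  have hwh : w.IsHomogeneous N := homogeneousComponent_isHomogeneous _ _
  have hyN : (y ^ (m + 1 + N)).IsHomogeneous (m + 1 + N) := by simpa using hy1.pow (m + 1 + N)
  have h1 : y ^ (m + 1 + N) - p * w ∈ I := by
    have := hI _ ht (m + 1 + N)
    rwa [map_sub, homogeneousComponent_of_mem hyN, if_pos rfl,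
      homogeneousComponent_mul_of_isHomogeneous hp, if_pos (by omega), Nat.add_sub_cancel_left]
      at this
  have hpw : RegularMod I (p * w) := (hy.pow _).congr h1
  have hwr : RegularMod I w := hpw.of_mul
  have hpr : RegularMod I p := RegularMod.of_mul (a := w) (by rwa [mul_comm])
  refine ⟨hpr, ?_⟩
  have hp0 : constantCoeff p = 0 := constantCoeff_of_isHomogeneous hp (by omega)
  have hs := h.pow hy (m + N)
  rw [show m + N + 1 = m + 1 + N by ring, sup_span_singleton_congr h1] at hs
  have hw1 : w ∉ I ⊔ Ideal.span {p * w} := by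
    intro hmem
    obtain ⟨t, ht⟩ := mem_sup_span_singleton_iff.1
      ((mul_mem_sup_span_mul_iff (z := 1) hwr).1 (by rwa [mul_one]))
    have := hI0 _ ht
    simp [hp0] at this
  obtain ⟨v, hv⟩ := hs.2 w hw1
  have hJ : IsGradedIdeal (I ⊔ Ideal.span {p * w}) := by
    refine isGradedIdeal_sup_span hI ?_
    rintro _ rfl
    exact ⟨_, hp.mul hwh⟩
  have hτ : (y ^ (m + N) * σ).IsHomogeneous (m + N + e) := by
    simpa using (hy1.pow (m + N)).mul hσ
  refine ⟨homogeneousComponent (e + m) v, homogeneousComponent_isHomogeneous _ _,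
    hs.of_mul hwr ?_⟩
  have := hJ _ hv (m + N + e)
  rwa [map_sub, homogeneousComponent_of_mem hτ, if_pos rfl,
    homogeneousComponent_mul_of_isHomogeneous hwh, if_pos (by omega),
    show m + N + e - N = e + m by omega] at this

theorem regularMod_X {s : Set ι} {n : ι} (hn : n ∉ s) :
    RegularMod (Ideal.span (X '' s : Set (MvPolynomial ι K))) (X n) := by
  classical
  intro z hz
  rw [mem_ideal_span_X_image] at hz ⊢
  intro m hm
  obtain ⟨i, hi, h⟩ := hz (Finsupp.single n 1 + m) (by
    rw [mem_support_iff] at hm ⊢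
    rwa [coeff_X_mul])
  refine ⟨i, hi, ?_⟩
  have hne : n ≠ i := by rintro rfl; exact hn hi
  simpa [Finsupp.single_eq_of_ne' hne] using h

end GradedRegular

section Specialization

variable {ι : Type*} {A : Type*} [CommRing A] [DecidableEq ι]

theorem powSum_insert_sub_mem {s : Finset ι} {n : ι} (hn : n ∉ s) {m : ℕ} (hm : 1 ≤ m) :
    powSum A (insert n s) m - powSum A s m ∈ Ideal.span {X n} := by
  rw [powSum_insert hn, add_sub_cancel_right, Ideal.mem_span_singleton]
  exact dvd_pow_self _ (by omega)

variable [Algebra ℚ A]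

theorem binomSeries_insert_sub_mem (κ : A) {s : Finset ι} {n : ι} (hn : n ∉ s) (m : ℕ) :
    binomSeries κ (insert n s) m - binomSeries κ s m ∈ Ideal.span {X n} := by
  induction m using Nat.strong_induction_on with
  | _ m ih =>
    cases m with
    | zero => simp [binomSeries]
    | succ m =>
      rw [binomSeries, binomSeries, ← mul_sub, ← Finset.sum_sub_distrib]
      refine Ideal.mul_mem_left _ _ (Ideal.sum_mem _ fun k _ => ?_)
      exact Ideal.mul_sub_mul_mem _ (powSum_insert_sub_mem hn (by omega)) (ih k (by omega))

theorem binomDeriv_insert_sub_mem (κ : A) {s : Finset ι} {n : ι} (hn : n ∉ s) (m : ℕ) :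
    binomDeriv κ (insert n s) m - binomDeriv κ s m ∈ Ideal.span {X n} := by
  induction m using Nat.strong_induction_on with
  | _ m ih =>
    cases m with
    | zero => simp [binomDeriv]
    | succ m =>
      rw [binomDeriv, binomDeriv, ← mul_sub, ← Finset.sum_sub_distrib]
      refine Ideal.mul_mem_left _ _ (Ideal.sum_mem _ fun k _ => ?_)
      refine Ideal.mul_sub_mul_mem _ (powSum_insert_sub_mem hn (by omega)) ?_
      rw [add_sub_add_comm, ← mul_sub]
      exact add_mem (binomSeries_insert_sub_mem κ hn k)
        (Ideal.mul_mem_left _ _ (ih k (by omega)))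

theorem lineDeriv_insert_sub_mem (κ : A) {s : Finset ι} {n : ι} (hn : n ∉ s) (i : ι) (m : ℕ) :
    lineDeriv κ (insert n s) i m - lineDeriv κ s i m ∈ Ideal.span {X n} := by
  induction m with
  | zero => simp [lineDeriv]
  | succ m ih =>
    rw [lineDeriv, lineDeriv, add_sub_add_comm, ← mul_sub]
    exact add_mem (Ideal.mul_mem_left _ _ ih) (binomDeriv_insert_sub_mem κ hn _)

end Specialization

section Socle

variable {ι : Type*} [Finite ι] [DecidableEq ι] {K : Type*} [Field K] [CharZero K] [Algebra ℚ K]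
  [IsAlgClosed K]

/-- The forms `lineDeriv (-c) s i m`, for `i ∈ s`, are a homogeneous system of parameters in
the variables in `s`. -/
theorem exists_isSocle_of_nodup {c m : ℕ} (hc : 1 ≤ c) (l : List ι) (hl : l.Nodup)
    (hm : c * l.length ≤ m + 1) :
    RegularSeq (Ideal.span (X '' {j | j ∉ l})) (fun i => lineDeriv (-c : K) l.toFinset i (m + 1)) l
    ∧ ∃ σ : MvPolynomial ι K, σ.IsHomogeneous (l.length * m) ∧
      IsSocle (Ideal.span (X '' {j | j ∉ l}) ⊔ Ideal.span
        ((fun i => lineDeriv (-c : K) l.toFinset i (m + 1)) '' {j | j ∈ l})) σ := by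
  induction l with
  | nil =>
    refine ⟨trivial, 1, by simpa using isHomogeneous_one ι K, ?_, fun u hu => ?_⟩
    · have h0 : (fun i => lineDeriv (-c : K) ([] : List ι).toFinset i (m + 1)) '' {j | j ∈ []} = ∅ := by
        simp
      rw [h0, Ideal.span_empty, sup_bot_eq, mem_ideal_span_X_image]
      intro h
      obtain ⟨i, -, hi⟩ := h 0 (by simp)
      exact hi rfl
    · have h0 : constantCoeff u ≠ 0 := by
        intro h0
        refine hu (Ideal.mem_sup_left ?_)
        rw [mem_ideal_span_X_image]
        intro d hd
        by_contra! hcon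
        have : d = 0 := by ext i; exact hcon i (by simp)
        rw [this, mem_support_iff] at hd
        exact hd h0
      refine ⟨C (constantCoeff u)⁻¹, Ideal.mem_sup_left ?_⟩
      rw [mem_ideal_span_X_image]
      intro d hd
      by_contra! hcon
      have : d = 0 := by ext i; exact hcon i (by simp)
      rw [this, mem_support_iff] at hd
      apply hd
      rw [← constantCoeff_eq]
      simp [h0]
  | cons n l ih =>
    obtain ⟨hn, hl⟩ := List.nodup_cons.1 hl
    rw [List.length_cons] at hm
    obtain ⟨hreg, σ, hσ, hsoc⟩ := ih hl (by nlinarith)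
    set s := (n :: l).toFinset with hs
    have hsi : s = insert n l.toFinset := by simp [hs]
    set p : ι → MvPolynomial ι K := fun i => lineDeriv (-c : K) s i (m + 1) with hp
    set 𝔠 : Ideal (MvPolynomial ι K) := Ideal.span (X '' {j | j ∉ n :: l}) with h𝔠
    have h𝔠l : Ideal.span (X '' {j | j ∉ l}) = 𝔠 ⊔ Ideal.span {(X n : MvPolynomial ι K)} := by
      rw [h𝔠, sup_comm, ← Ideal.span_insert, ← Set.image_insert_eq]
      congr 2
      ext j
      by_cases hj : j = n
      · subst hj; simpa using hn
      · simp [hj]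
    have hcong : ∀ i, lineDeriv (-c : K) l.toFinset i (m + 1) - p i ∈ 𝔠 ⊔ Ideal.span {X n} := by
      intro i
      rw [hp, ← neg_sub, hsi]
      exact neg_mem (Ideal.mem_sup_right
        (lineDeriv_insert_sub_mem (-c : K) (by simpa using hn) i (m + 1)))
    rw [h𝔠l] at hreg hsoc
    rw [sup_span_image_congr _ fun j _ => hcong j, sup_right_comm] at hsoc
    have h𝔠g : IsGradedIdeal 𝔠 := by
      refine isGradedIdeal_span ?_
      rintro _ ⟨j, -, rfl⟩
      exact ⟨1, isHomogeneous_X K j⟩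
    have hph : ∀ j, (p j).IsHomogeneous (m + 1) := fun j => isHomogeneous_lineDeriv _ _ _ _
    obtain ⟨h1, h2⟩ := (hreg.congr fun j _ => hcong j).swap (d := 0) h𝔠g (isHomogeneous_X K n)
      (regularMod_X (by simp)) fun j => ⟨m + 1, hph j⟩
    set 𝔟 := 𝔠 ⊔ Ideal.span (p '' {j | j ∈ l}) with h𝔟
    have h𝔟g : IsGradedIdeal 𝔟 := by
      refine isGradedIdeal_sup_span h𝔠g ?_
      rintro _ ⟨j, -, rfl⟩
      exact ⟨m + 1, hph j⟩
    have h𝔟0 : ∀ f ∈ 𝔟, constantCoeff f = 0 := by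
      have : 𝔟 ≤ RingHom.ker (constantCoeff : MvPolynomial ι K →+* K) := by
        refine sup_le (Ideal.span_le.2 ?_) (Ideal.span_le.2 ?_)
        · rintro _ ⟨j, -, rfl⟩
          simp
        · rintro _ ⟨j, -, rfl⟩
          exact constantCoeff_of_isHomogeneous (hph j) (by omega)
      exact this
    have himg : 𝔠 ⊔ Ideal.span (p '' {j | j ∈ n :: l}) = 𝔟 ⊔ Ideal.span {p n} := by
      have : {j | j ∈ n :: l} = insert n {j | j ∈ l} := by ext; simp
      rw [this, Set.image_insert_eq, Ideal.span_insert, sup_comm (Ideal.span {p n}), ← sup_assoc]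
    have hrad : X n ∈ (𝔟 ⊔ Ideal.span {p n}).radical := by
      rw [← himg, ← vanishingIdeal_zeroLocus_eq_radical (K := K), mem_vanishingIdeal_iff]
      intro y hy
      rw [mem_zeroLocus_iff] at hy
      rw [aeval_X]
      have hcard : s.card = l.length + 1 := by
        rw [hsi, Finset.card_insert_of_notMem (by simpa using hn), List.toFinset_card_of_nodup hl]
      refine eq_zero_of_eval_lineDeriv_eq_zero hc y (s := s) (m := m + 1) (by rwa [hcard]) ?_ n
        (by simp [hs])
      intro i hi
      rw [← coe_aeval_eq_eval]
      exact hy _ (Ideal.mem_sup_right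
        (Ideal.subset_span ⟨i, by simpa [hs] using hi, rfl⟩))
    obtain ⟨h3, σ', hσ', h4⟩ := hsoc.exists_of_mem_radical h𝔟g h𝔟0 (isHomogeneous_X K n) h2 (hph n)
      hrad hσ
    refine ⟨⟨h1, h3⟩, σ', ?_, ?_⟩
    · rwa [List.length_cons, add_mul, one_mul]
    · rwa [himg]

theorem exists_isSocle_lineDeriv [Fintype ι] {c m : ℕ} (hc : 1 ≤ c)
    (hm : c * Fintype.card ι = m + 1) :
    ∃ σ : MvPolynomial ι K, σ.IsHomogeneous (Fintype.card ι * m) ∧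
      IsSocle (Ideal.span (Set.range fun i => lineDeriv (-c : K) Finset.univ i (m + 1))) σ := by
  have hlen : (Finset.univ : Finset ι).toList.length = Fintype.card ι := by simp
  obtain ⟨-, σ, hσ, h⟩ := exists_isSocle_of_nodup (K := K) (m := m) hc
    (Finset.univ : Finset ι).toList (Finset.nodup_toList _) (by rw [hlen, hm])
  refine ⟨σ, by rwa [hlen] at hσ, ?_⟩
  simpa [Set.image_univ] using h

end Socle

section MapCoeff

variable {ι K A B : Type*} [CommRing K] [CommRing A] [CommRing B] [Algebra K A] [Algebra K B]

/-- Apply a linear map to the coefficients of a polynomial. -/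
noncomputable def mapCoeff (L : A →ₗ[K] B) : MvPolynomial ι A →ₗ[K] MvPolynomial ι B where
  toFun p := ∑ n ∈ p.support, monomial n (L (coeff n p))
  map_add' p q := by
    classical
    ext m
    simp only [coeff_sum, coeff_monomial, coeff_add, Finset.sum_ite_eq', mem_support_iff]
    split_ifs <;> simp_all [← map_add]
  map_smul' k p := by
    classical
    ext m
    simp only [coeff_sum, coeff_monomial, coeff_smul, Finset.sum_ite_eq', mem_support_iff,
      RingHom.id_apply, map_smul]
    split_ifs with h1 h2 h2
    · rfl
    · rw [not_ne_iff.1 h2, map_zero, smul_zero]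
    · rw [← map_smul, not_ne_iff.1 h1, map_zero]
    · simp

@[simp]
theorem coeff_mapCoeff (L : A →ₗ[K] B) (p : MvPolynomial ι A) (m : ι →₀ ℕ) :
    coeff m (mapCoeff L p) = L (coeff m p) := by
  classical
  simp only [mapCoeff, LinearMap.coe_mk, AddHom.coe_mk, coeff_sum, coeff_monomial,
    Finset.sum_ite_eq', mem_support_iff]
  split_ifs <;> simp_all

@[simp]
theorem mapCoeff_monomial (L : A →ₗ[K] B) (n : ι →₀ ℕ) (a : A) :
    mapCoeff L (monomial n a) = monomial n (L a) := by
  classical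
  ext m
  simp only [coeff_mapCoeff, coeff_monomial]
  split_ifs <;> simp

theorem mapCoeff_algHom (f : A →ₐ[K] B) (p : MvPolynomial ι A) :
    mapCoeff f.toLinearMap p = map (f : A →+* B) p := by
  ext m; simp [coeff_map]

theorem mapCoeff_mapCoeff {D : Type*} [CommRing D] [Algebra K D] (L : A →ₗ[K] B) (L' : B →ₗ[K] D)
    (p : MvPolynomial ι A) : mapCoeff L' (mapCoeff L p) = mapCoeff (L' ∘ₗ L) p := by
  ext m; simp

theorem mapCoeff_C_mul (L : A →ₗ[K] B) (a : A) (p : MvPolynomial ι A) :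
    mapCoeff L (C a * p) = mapCoeff (L ∘ₗ LinearMap.mulLeft K a) p := by
  ext m; simp [coeff_C_mul]

theorem C_mul_mapCoeff (L : A →ₗ[K] B) (b : B) (p : MvPolynomial ι A) :
    C b * mapCoeff L p = mapCoeff (LinearMap.mulLeft K b ∘ₗ L) p := by
  ext m; simp [coeff_C_mul]

theorem mapCoeff_mul_map (L : A →ₗ[K] B) (p : MvPolynomial ι A) (q : MvPolynomial ι K) :
    mapCoeff L (p * map (algebraMap K A) q) = mapCoeff L p * map (algebraMap K B) q := by
  classical
  ext m
  simp only [coeff_mapCoeff, coeff_mul, map_sum, coeff_map]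
  refine Finset.sum_congr rfl fun x _ => ?_
  rw [mul_comm, ← Algebra.smul_def, map_smul, Algebra.smul_def, mul_comm]

theorem mapCoeff_rename {κ : Type*} (L : A →ₗ[K] B) (w : ι → κ) (p : MvPolynomial ι A) :
    mapCoeff L (rename w p) = rename w (mapCoeff L p) := by
  induction p using MvPolynomial.induction_on' with
  | monomial n a => simp [rename_monomial]
  | add p q hp hq => simp [hp, hq]

theorem mapCoeff_dunkl [IsDomain K] [IsDomain A] [IsDomain B] [DecidableEq ι] (L : A →ₗ[K] B)
    (κ : K) (s : Finset ι) (i : ι) (p : MvPolynomial ι A) :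
    mapCoeff L (dunkl (algebraMap K A κ) s i p) = dunkl (algebraMap K B κ) s i (mapCoeff L p) := by
  induction p using MvPolynomial.induction_on' with
  | add p q hp hq => simp [hp, hq]
  | monomial n a =>
    have hA : monomial n a = a • map (algebraMap K A) (monomial n 1) := by
      simp [smul_monomial]
    have hB : monomial n (L a) = L a • map (algebraMap K B) (monomial n 1) := by
      simp [smul_monomial]
    rw [mapCoeff_monomial, hA, hB, LinearMap.map_smul (dunkl (algebraMap K A κ) s i),
      LinearMap.map_smul (dunkl (algebraMap K B κ) s i), ← map_dunkl, ← map_dunkl]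
    ext m
    simp only [coeff_mapCoeff, coeff_smul, coeff_map, smul_eq_mul]
    rw [mul_comm, ← Algebra.smul_def, map_smul, Algebra.smul_def, mul_comm]

/-- A derivation of the coefficient ring, extended to polynomials. -/
noncomputable def coeffDeriv (D : Derivation K A A) :
    Derivation K (MvPolynomial ι A) (MvPolynomial ι A) :=
  Derivation.mk' (mapCoeff D.toLinearMap) fun p q => by
    classical
    ext m
    simp only [coeff_mapCoeff, coeff_mul, map_sum, coeff_add, smul_eq_mul, mul_comm q,
      ← Finset.sum_add_distrib]
    exact Finset.sum_congr rfl fun x _ => by simp; ring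

theorem coeffDeriv_apply (D : Derivation K A A) (p : MvPolynomial ι A) :
    coeffDeriv D p = mapCoeff D.toLinearMap p := rfl

end MapCoeff

theorem leibniz_prod {K R κ : Type*} [CommRing K] [CommRing R] [Algebra K R] [DecidableEq κ]
    (D : Derivation K R R) (s : Finset κ) (g : κ → R) :
    D (∏ p ∈ s, g p) = ∑ p ∈ s, (∏ q ∈ s.erase p, g q) * D (g p) := by
  induction s using Finset.induction_on with
  | empty => simp
  | insert a s ha ih =>
    rw [Finset.prod_insert ha, D.leibniz, ih, Finset.sum_insert ha, Finset.erase_insert ha,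
      smul_eq_mul, smul_eq_mul, add_comm, Finset.mul_sum]
    congr 1
    refine Finset.sum_congr rfl fun p hp => ?_
    have hpa : p ≠ a := by rintro rfl; exact ha hp
    rw [Finset.erase_insert_of_ne hpa.symm, Finset.prod_insert (by simp [ha]), mul_assoc]

section Kernel

variable (ι K : Type*) [Field K]

/-- The difference of the variables `x_j` and `r_k`, the latter being coefficients. -/
noncomputable def lin {ι : Type*} (K : Type*) [Field K] (j k : ι) :
    MvPolynomial ι (MvPolynomial ι K) := X j - C (X k)

variable {ι K}

theorem lin_ne_zero (j k : ι) : lin K j k ≠ 0 := by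
  classical
  intro h
  have := congrArg (coeff (Finsupp.single j 1)) h
  have hne : (0 : ι →₀ ℕ) ≠ Finsupp.single j 1 := (Finsupp.single_ne_zero.2 one_ne_zero).symm
  simp [lin, coeff_C, hne] at this

variable [Fintype ι] [DecidableEq ι]

/-- The product `∏_{j ≠ k} (x_j - r_k)^{a + 1} ∏_j (x_j - r_j)^a`. -/
noncomputable def kernelPoly (ι K : Type*) [Field K] [Fintype ι] [DecidableEq ι] (a : ℕ) :
    MvPolynomial ι (MvPolynomial ι K) :=
  ∏ p : ι × ι, lin K p.1 p.2 ^ (if p.1 = p.2 then a else a + 1)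

theorem kernelPoly_mul (a : ℕ) :
    kernelPoly ι K a * ∏ k, lin K k k = ∏ p : ι × ι, lin K p.1 p.2 ^ (a + 1) := by
  rw [kernelPoly, Fintype.prod_prod_type, Fintype.prod_prod_type, ← Finset.prod_mul_distrib]
  refine Finset.prod_congr rfl fun j _ => ?_
  rw [← Finset.mul_prod_erase _ _ (Finset.mem_univ j),
    ← Finset.mul_prod_erase _ (fun k => lin K j k ^ (a + 1)) (Finset.mem_univ j)]
  have : ∏ k ∈ Finset.univ.erase j, lin K j k ^ (if j = k then a else a + 1) =
      ∏ k ∈ Finset.univ.erase j, lin K j k ^ (a + 1) :=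
    Finset.prod_congr rfl fun k hk => by rw [if_neg (Finset.ne_of_mem_erase hk).symm]
  simp only [if_true]
  rw [this]; ring

theorem exists_kernelPoly_eq (a : ℕ) {i j : ι} (h : i ≠ j) :
    ∃ T, kernelPoly ι K a = lin K i j * lin K j i * T := by
  have h1 : (i, j) ∈ (Finset.univ : Finset (ι × ι)) := Finset.mem_univ _
  have h2 : (j, i) ∈ (Finset.univ : Finset (ι × ι)).erase (i, j) := by simp [h]
  rw [kernelPoly, ← Finset.mul_prod_erase _ _ h1, ← Finset.mul_prod_erase _ _ h2]
  simp only [if_neg h, if_neg h.symm, pow_succ]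
  set R := ∏ x ∈ (Finset.univ.erase (i, j)).erase (j, i),
    lin K x.1 x.2 ^ (if x.1 = x.2 then a else a + 1)
  exact ⟨lin K i j ^ a * lin K j i ^ a * R, by ring⟩

theorem map_kernelPoly_of_swap {a : ℕ} {i j : ι} (h : i ≠ j) {T : MvPolynomial ι (MvPolynomial ι K)}
    (hT : kernelPoly ι K a = lin K i j * lin K j i * T)
    (ψ : MvPolynomial ι (MvPolynomial ι K) →+* MvPolynomial ι (MvPolynomial ι K))
    (hP : ∏ p : ι × ι, ψ (lin K p.1 p.2) ^ (a + 1) = ∏ p : ι × ι, lin K p.1 p.2 ^ (a + 1))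
    (hij : ψ (lin K i i) * ψ (lin K j j) = lin K i j * lin K j i)
    (hk : ∀ k, k ≠ i → k ≠ j → ψ (lin K k k) = lin K k k) :
    ψ (kernelPoly ι K a) = lin K i i * lin K j j * T := by
  have hji : j ∈ (Finset.univ : Finset ι).erase i := by simp [h.symm]
  have h1 := congrArg ψ (kernelPoly_mul (ι := ι) (K := K) a)
  simp only [map_mul, map_prod, map_pow] at h1
  rw [hP, ← kernelPoly_mul, hT, ← Finset.mul_prod_erase _ _ (Finset.mem_univ i),
    ← Finset.mul_prod_erase _ _ hji, ← Finset.mul_prod_erase _ (fun k => lin K k k)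
    (Finset.mem_univ i), ← Finset.mul_prod_erase _ (fun k => lin K k k) hji] at h1
  have h2 : ∏ k ∈ (Finset.univ.erase i).erase j, ψ (lin K k k) =
      ∏ k ∈ (Finset.univ.erase i).erase j, lin K k k :=
    Finset.prod_congr rfl fun k hk' => hk k (by simp at hk'; tauto) (by simp at hk'; tauto)
  rw [h2] at h1
  have h3 : lin K i j * lin K j i * ∏ k ∈ (Finset.univ.erase i).erase j, lin K k k ≠ 0 :=
    mul_ne_zero (mul_ne_zero (lin_ne_zero _ _) (lin_ne_zero _ _))
      (Finset.prod_ne_zero_iff.2 fun k _ => lin_ne_zero _ _)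
  apply mul_right_cancel₀ h3
  rw [← hij] at h1 h3 ⊢
  rw [hT, ← hij]
  linear_combination h1

theorem rename_swap_kernelPoly {a : ℕ} {i j : ι} (h : i ≠ j) {T : MvPolynomial ι (MvPolynomial ι K)}
    (hT : kernelPoly ι K a = lin K i j * lin K j i * T) :
    rename (Equiv.swap i j) (kernelPoly ι K a) = lin K i i * lin K j j * T := by
  have hl : ∀ k l : ι, rename (Equiv.swap i j) (lin K k l) = lin K (Equiv.swap i j k) l := by
    intro k l; simp [lin]
  refine map_kernelPoly_of_swap h hT (rename (R := MvPolynomial ι K) (Equiv.swap i j)).toRingHom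
    ?_ ?_ ?_
  · simp only [AlgHom.toRingHom_eq_coe, RingHom.coe_coe, hl]
    rw [Fintype.prod_prod_type, Fintype.prod_prod_type]
    exact Equiv.prod_comp (Equiv.swap i j) fun k => ∏ l, lin K k l ^ (a + 1)
  · simp [hl, mul_comm]
  · intro k hki hkj
    simp [hl, Equiv.swap_apply_of_ne_of_ne hki hkj]

theorem map_rename_swap_kernelPoly {a : ℕ} {i j : ι} (h : i ≠ j)
    {T : MvPolynomial ι (MvPolynomial ι K)}
    (hT : kernelPoly ι K a = lin K i j * lin K j i * T) :
    map (rename (R := K) (Equiv.swap i j) : MvPolynomial ι K →+* MvPolynomial ι K) (kernelPoly ι K a) =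
      lin K i i * lin K j j * T := by
  have hl : ∀ k l : ι, map (rename (R := K) (Equiv.swap i j) : MvPolynomial ι K →+* _)
      (lin K k l) = lin K k (Equiv.swap i j l) := by
    intro k l; simp [lin]
  refine map_kernelPoly_of_swap h hT _ ?_ ?_ ?_
  · simp only [hl]
    rw [Fintype.prod_prod_type, Fintype.prod_prod_type]
    exact Finset.prod_congr rfl fun k _ =>
      Equiv.prod_comp (Equiv.swap i j) fun l => lin K k l ^ (a + 1)
  · simp [hl]
  · intro k hki hkj
    simp [hl, Equiv.swap_apply_of_ne_of_ne hki hkj]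

theorem divDiff_kernelPoly {a : ℕ} {i j : ι} (h : i ≠ j) {T : MvPolynomial ι (MvPolynomial ι K)}
    (hT : kernelPoly ι K a = lin K i j * lin K j i * T) :
    divDiff i j (kernelPoly ι K a) = - (T * (C (X i) - C (X j))) := by
  rw [divDiff_eq_iff h, rename_swap_kernelPoly h hT, hT]
  simp only [lin]
  ring

theorem mapCoeff_divDiff_kernelPoly {a : ℕ} {i j : ι} (h : i ≠ j)
    {T : MvPolynomial ι (MvPolynomial ι K)}
    (hT : kernelPoly ι K a = lin K i j * lin K j i * T) :
    mapCoeff (divDiff (A := K) i j) (kernelPoly ι K a) = - (T * (X i - X j)) := by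
  have hne : (C (X i - X j) : MvPolynomial ι (MvPolynomial ι K)) ≠ 0 := by
    rw [Ne, C_eq_zero]; exact X_sub_X_ne_zero h
  apply mul_left_cancel₀ hne
  have : LinearMap.mulLeft K (X i - X j : MvPolynomial ι K) ∘ₗ divDiff (A := K) i j =
      LinearMap.id - (rename (R := K) (Equiv.swap i j)).toLinearMap := by
    refine LinearMap.ext fun p => ?_
    simp [X_sub_X_mul_divDiff h]
  rw [C_mul_mapCoeff, this]
  have h2 : mapCoeff (LinearMap.id - (rename (R := K) (Equiv.swap i j)).toLinearMap)
      (kernelPoly ι K a) = kernelPoly ι K a -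
        map (rename (R := K) (Equiv.swap i j) : MvPolynomial ι K →+* MvPolynomial ι K)
        (kernelPoly ι K a) := by
    ext1 m; simp [coeff_map]
  rw [h2, map_rename_swap_kernelPoly h hT, hT]
  simp only [lin, map_sub]
  ring

theorem derivation_kernelPoly {a : ℕ} {i : ι} {T : ι → MvPolynomial ι (MvPolynomial ι K)}
    (hT : ∀ j, j ≠ i → kernelPoly ι K a = lin K i j * lin K j i * T j)
    (D : Derivation K (MvPolynomial ι (MvPolynomial ι K)) (MvPolynomial ι (MvPolynomial ι K)))
    (hD : ∀ j k, D (lin K j k) = (if j = i then 1 else 0) - (if k = i then 1 else 0)) :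
    D (kernelPoly ι K a) = (a + 1) * ∑ j ∈ Finset.univ.erase i, T j * (lin K j i - lin K i j) := by
  set e : ι × ι → ℕ := fun p => if p.1 = p.2 then a else a + 1 with he
  set Q : ι × ι → MvPolynomial ι (MvPolynomial ι K) := fun p =>
    (∏ q ∈ Finset.univ.erase p, lin K q.1 q.2 ^ e q) * (e p * lin K p.1 p.2 ^ (e p - 1)) with hQ
  have hQe : ∀ j k, j ≠ k → lin K j k * Q (j, k) = (a + 1) * kernelPoly ι K a := by
    intro j k hjk
    rw [kernelPoly, ← Finset.mul_prod_erase _ _ (Finset.mem_univ (j, k))]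
    simp only [hQ, he, if_neg hjk, Nat.add_sub_cancel]
    push_cast
    ring
  have h1 : D (kernelPoly ι K a) =
      ∑ p, Q p * ((if p.1 = i then 1 else 0) - (if p.2 = i then 1 else 0)) := by
    rw [kernelPoly, leibniz_prod]
    refine Finset.sum_congr rfl fun p _ => ?_
    rw [D.leibniz_pow, hD, hQ, smul_eq_mul, nsmul_eq_mul]
    ring
  have h2 : D (kernelPoly ι K a) = ∑ j, (Q (i, j) - Q (j, i)) := by
    rw [h1, Fintype.sum_prod_type]
    simp only [mul_sub, Finset.sum_sub_distrib, mul_ite, mul_one, mul_zero]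
    congr 1
    · rw [Finset.sum_comm]; simp
    · simp
  rw [h2, ← Finset.add_sum_erase _ _ (Finset.mem_univ i), sub_self, zero_add, Finset.mul_sum]
  refine Finset.sum_congr rfl fun j hj => ?_
  have hji := Finset.ne_of_mem_erase hj
  have h3 : Q (i, j) = (a + 1) * (lin K j i * T j) := by
    apply mul_left_cancel₀ (lin_ne_zero i j)
    rw [hQe _ _ hji.symm, hT j hji]; ring
  have h4 : Q (j, i) = (a + 1) * (lin K i j * T j) := by
    apply mul_left_cancel₀ (lin_ne_zero j i)
    rw [hQe _ _ hji, hT j hji]; ring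
  rw [h3, h4]; ring

/-- Dunkl operators in the two sets of variables act on `kernelPoly` by opposite operators. -/
theorem dunkl_kernelPoly (a : ℕ) (i : ι) :
    dunkl (algebraMap K (MvPolynomial ι K) (-((a + 1 : ℕ) : K))) Finset.univ i
      (kernelPoly ι K a) =
    - mapCoeff (dunkl (-((a + 1 : ℕ) : K)) Finset.univ i) (kernelPoly ι K a) := by
  have hex : ∀ j, ∃ T, j ≠ i → kernelPoly ι K a = lin K i j * lin K j i * T := by
    intro j
    by_cases h : j = i
    · exact ⟨0, fun h' => (h' h).elim⟩
    · obtain ⟨T, hT⟩ := exists_kernelPoly_eq (K := K) a (Ne.symm h)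
      exact ⟨T, fun _ => hT⟩
  choose T hT using hex
  have hder := derivation_kernelPoly hT
    ((pderiv (R := MvPolynomial ι K) i).restrictScalars K + coeffDeriv (pderiv i)) (by
      intro j k
      simp only [Derivation.add_apply, Derivation.restrictScalars_apply, coeffDeriv_apply]
      have h1 : mapCoeff (pderiv (R := K) i).toLinearMap (lin K j k) =
          - (if k = i then 1 else 0) := by
        rw [lin, map_sub, X, C_apply, mapCoeff_monomial, mapCoeff_monomial]
        simp [pderiv_X, Pi.single_apply]
      rw [h1, lin, map_sub, pderiv_X, pderiv_C, Pi.single_apply, sub_zero, sub_eq_add_neg])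
  simp only [Derivation.add_apply, Derivation.restrictScalars_apply, coeffDeriv_apply] at hder
  have hx : dunkl (algebraMap K (MvPolynomial ι K) (-((a + 1 : ℕ) : K))) Finset.univ i
      (kernelPoly ι K a) = pderiv i (kernelPoly ι K a) +
      (a + 1) * ∑ j ∈ Finset.univ.erase i, T j * (C (X i) - C (X j)) := by
    rw [dunkl_apply, smul_eq_C_mul]
    simp only [algebraMap_eq, map_neg, map_natCast]
    rw [Finset.sum_congr rfl fun j hj => divDiff_kernelPoly (Finset.ne_of_mem_erase hj).symm
      (hT j (Finset.ne_of_mem_erase hj)), Finset.sum_neg_distrib]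
    push_cast
    ring
  have hr : mapCoeff (dunkl (-((a + 1 : ℕ) : K)) Finset.univ i) (kernelPoly ι K a) =
      mapCoeff (pderiv (R := K) i).toLinearMap (kernelPoly ι K a) +
      (a + 1) * ∑ j ∈ Finset.univ.erase i, T j * (X i - X j) := by
    have : mapCoeff (dunkl (-((a + 1 : ℕ) : K)) Finset.univ i) (kernelPoly ι K a) =
        mapCoeff (pderiv (R := K) i).toLinearMap (kernelPoly ι K a) -
        (a + 1) * ∑ j ∈ Finset.univ.erase i, mapCoeff (divDiff (A := K) i j) (kernelPoly ι K a) := by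
      ext1 m
      have hC : ((a : MvPolynomial ι (MvPolynomial ι K)) + 1) = C (((a + 1 : ℕ) : MvPolynomial ι K)) := by simp
      rw [coeff_sub, hC, coeff_C_mul, coeff_sum]
      simp only [coeff_mapCoeff, dunkl_apply]
      rw [smul_eq_C_mul]
      simp
      ring
    rw [this, Finset.sum_congr rfl fun j hj => mapCoeff_divDiff_kernelPoly
      (Finset.ne_of_mem_erase hj).symm (hT j (Finset.ne_of_mem_erase hj)), Finset.sum_neg_distrib]
    ring
  rw [hx, hr, eq_neg_iff_add_eq_zero]
  have : ∑ j ∈ Finset.univ.erase i, T j * (lin K j i - lin K i j) +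
      (∑ j ∈ Finset.univ.erase i, T j * (C (X i) - C (X j)) +
      ∑ j ∈ Finset.univ.erase i, T j * (X i - X j)) = 0 := by
    rw [← Finset.sum_add_distrib, ← Finset.sum_add_distrib]
    refine Finset.sum_eq_zero fun j _ => ?_
    simp only [lin]; ring
  linear_combination hder + (a + 1) * this

/-- The images of `kernelPoly` under functionals on the coefficient ring. -/
noncomputable def kernelImage (ι K : Type*) [Field K] [Fintype ι] [DecidableEq ι] (a : ℕ) :
    Submodule K (MvPolynomial ι K) where
  carrier := {p | ∃ τ : MvPolynomial ι K →ₗ[K] K, mapCoeff τ (kernelPoly ι K a) = p}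
  zero_mem' := ⟨0, by ext m; simp⟩
  add_mem' := by
    rintro _ _ ⟨τ, rfl⟩ ⟨τ', rfl⟩
    exact ⟨τ + τ', by ext m; simp⟩
  smul_mem' := by
    rintro k _ ⟨τ, rfl⟩
    exact ⟨k • τ, by ext m; simp⟩

theorem mem_kernelImage {a : ℕ} {p : MvPolynomial ι K} :
    p ∈ kernelImage ι K a ↔ ∃ τ : MvPolynomial ι K →ₗ[K] K, mapCoeff τ (kernelPoly ι K a) = p :=
  Iff.rfl

theorem dunkl_mem_kernelImage {a : ℕ} {p : MvPolynomial ι K} (hp : p ∈ kernelImage ι K a) (i : ι) :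
    dunkl (-((a + 1 : ℕ) : K)) Finset.univ i p ∈ kernelImage ι K a := by
  obtain ⟨τ, rfl⟩ := hp
  refine ⟨- (τ ∘ₗ dunkl (-((a + 1 : ℕ) : K)) Finset.univ i), ?_⟩
  have := mapCoeff_dunkl τ (-((a + 1 : ℕ) : K)) Finset.univ i (kernelPoly ι K a)
  rw [Algebra.algebraMap_self, RingHom.id_apply] at this
  rw [← this, dunkl_kernelPoly, map_neg, mapCoeff_mapCoeff]
  ext m; simp

theorem dunklAct_mem_kernelImage {a : ℕ} (h : MvPolynomial ι K) {p : MvPolynomial ι K}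
    (hp : p ∈ kernelImage ι K a) :
    dunklAct (-((a + 1 : ℕ) : K)) Finset.univ h p ∈ kernelImage ι K a := by
  induction h using MvPolynomial.induction_on generalizing p with
  | C k => rw [dunklAct_C]; exact Submodule.smul_mem _ _ hp
  | add f g hf hg =>
    rw [map_add, LinearMap.add_apply]
    exact add_mem (hf hp) (hg hp)
  | mul_X f i hf =>
    rw [dunklAct_mul, dunklAct_X _ (Finset.mem_univ i)]
    exact hf (dunkl_mem_kernelImage hp i)

theorem prod_X_pow_mem_kernelImage (a : ℕ) :
    ∏ i : ι, (X i : MvPolynomial ι K) ^ ((a + 1) * Fintype.card ι - 1) ∈ kernelImage ι K a := by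
  refine ⟨(aeval (R := K) (0 : ι → K)).toLinearMap, ?_⟩
  rw [mapCoeff_algHom, kernelPoly, map_prod, Fintype.prod_prod_type]
  refine Finset.prod_congr rfl fun i _ => ?_
  have : ∀ k, map ((aeval (R := K) (0 : ι → K) : MvPolynomial ι K →ₐ[K] K) : _ →+* K)
      (lin K i k) = X i := by
    intro k; simp [lin]
  simp only [map_pow, this]
  rw [Finset.prod_pow_eq_pow_sum, ← Finset.add_sum_erase _ _ (Finset.mem_univ i), if_pos rfl,
    Finset.sum_congr rfl fun k hk => if_neg (Finset.ne_of_mem_erase hk).symm,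
    Finset.sum_const, Finset.card_erase_of_mem (Finset.mem_univ i), Finset.card_univ]
  congr 1
  have : 1 ≤ Fintype.card ι := Fintype.card_pos_iff.2 ⟨i⟩
  obtain ⟨n, hn⟩ : ∃ n, Fintype.card ι = n + 1 := ⟨_, (Nat.sub_add_cancel this).symm⟩
  rw [hn, Nat.add_sub_cancel, smul_eq_mul]
  rw [show (a + 1) * (n + 1) = a + n * (a + 1) + 1 by ring, Nat.add_sub_cancel]

end Kernel

section Density

variable {ι : Type*} [Fintype ι] [DecidableEq ι] {K : Type*} [Field K] [CharZero K] [Algebra ℚ K]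
  [IsAlgClosed K]

/-- Every polynomial of degree less than `(a + 1) * card ι` in each variable is the image of
`kernelPoly` under some functional. -/
theorem mem_kernelImage_of_degreeOf_le [Nonempty ι] (a : ℕ) (g : MvPolynomial ι K)
    (hg : ∀ i, degreeOf i g ≤ (a + 1) * Fintype.card ι - 1) : g ∈ kernelImage ι K a := by
  by_contra hgN
  have hcard : 1 ≤ Fintype.card ι := Fintype.card_pos
  obtain ⟨M, hM⟩ : ∃ M, (a + 1) * Fintype.card ι = M + 1 :=
    ⟨_, (Nat.sub_add_cancel (Nat.mul_pos a.succ_pos hcard)).symm⟩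
  have hprod : ∏ i : ι, (X i : MvPolynomial ι K) ^ M ∈ kernelImage ι K a := by
    have := prod_X_pow_mem_kernelImage (ι := ι) (K := K) a
    rwa [hM] at this
  rw [hM, Nat.add_sub_cancel] at hg
  set V := restrictDegree ι K M with hV
  have hmemV : ∀ p : MvPolynomial ι K, p ∈ V ↔ ∀ i, degreeOf i p ≤ M := by
    intro p
    rw [hV, mem_restrictDegree]
    simp only [degreeOf_le_iff]
    tauto
  set c := a + 1 with hc
  set w := ∏ i : ι, (X i : MvPolynomial ι K) ^ M with hw
  have hw0 : w ≠ 0 := Finset.prod_ne_zero_iff.2 fun i _ => pow_ne_zero _ (X_ne_zero i)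
  have hwh : w.IsHomogeneous (Fintype.card ι * M) := by
    have := IsHomogeneous.prod Finset.univ (fun i : ι => (X i : MvPolynomial ι K) ^ M) (fun _ => M)
      fun i _ => by simpa using (isHomogeneous_X K i).pow M
    simpa using this
  have hwV : ∀ i, degreeOf i w ≤ M := by
    intro i
    refine (degreeOf_prod_le _ _ _).trans ?_
    rw [Finset.sum_eq_single i]
    · refine (degreeOf_pow_le _ _ _).trans ?_
      simp
    · intro j _ hj
      refine Nat.le_zero.1 ((degreeOf_pow_le _ _ _).trans ?_)
      rw [degreeOf_X_of_ne hj.symm, mul_zero]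
    · simp
  obtain ⟨ψ, hψg, hψN⟩ := Submodule.exists_dual_map_eq_bot_of_notMem hgN inferInstance
  obtain ⟨h, hh⟩ := exists_pairing_eq (c := c) (by omega) V (ψ ∘ₗ V.subtype)
  have hN : ∀ p, dunklAct (-(c : K)) Finset.univ p w ∈ kernelImage ι K a :=
    fun p => dunklAct_mem_kernelImage p hprod
  have hdeg : ∀ p (q : MvPolynomial ι K), (∀ i, degreeOf i q ≤ M) →
      ∀ i, degreeOf i (dunklAct (-(c : K)) Finset.univ p q) ≤ M :=
    fun p q hq i => degreeOf_dunklAct_le _ _ _ hq i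
  set P := fun i => lineDeriv (-c : K) (Finset.univ : Finset ι) i (M + 1) with hP
  have hPh : ∀ i, (P i).IsHomogeneous (M + 1) := fun i => isHomogeneous_lineDeriv _ _ _ _
  set I := Ideal.span (Set.range P) with hI
  have hIg : IsGradedIdeal I := by
    refine isGradedIdeal_span ?_
    rintro _ ⟨i, rfl⟩
    exact ⟨_, hPh i⟩
  have hpair : ∀ u ∈ I, ∀ q : MvPolynomial ι K, (∀ i, degreeOf i q ≤ M) →
      pairing (-c : K) Finset.univ u q = 0 := by
    intro u hu
    refine Submodule.span_induction ?_ ?_ ?_ ?_ hu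
    · rintro _ ⟨i, rfl⟩ q hq
      have hM' : c * (Finset.univ : Finset ι).card = M + 1 := by rw [Finset.card_univ, hM]
      obtain ⟨ρ, -, hρ⟩ := pairing_lineDeriv (A := K) (c := c) (by omega) (Finset.mem_univ i)
        (lineSeries_neg_eq_zero (by omega) (Finset.mem_univ i) le_rfl)
      rw [hM'] at hρ
      rw [hP, hρ q, notMem_support_iff.1, mul_zero]
      intro hmem
      have := degreeOf_le_iff.1 (hq i) _ hmem
      simp at this
    · intro q _
      simpa using pairing_C_mul_left (-c : K) Finset.univ (0 : K) 0 q
    · intro f f' _ _ hf hf' q hq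
      rw [pairing_add_left, hf q hq, hf' q hq, add_zero]
    · intro r f _ hf q hq
      rw [smul_eq_mul, mul_comm, pairing_mul]
      exact hf _ (hdeg _ _ hq)
  have hψh : ∀ q : MvPolynomial ι K, (∀ i, degreeOf i q ≤ M) →
      ψ q = pairing (-c : K) Finset.univ h q := fun q hq => hh ⟨q, (hmemV q).2 hq⟩
  have hhI : h ∉ I := by
    intro hmem
    exact hψg (by rw [hψh g hg, hpair h hmem g hg])
  have hJ : ∀ p, pairing (-c : K) Finset.univ (h * p) w = 0 := by
    intro p
    rw [pairing_mul, ← hψh _ (hdeg _ _ hwV)]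
    have := Submodule.mem_map_of_mem (f := ψ) (hN p)
    rwa [hψN, Submodule.mem_bot] at this
  have hsub : ∀ u v : MvPolynomial ι K, u - v ∈ I →
      pairing (-c : K) Finset.univ u w = pairing (-c : K) Finset.univ v w := by
    intro u v huv
    rw [← sub_add_cancel u v, pairing_add_left, hpair _ huv w hwV, zero_add]
  obtain ⟨σ, hσh, hσ⟩ := exists_isSocle_lineDeriv (ι := ι) (K := K) (c := c) (by omega) hM
  obtain ⟨v, hv⟩ := hσ.2 h hhI
  have hσ0 : pairing (-c : K) Finset.univ σ w = 0 := by rw [← hsub _ _ hv, hJ]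
  obtain ⟨u, hu⟩ : ∃ u, pairing (-c : K) Finset.univ u w ≠ 0 := by
    by_contra! hcon
    exact hw0 (eq_zero_of_pairing_eq_zero (by omega) hcon)
  set e := Fintype.card ι * M with he
  set u' := homogeneousComponent e u with hu'
  have hu'h : u'.IsHomogeneous e := homogeneousComponent_isHomogeneous _ _
  have hu'w : pairing (-c : K) Finset.univ u' w ≠ 0 := by
    rwa [hu', pairing_homogeneousComponent, homogeneousComponent_of_mem hwh, if_pos rfl]
  have hu'I : u' ∉ I := fun hmem => hu'w (hpair _ hmem w hwV)
  obtain ⟨v', hv'⟩ := hσ.2 u' hu'I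
  have hv0 := hIg _ hv' e
  rw [map_sub, homogeneousComponent_of_mem hσh, if_pos rfl,
    homogeneousComponent_mul_of_isHomogeneous hu'h, if_pos le_rfl, Nat.sub_self,
    homogeneousComponent_zero, mul_comm] at hv0
  have h1 := hsub _ _ hv0
  rw [pairing_C_mul_left, hσ0, mul_eq_zero, or_iff_left hu'w] at h1
  rw [h1, C_0, zero_mul, zero_sub] at hv0
  exact hσ.1 (neg_mem_iff.1 hv0)

end Density

section Alternation

variable {b : ℕ} {A : Type*} [CommRing A]

/-- Antisymmetrization of a polynomial. -/
noncomputable def alternation (p : MvPolynomial (Fin b) A) : MvPolynomial (Fin b) A :=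
  ∑ w : Equiv.Perm (Fin b), (Equiv.Perm.sign w : ℤ) • rename w p

theorem alternation_mul {g : MvPolynomial (Fin b) A} (hg : g.IsSymmetric)
    (p : MvPolynomial (Fin b) A) : alternation (g * p) = g * alternation p := by
  simp only [alternation, map_mul, hg _, Finset.mul_sum]
  exact Finset.sum_congr rfl fun w _ => (mul_smul_comm _ _ _).symm

theorem alternation_prod_eval (P : Fin b → Polynomial A) :
    alternation (∏ i, Polynomial.aeval (X i : MvPolynomial (Fin b) A) (P i)) =
      (Matrix.of fun i j => Polynomial.aeval (X i : MvPolynomial (Fin b) A) (P j)).det := by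
  rw [alternation, Matrix.det_apply]
  refine Finset.sum_congr rfl fun w _ => ?_
  rw [map_prod, ← Units.smul_def]
  congr 1
  refine Finset.prod_congr rfl fun i _ => ?_
  rw [← Polynomial.aeval_algHom_apply, rename_X]
  rfl

/-- An antisymmetrized product of polynomials of small degree is a multiple of the Vandermonde
determinant. -/
theorem alternation_prod_eval_eq (P : Fin b → Polynomial A) (hP : ∀ i, (P i).natDegree < b) :
    alternation (∏ i, Polynomial.aeval (X i : MvPolynomial (Fin b) A) (P i)) =
      (Matrix.vandermonde (X : Fin b → MvPolynomial (Fin b) A)).det *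
        C (Matrix.of fun i j : Fin b => (P j).coeff i).det := by
  have h : (Matrix.of fun i j => Polynomial.aeval (X i : MvPolynomial (Fin b) A) (P j)) =
      Matrix.vandermonde (X : Fin b → MvPolynomial (Fin b) A) *
        (C : A →+* MvPolynomial (Fin b) A).mapMatrix (Matrix.of fun i j : Fin b => (P j).coeff i) := by
    ext1 i j
    simp only [Matrix.of_apply, Matrix.mul_apply, Matrix.vandermonde_apply, RingHom.mapMatrix_apply,
      Matrix.map_apply]
    rw [Polynomial.aeval_eq_sum_range' (hP j), Finset.sum_range]
    exact Finset.sum_congr rfl fun k _ => by rw [smul_eq_C_mul, mul_comm]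
  rw [alternation_prod_eval, h, Matrix.det_mul, RingHom.map_det]

theorem alternation_prod_X_pow :
    alternation (∏ i : Fin b, (X i : MvPolynomial (Fin b) A) ^ (i : ℕ)) =
      (Matrix.vandermonde (X : Fin b → MvPolynomial (Fin b) A)).det := by
  have h := alternation_prod_eval (A := A) (fun i : Fin b => Polynomial.X ^ (i : ℕ))
  simp only [map_pow, Polynomial.aeval_X] at h
  rw [h]
  rfl

theorem mapCoeff_alternation {K B : Type*} [CommRing K] [CommRing B] [Algebra K A] [Algebra K B]
    (L : A →ₗ[K] B) (p : MvPolynomial (Fin b) A) :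
    mapCoeff L (alternation p) = alternation (mapCoeff L p) := by
  simp only [alternation, map_sum, map_zsmul, mapCoeff_rename]

variable {K : Type*} [Field K]

theorem kernelPoly_eq_mul (a : ℕ) :
    kernelPoly (Fin b) K a = (∏ p : Fin b × Fin b, lin K p.1 p.2 ^ a) *
      ∏ i, Polynomial.aeval (X i : MvPolynomial (Fin b) (MvPolynomial (Fin b) K))
        (∏ k ∈ Finset.univ.erase i, (Polynomial.X - Polynomial.C (X k : MvPolynomial (Fin b) K))) := by
  rw [kernelPoly, Fintype.prod_prod_type, Fintype.prod_prod_type, ← Finset.prod_mul_distrib]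
  refine Finset.prod_congr rfl fun j _ => ?_
  rw [map_prod, ← Finset.mul_prod_erase _ _ (Finset.mem_univ j),
    ← Finset.mul_prod_erase _ (fun k => lin K j k ^ a) (Finset.mem_univ j), if_pos rfl,
    mul_assoc, ← Finset.prod_mul_distrib]
  congr 1
  refine Finset.prod_congr rfl fun k hk => ?_
  rw [if_neg (Finset.ne_of_mem_erase hk).symm, pow_succ]
  simp [lin]

theorem exists_mapCoeff_eq_of_isSymmetric [CharZero K] [Algebra ℚ K] [IsAlgClosed K] {a : ℕ}
    (hb : 1 ≤ b) {g : MvPolynomial (Fin b) K} (hg : g.IsSymmetric)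
    (hdeg : ∀ i, degreeOf i g ≤ a * b) :
    ∃ τ : MvPolynomial (Fin b) K →ₗ[K] K,
      g = mapCoeff τ (∏ p : Fin b × Fin b, lin K p.1 p.2 ^ a) := by
  have : Nonempty (Fin b) := ⟨⟨0, hb⟩⟩
  obtain ⟨τ, hτ⟩ := mem_kernelImage.1 <| mem_kernelImage_of_degreeOf_le a
    (g * ∏ i : Fin b, X i ^ (i : ℕ)) fun i => by
      have h1 : degreeOf i (∏ j : Fin b, (X j : MvPolynomial (Fin b) K) ^ (j : ℕ)) ≤ i := by
        refine (degreeOf_prod_le _ _ _).trans ?_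
        rw [Finset.sum_eq_single i]
        · refine (degreeOf_pow_le _ _ _).trans ?_
          simp
        · intro j _ hj
          refine Nat.le_zero.1 ((degreeOf_pow_le _ _ _).trans ?_)
          rw [degreeOf_X_of_ne hj.symm, mul_zero]
        · simp
      have h2 := degreeOf_mul_le i g (∏ j : Fin b, (X j : MvPolynomial (Fin b) K) ^ (j : ℕ))
      have h3 := hdeg i
      have h4 := i.2
      rw [Fintype.card_fin, add_mul, one_mul]
      omega
  set Q := ∏ p : Fin b × Fin b, lin K p.1 p.2 ^ a with hQ
  have hQs : Q.IsSymmetric := by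
    intro w
    have hl : ∀ k l, rename w (lin K k l) = lin K (w k) l := by intro k l; simp [lin]
    simp only [hQ, map_prod, map_pow, hl]
    rw [Fintype.prod_prod_type, Fintype.prod_prod_type]
    exact Equiv.prod_comp w fun k => ∏ l, lin K k l ^ a
  set V := (Matrix.vandermonde (X : Fin b → MvPolynomial (Fin b) K)).det with hV
  have hV0 : V ≠ 0 := Matrix.det_vandermonde_ne_zero_iff.2 (X_injective)
  have hVm : (Matrix.vandermonde (X : Fin b → MvPolynomial (Fin b) (MvPolynomial (Fin b) K))).det =
      map (algebraMap K (MvPolynomial (Fin b) K)) V := by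
    rw [hV, RingHom.map_det]
    congr 1
    ext1 i j
    simp [Matrix.vandermonde_apply]
  set P : Fin b → Polynomial (MvPolynomial (Fin b) K) := fun i =>
    ∏ k ∈ Finset.univ.erase i, (Polynomial.X - Polynomial.C (X k)) with hP
  have hPd : ∀ i, (P i).natDegree < b := by
    intro i
    rw [hP, Polynomial.natDegree_prod_of_monic _ _ fun k _ => Polynomial.monic_X_sub_C _]
    simp
    omega
  set G := (Matrix.of fun i j : Fin b => (P j).coeff i).det with hG
  have h1 := congrArg alternation hτ
  rw [← mapCoeff_alternation, kernelPoly_eq_mul, alternation_mul hQs,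
    alternation_prod_eval_eq P hPd, alternation_mul hg, alternation_prod_X_pow, ← hG, ← hV, hVm,
    show Q * (map (algebraMap K (MvPolynomial (Fin b) K)) V * C G) =
      C G * Q * map (algebraMap K (MvPolynomial (Fin b) K)) V by ring, mapCoeff_mul_map,
    Algebra.algebraMap_self, map_id, mapCoeff_C_mul] at h1
  exact ⟨_, (mul_right_cancel₀ hV0 h1).symm⟩

end Alternation

section Dehomogenization

variable {R : Type*} [CommRing R]

/-- Setting the second of two variables equal to `1`. -/
noncomputable def dehomogenize : MvPolynomial (Fin 2) R →ₐ[R] Polynomial R :=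
  aeval ![Polynomial.X, 1]

theorem coeff_dehomogenize {p : MvPolynomial (Fin 2) R} {n j : ℕ} (hp : p.IsHomogeneous n)
    (hj : j ≤ n) :
    (dehomogenize p).coeff j = coeff (Finsupp.single 0 j + Finsupp.single 1 (n - j)) p := by
  classical
  rw [dehomogenize, aeval_def, eval₂_eq']
  simp only [Fin.prod_univ_two, Matrix.cons_val_zero, Matrix.cons_val_one, one_pow, mul_one,
    Polynomial.finsetSum_coeff, Polynomial.algebraMap_eq, Polynomial.coeff_C_mul,
    Polynomial.coeff_X_pow, mul_ite, mul_zero]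
  rw [Finset.sum_eq_single (Finsupp.single 0 j + Finsupp.single 1 (n - j))]
  · simp
  · intro d hd hne
    rw [if_neg]
    rintro rfl
    apply hne
    have h := hp (mem_support_iff.1 hd)
    rw [Pi.one_def, ← Finsupp.degree_eq_weight_one, Finsupp.degree_eq_sum,
      Fin.sum_univ_two] at h
    ext i
    fin_cases i <;> (simp; try omega)
  · intro h
    rw [notMem_support_iff.1 h, ite_self]

/-- Polynomials over a multivariate polynomial ring all of whose coefficients are homogeneous
of the same degree. -/
theorem isHomogeneous_coeff_pow {σ : Type*} {p : Polynomial (MvPolynomial σ R)} {m : ℕ}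
    (hp : ∀ i, (p.coeff i).IsHomogeneous m) (n i : ℕ) :
    ((p ^ n).coeff i).IsHomogeneous (m * n) := by
  induction n generalizing i with
  | zero =>
    rw [pow_zero, Polynomial.coeff_one, mul_zero]
    split_ifs
    · exact isHomogeneous_one _ _
    · exact isHomogeneous_zero _ _ _
  | succ n ih =>
    rw [pow_succ, Polynomial.coeff_mul, mul_add, mul_one]
    exact IsHomogeneous.sum _ _ _ fun x _ => (ih _).mul (hp _)

end Dehomogenization

/-- The generic polynomial of degree `b` in one variable. -/
noncomputable def genPoly (b : ℕ) : Polynomial (MvPolynomial (Fin (b + 1)) ℂ) :=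
  ∑ i : Fin (b + 1), Polynomial.C (X i) * Polynomial.X ^ (i : ℕ)

theorem dehomogenize_genForm (b : ℕ) : dehomogenize (genForm b) = genPoly b := by
  simp only [genForm, map_sum, map_mul, map_pow, dehomogenize, algHom_C, aeval_X,
    Matrix.cons_val_zero, Matrix.cons_val_one, one_pow, mul_one, Polynomial.algebraMap_eq]
  rfl

theorem isHomogeneous_genForm (b : ℕ) : (genForm b).IsHomogeneous b := by
  refine IsHomogeneous.sum _ _ _ fun i _ => ?_
  have h := ((isHomogeneous_C_mul_X_pow (X i : MvPolynomial (Fin (b + 1)) ℂ) (0 : Fin 2) i).mul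
    (isHomogeneous_X_pow (R := MvPolynomial (Fin (b + 1)) ℂ) (1 : Fin 2) (b - i)))
  rwa [show (i : ℕ) + (b - i) = b by omega] at h

theorem coeffC_eq_coeff_genPoly_pow {a b j : ℕ} (hj : j ≤ a * b) :
    coeffC a b j = (genPoly b ^ a).coeff j := by
  have h := (isHomogeneous_genForm b).pow a
  rw [mul_comm b a] at h
  rw [coeffC, ← coeff_dehomogenize h hj, map_pow, dehomogenize_genForm]

theorem isHomogeneous_coeffC {a b j : ℕ} (hj : j ≤ a * b) : (coeffC a b j).IsHomogeneous a := by
  suffices h : ∀ i, ((genPoly b).coeff i).IsHomogeneous 1 by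
    simpa [coeffC_eq_coeff_genPoly_pow hj] using isHomogeneous_coeff_pow h a j
  intro i
  rw [genPoly, Polynomial.finsetSum_coeff]
  refine IsHomogeneous.sum _ _ _ fun k _ => ?_
  rw [Polynomial.coeff_C_mul, Polynomial.coeff_X_pow]
  split_ifs
  · simpa using isHomogeneous_X _ _
  · simpa using isHomogeneous_zero _ _ _

theorem isHomogeneous_FH {a b k : ℕ} {s : MvPolynomial (Fin (a * b + 1)) ℂ}
    (hs : s.IsHomogeneous k) : (FH a b s).IsHomogeneous (a * k) :=
  hs.aeval _ fun j => isHomogeneous_coeffC (by omega)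

theorem natDegree_genPoly_pow_lt (a b : ℕ) : (genPoly b ^ a).natDegree < a * b + 1 := by
  refine Nat.lt_succ_of_le (Polynomial.natDegree_pow_le_of_le a ?_)
  exact Polynomial.natDegree_sum_le_of_forall_le _ _ fun i _ =>
    (Polynomial.natDegree_C_mul_X_pow_le _ _).trans (by omega)

theorem genPoly_pow_eq_sum (a b : ℕ) :
    genPoly b ^ a =
      ∑ j : Fin (a * b + 1), Polynomial.C (coeffC a b j) * Polynomial.X ^ (j : ℕ) := by
  conv_lhs => rw [Polynomial.as_sum_range_C_mul_X_pow' _ (natDegree_genPoly_pow_lt a b)]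
  rw [Finset.sum_range]
  exact Finset.sum_congr rfl fun j _ => by rw [coeffC_eq_coeff_genPoly_pow (by omega)]

section RootMap

variable (b : ℕ)

/-- The generic monic split polynomial of degree `b`. -/
noncomputable def splitPoly : Polynomial (MvPolynomial (Fin b) ℂ) :=
  ∏ j, (Polynomial.X - Polynomial.C (X j))

/-- The homomorphism sending the coefficients of a generic polynomial to the coefficients of
the generic monic split polynomial. -/
noncomputable def rootMap : MvPolynomial (Fin (b + 1)) ℂ →ₐ[ℂ] MvPolynomial (Fin b) ℂ :=
  aeval fun i : Fin (b + 1) => (splitPoly b).coeff i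

theorem map_rootMap_genPoly : (genPoly b).map (rootMap b : _ →+* _) = splitPoly b := by
  have hd : (splitPoly b).natDegree < b + 1 := by
    rw [splitPoly, Polynomial.natDegree_prod_of_monic _ _ fun k _ => Polynomial.monic_X_sub_C _]
    simp
  rw [(splitPoly b).as_sum_range_C_mul_X_pow' hd, Finset.sum_range, genPoly,
    Polynomial.map_sum]
  simp [rootMap]

theorem isSymmetric_rootMap (h : MvPolynomial (Fin (b + 1)) ℂ) : (rootMap b h).IsSymmetric := by
  intro w
  have hw : (splitPoly b).map (rename w : _ →ₐ[ℂ] MvPolynomial (Fin b) ℂ).toRingHom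
      = splitPoly b := by
    rw [splitPoly, Polynomial.map_prod]
    simp only [AlgHom.toRingHom_eq_coe, Polynomial.map_sub, Polynomial.map_X, Polynomial.map_C,
      RingHom.coe_coe, rename_X]
    exact Equiv.prod_comp w fun j => Polynomial.X - Polynomial.C (X j)
  rw [rootMap, ← AlgHom.comp_apply, comp_aeval]
  congr 1
  congr 1
  ext1 i
  conv_rhs => rw [← hw]
  simp

theorem degreeOf_coeff_prod_X_sub_C_le (l : Fin b) (s : Finset (Fin b)) (i : ℕ) :
    degreeOf l ((∏ j ∈ s, (Polynomial.X - Polynomial.C (X j : MvPolynomial (Fin b) ℂ))).coeff i)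
      ≤ if l ∈ s then 1 else 0 := by
  classical
  induction s using Finset.induction_on generalizing i with
  | empty =>
    rw [Finset.prod_empty, Polynomial.coeff_one]
    split_ifs <;> simp
  | insert k s hk ih =>
    rw [Finset.prod_insert hk, sub_mul, Polynomial.coeff_sub, Polynomial.coeff_C_mul]
    refine (degreeOf_sub_le _ _ _).trans (max_le ?_ ?_)
    · cases i with
      | zero => simp
      | succ i =>
        rw [Polynomial.coeff_X_mul]
        refine (ih i).trans ?_
        split_ifs <;> simp_all
    · refine (degreeOf_mul_le _ _ _).trans ?_
      refine (Nat.add_le_add_left (ih i) _).trans ?_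
      by_cases hlk : l = k
      · subst hlk
        simp [hk]
      · rw [degreeOf_X_of_ne hlk]
        simp [hlk]

theorem degreeOf_rootMap_le {n : ℕ} {h : MvPolynomial (Fin (b + 1)) ℂ} (hh : h.IsHomogeneous n)
    (l : Fin b) : degreeOf l (rootMap b h) ≤ n := by
  rw [rootMap, aeval_def, eval₂_eq']
  refine (degreeOf_sum_le _ _ _).trans (Finset.sup_le fun d hd => ?_)
  refine (degreeOf_C_mul_le _ _ _).trans ((degreeOf_prod_le _ _ _).trans ?_)
  rw [hh.degree_eq_sum_deg_support hd, ← Finsupp.degree_apply, Finsupp.degree_eq_sum]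
  refine Finset.sum_le_sum fun i _ => (degreeOf_pow_le _ _ _).trans ?_
  have := degreeOf_coeff_prod_X_sub_C_le b l Finset.univ i
  rw [if_pos (Finset.mem_univ l)] at this
  simpa [splitPoly] using Nat.mul_le_mul_left (d i) this

theorem eval_smul_of_isHomogeneous {σ K : Type*} [CommRing K] {n : ℕ} {h : MvPolynomial σ K}
    (hh : h.IsHomogeneous n) (c : K) (y : σ → K) :
    eval (fun i => c * y i) h = c ^ n * eval y h := by
  rw [eval_eq, eval_eq, Finset.mul_sum]
  refine Finset.sum_congr rfl fun d hd => ?_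
  rw [hh.degree_eq_sum_deg_support hd]
  simp only [mul_pow, Finset.prod_mul_distrib, Finset.prod_pow_eq_pow_sum]
  ring

theorem eq_zero_of_rootMap_eq_zero {n : ℕ} {h : MvPolynomial (Fin (b + 1)) ℂ}
    (hh : h.IsHomogeneous n) (h0 : rootMap b h = 0) : h = 0 := by
  suffices H : X (Fin.last b) * h = 0 from
    (mul_eq_zero.1 H).resolve_left (X_ne_zero _)
  refine MvPolynomial.funext fun u => ?_
  rw [map_mul, eval_X, map_zero]
  by_cases hu : u (Fin.last b) = 0
  · rw [hu, zero_mul]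
  refine mul_eq_zero_of_right _ ?_
  set P : Polynomial ℂ := ∑ i : Fin (b + 1), Polynomial.C (u i) * Polynomial.X ^ (i : ℕ) with hP
  have hc : ∀ i : Fin (b + 1), P.coeff i = u i := by
    intro i
    simp [hP, Polynomial.finsetSum_coeff, Polynomial.coeff_X_pow, Fin.val_inj]
  have hd : P.natDegree = b := by
    refine le_antisymm ?_ (Polynomial.le_natDegree_of_ne_zero ?_)
    · exact Polynomial.natDegree_sum_le_of_forall_le _ _ fun i _ =>
        (Polynomial.natDegree_C_mul_X_pow_le _ _).trans (by omega)
    · exact (hc (Fin.last b)).symm ▸ hu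
  have hs := IsAlgClosed.splits P
  obtain ⟨l, hl⟩ : ∃ l : List ℂ, (l : Multiset ℂ) = P.roots := Quot.exists_rep _
  have hcard : l.length = b := by
    rw [← Multiset.coe_card, hl, ← hs.natDegree_eq_card_roots, hd]
  set y : Fin b → ℂ := fun j => l[j] with hy
  have hPy : P = Polynomial.C (u (Fin.last b)) *
      (splitPoly b).map (eval y) := by
    rw [hs.eq_prod_roots, Polynomial.leadingCoeff, hd]
    congr 1
    · rw [← hc (Fin.last b)]; rfl
    · rw [splitPoly, Polynomial.map_prod]
      simp only [Polynomial.map_sub, Polynomial.map_X, Polynomial.map_C, eval_X, hy]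
      rw [← hl, Multiset.map_coe, Multiset.prod_coe, ← Fin.prod_univ_fun_getElem]
      exact (Equiv.prod_comp (finCongr hcard.symm) _).symm
  have hu' : u = fun i : Fin (b + 1) => u (Fin.last b) * eval y ((splitPoly b).coeff i) := by
    ext i
    rw [← hc i]
    conv_lhs => rw [hPy]
    simp
  rw [hu', eval_smul_of_isHomogeneous hh]
  refine mul_eq_zero_of_right _ ?_
  have := congrArg (eval y) h0
  rw [rootMap, map_zero, aeval_def, eval_eval₂] at this
  rw [← this, eval, coe_eval₂Hom]
  congr 1
  ext; simp

end RootMap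

section BaseCase

theorem prod_lin_pow_eq (a b : ℕ) :
    ∏ p : Fin b × Fin b, lin ℂ p.1 p.2 ^ a =
      (∏ _p : Fin b × Fin b, (-1 : ℂ) ^ a) • ∏ k : Fin b, ∑ j : Fin (a * b + 1),
        C (X k ^ (j : ℕ)) * map (algebraMap ℂ (MvPolynomial (Fin b) ℂ))
          (rootMap b (coeffC a b j)) := by
  have h : ∀ k : Fin b, (∑ j : Fin (a * b + 1),
      C (X k ^ (j : ℕ)) * map (algebraMap ℂ (MvPolynomial (Fin b) ℂ))
        (rootMap b (coeffC a b j))) = ∏ j, (C (X k) - X j) ^ a := by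
    intro k
    have h1 := congrArg (Polynomial.map (rootMap b : _ →+* MvPolynomial (Fin b) ℂ)) (genPoly_pow_eq_sum a b)
    rw [Polynomial.map_pow, map_rootMap_genPoly] at h1
    have h2 := congrArg (Polynomial.eval₂ (map (algebraMap ℂ (MvPolynomial (Fin b) ℂ)))
      (C (X k) : MvPolynomial (Fin b) (MvPolynomial (Fin b) ℂ))) h1
    rw [Polynomial.eval₂_pow, splitPoly, Polynomial.eval₂_finsetProd, Polynomial.map_sum,
      Polynomial.eval₂_finsetSum, ← Finset.prod_pow] at h2
    simp only [Polynomial.eval₂_sub, Polynomial.eval₂_X, Polynomial.eval₂_C, map_X,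
      Polynomial.map_mul, Polynomial.map_C, Polynomial.map_pow, Polynomial.map_X,
      Polynomial.eval₂_mul, Polynomial.eval₂_pow, RingHom.coe_coe] at h2
    rw [h2]
    exact Finset.sum_congr rfl fun j _ => by rw [map_pow, mul_comm]
  simp only [h]
  rw [Fintype.prod_prod_type_right, Fintype.prod_prod_type_right, Algebra.smul_def]
  simp only [map_prod, ← Finset.prod_mul_distrib]
  refine Finset.prod_congr rfl fun k _ => Finset.prod_congr rfl fun j _ => ?_
  rw [map_pow, ← mul_pow, map_neg, map_one, lin]
  congr 1
  ring

/-- The Foulkes–Howe map is surjective in degree `b`. -/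
theorem exists_FH_eq_of_degree_eq {a b : ℕ} (hb : 1 ≤ b) {h : MvPolynomial (Fin (b + 1)) ℂ}
    (hh : h.IsHomogeneous (a * b)) :
    ∃ s : MvPolynomial (Fin (a * b + 1)) ℂ, s.IsHomogeneous b ∧ FH a b s = h := by
  obtain ⟨τ, hτ⟩ := exists_mapCoeff_eq_of_isSymmetric hb (isSymmetric_rootMap b h)
    (degreeOf_rootMap_le b hh)
  set s : MvPolynomial (Fin (a * b + 1)) ℂ := (∏ _p : Fin b × Fin b, (-1 : ℂ) ^ a) •
    ∑ f : Fin b → Fin (a * b + 1), C (τ (∏ k, X k ^ (f k : ℕ))) * ∏ k, X (f k) with hs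
  have hsh : s.IsHomogeneous b := by
    refine (homogeneousSubmodule _ ℂ b).smul_mem _ (IsHomogeneous.sum _ _ _ fun f _ => ?_)
    refine IsHomogeneous.C_mul ?_ _
    simpa using IsHomogeneous.prod Finset.univ (fun k => (X (f k) : MvPolynomial _ ℂ))
      (fun _ => 1) fun k _ => isHomogeneous_X _ _
  refine ⟨s, hsh, ?_⟩
  rw [← sub_eq_zero]
  refine eq_zero_of_rootMap_eq_zero b ((isHomogeneous_FH hsh).sub hh) ?_
  rw [map_sub, sub_eq_zero, hτ, prod_lin_pow_eq, hs, map_smul, map_smul, map_smul]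
  congr 1
  rw [Finset.prod_univ_sum, map_sum, map_sum, map_sum]
  simp only [Fintype.piFinset_univ]
  refine Finset.sum_congr rfl fun f _ => ?_
  rw [Finset.prod_mul_distrib, ← map_prod, ← map_prod, mapCoeff_mul_map]
  rw [show mapCoeff τ (C (∏ x, X x ^ (f x : ℕ)) : MvPolynomial (Fin b) _) = C (τ _) from
    mapCoeff_monomial τ _ _]
  simp [FH, algHom_C, map_id]

end BaseCase

section Surjectivity

variable {a b : ℕ}

theorem pow_mem_map_FH (t : ℂ) :
    ∃ s : MvPolynomial (Fin (a * b + 1)) ℂ, s.IsHomogeneous 1 ∧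
      FH a b s = (∑ j : Fin (b + 1), C (t ^ (j : ℕ)) * X j) ^ a := by
  refine ⟨∑ j : Fin (a * b + 1), C (t ^ (j : ℕ)) * X j,
    IsHomogeneous.sum _ _ _ fun j _ => isHomogeneous_C_mul_X _ _, ?_⟩
  have h := congrArg (Polynomial.eval (C t)) (genPoly_pow_eq_sum a b)
  rw [Polynomial.eval_pow, genPoly] at h
  simp only [Polynomial.eval_finsetSum, Polynomial.eval_mul, Polynomial.eval_C,
    Polynomial.eval_pow, Polynomial.eval_X] at h
  simp only [map_sum, map_mul, FH, algHom_C, aeval_X, algebraMap_eq, map_pow]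
  simp only [mul_comm _ (X _)]
  rw [h]
  exact Finset.sum_congr rfl fun j _ => mul_comm _ _

theorem exists_FH_eq_succ {k : ℕ} (hk : b ≤ k)
    (ih : ∀ h : MvPolynomial (Fin (b + 1)) ℂ, h.IsHomogeneous (a * k) →
      ∃ s : MvPolynomial (Fin (a * b + 1)) ℂ, s.IsHomogeneous k ∧ FH a b s = h)
    {h : MvPolynomial (Fin (b + 1)) ℂ} (hh : h.IsHomogeneous (a * (k + 1))) :
    ∃ s : MvPolynomial (Fin (a * b + 1)) ℂ, s.IsHomogeneous (k + 1) ∧ FH a b s = h := by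
  set M : Matrix (Fin (b + 1)) (Fin (b + 1)) ℂ :=
    Matrix.vandermonde fun i => ((i : ℕ) : ℂ) with hM
  have hMu : IsUnit M.det := by
    rw [isUnit_iff_ne_zero, hM, Matrix.det_vandermonde_ne_zero_iff]
    intro i j hij
    exact Fin.ext (Nat.cast_injective hij)
  set l : Fin (b + 1) → MvPolynomial (Fin (b + 1)) ℂ := fun i => ∑ j, C (M i j) * X j with hl
  set h' := aeval (fun i => ∑ j, C (M⁻¹ i j) * X j : Fin (b + 1) → MvPolynomial (Fin (b + 1)) ℂ) h
    with hh'
  have hl1 : ∀ i, (l i).IsHomogeneous 1 := fun i =>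
    IsHomogeneous.sum _ _ _ fun j _ => isHomogeneous_C_mul_X _ _
  have hhom : h'.IsHomogeneous (a * (k + 1)) := by
    rw [← one_mul (a * (k + 1))]
    exact hh.aeval _ fun i => IsHomogeneous.sum _ _ _ fun j _ => isHomogeneous_C_mul_X _ _
  have hlh : aeval l h' = h := by
    rw [hh', ← AlgHom.comp_apply, comp_aeval]
    have hX : (fun i => aeval l (∑ j, C (M⁻¹ i j) * X j)) = X := by
      ext1 i
      simp only [map_sum, map_mul, algHom_C, aeval_X, hl, Finset.mul_sum, algebraMap_eq]
      rw [Finset.sum_comm]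
      simp only [← mul_assoc, ← C_mul]
      simp only [← Finset.sum_mul, ← map_sum, ← Matrix.mul_apply, Matrix.nonsing_inv_mul M hMu]
      simp [Matrix.one_apply]
    rw [hX, aeval_X_left, AlgHom.id_apply]
  suffices H : h ∈ (homogeneousSubmodule _ ℂ (k + 1)).map (FH a b).toLinearMap by
    obtain ⟨s, hs, hsh⟩ := H
    exact ⟨s, hs, hsh⟩
  rw [← hlh, h'.as_sum, map_sum]
  refine Submodule.sum_mem _ fun d hd => ?_
  have hdeg := hhom.degree_eq_sum_deg_support hd
  rw [← Finsupp.degree_apply] at hdeg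
  obtain ⟨i, hi⟩ : ∃ i, a ≤ d i := by
    by_contra! hlt
    rw [Finsupp.degree_eq_sum] at hdeg
    have h1 : ∑ i, d i < ∑ _i : Fin (b + 1), a :=
      Finset.sum_lt_sum_of_nonempty Finset.univ_nonempty fun i _ => hlt i
    rw [← hdeg] at h1
    simp only [Finset.sum_const, Finset.card_univ, Fintype.card_fin, smul_eq_mul] at h1
    nlinarith
  obtain ⟨s₁, hs₁, h₁⟩ := pow_mem_map_FH (a := a) (b := b) ((i : ℕ) : ℂ)
  have hd' : d = Finsupp.single i a + (d - Finsupp.single i a) :=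
    (add_tsub_cancel_of_le (Finsupp.single_le_iff.2 hi)).symm
  have hdd : (d - Finsupp.single i a).degree = a * k := by
    rw [hd', map_add, Finsupp.degree_single] at hdeg
    rw [mul_add, mul_one] at hdeg
    omega
  obtain ⟨s₂, hs₂, h₂⟩ := ih (aeval l (monomial (d - Finsupp.single i a) (coeff d h'))) (by
    rw [← one_mul (a * k)]
    exact (isHomogeneous_monomial _ hdd).aeval _ hl1)
  refine ⟨s₁ * s₂, add_comm k 1 ▸ hs₁.mul hs₂, ?_⟩
  have hmon : monomial d (coeff d h') =
      X i ^ a * monomial (d - Finsupp.single i a) (coeff d h') := by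
    rw [X_pow_eq_monomial, monomial_mul, one_mul, ← hd']
  rw [hmon, map_mul (aeval l), map_pow (aeval l), aeval_X, ← h₂, AlgHom.toLinearMap_apply,
    map_mul, h₁]
  rfl

/-- The Foulkes–Howe map is surjective in all degrees at least `b`. -/
theorem exists_FH_eq (hb : 1 ≤ b) {k : ℕ} (hk : b ≤ k) {h : MvPolynomial (Fin (b + 1)) ℂ}
    (hh : h.IsHomogeneous (a * k)) :
    ∃ s : MvPolynomial (Fin (a * b + 1)) ℂ, s.IsHomogeneous k ∧ FH a b s = h := by
  induction k, hk using Nat.le_induction generalizing h with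
  | base => exact exists_FH_eq_of_degree_eq hb hh
  | succ k hk ih => exact exists_FH_eq_succ hk (fun h hh => ih hh) hh

end Surjectivity

section Dimension

theorem finite_homogeneousSubmodule (n k : ℕ) :
    Module.Finite ℂ (homogeneousSubmodule (Fin n) ℂ k) :=
  Module.Finite.iff_fg.2 (homogeneousSubmodule_fg _ _ _)

theorem finrank_homogeneousSubmodule (n k : ℕ) :
    Module.finrank ℂ (homogeneousSubmodule (Fin (n + 1)) ℂ k) = (n + k).choose n := by
  have e : {d : Fin (n + 1) →₀ ℕ | d.degree = k} ≃ Sym (Fin (n + 1)) k :=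
    (Equiv.subtypeEquivRight fun d => by rfl).trans (Sym.equivNatSum (Fin (n + 1)) k).symm
  have : Fintype {d : Fin (n + 1) →₀ ℕ | d.degree = k} := Fintype.ofEquiv _ e.symm
  rw [homogeneousSubmodule_eq_finsupp_supported,
    (AddMonoidAlgebra.supportedEquivFinsupp (R := ℂ) (S := ℂ) _).finrank_eq,
    Module.finrank_finsupp_self, Fintype.card_congr e, Sym.card_sym_eq_choose, Fintype.card_fin,
    show n + 1 + k - 1 = n + k by omega, ← Nat.choose_symm_add, add_comm]

theorem finrank_kernel_add {a b k : ℕ} (hb : 1 ≤ b) (hk : b ≤ k) :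
    Module.finrank ℂ ↥(homogeneousSubmodule (Fin (a * b + 1)) ℂ k ⊓
      LinearMap.ker (FH a b).toLinearMap) + (a * k + b).choose b = (a * b + k).choose (a * b) := by
  have := finite_homogeneousSubmodule (a * b + 1) k
  set H := homogeneousSubmodule (Fin (a * b + 1)) ℂ k
  have h := LinearMap.finrank_range_add_finrank_ker ((FH a b).toLinearMap.domRestrict H)
  have hr : LinearMap.range ((FH a b).toLinearMap.domRestrict H) =
      homogeneousSubmodule (Fin (b + 1)) ℂ (a * k) := by
    ext p
    constructor
    · rintro ⟨s, rfl⟩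
      exact isHomogeneous_FH s.2
    · intro hp
      obtain ⟨s, hs, rfl⟩ := exists_FH_eq hb hk hp
      exact ⟨⟨s, hs⟩, rfl⟩
  rw [hr, finrank_homogeneousSubmodule, finrank_homogeneousSubmodule, LinearMap.ker_domRestrict,
    ← Submodule.finrank_map_subtype_eq, Submodule.map_comap_subtype] at h
  rw [← h, add_comm, add_comm (a * k)]

end Dimension
end FoulkesHowe

/-- For `k ≥ b`, the degree-`k` component of `ker α` has dimension
`C(d+k, d) − C(ak+b, b)`, where `d = ab`. In particular, for `a, b ≥ 2` the
degree-`(b+1)` component has dimension `C(d+b+1, b+1) − C(d+a+b, b)`. -/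
theorem finrank_kernel_FH_degree_component (a b : ℕ) (ha : 1 ≤ a) (hb : 1 ≤ b) :
    (∀ k : ℕ, b ≤ k →
      (Module.finrank ℂ
        ↥(MvPolynomial.homogeneousSubmodule (Fin (a * b + 1)) ℂ k ⊓
          LinearMap.ker (FH a b).toLinearMap) : ℤ) =
        (a * b + k).choose (a * b) - (a * k + b).choose b) ∧
    (2 ≤ a → 2 ≤ b →
      (Module.finrank ℂ
        ↥(MvPolynomial.homogeneousSubmodule (Fin (a * b + 1)) ℂ (b + 1) ⊓
          LinearMap.ker (FH a b).toLinearMap) : ℤ) =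
        (a * b + b + 1).choose (b + 1) - (a * b + a + b).choose b) := by
  have h (k : ℕ) (hk : b ≤ k) := FoulkesHowe.finrank_kernel_add (a := a) hb hk
  refine ⟨fun k hk => ?_, fun _ _ => ?_⟩
  · rw [← h k hk]
    push_cast
    ring
  · have h1 := h (b + 1) (Nat.le_succ b)
    rw [Nat.choose_symm_add, mul_add, mul_one, ← add_assoc, add_right_comm (a * b)] at h1
    rw [← h1, add_right_comm (a * b)]
    push_cast
    ring
end

section
/- Every homogeneous polynomial in R of degree strictly greater than ⌊(b+2)/2⌋·(a−1) belongs to the ideal I_{a,b}, and there exists a homogeneous polynomial in R of degree exactly ⌊(b+2)/2⌋·(a−1) that does not belong to I_{a,b}. (Equivalently, the top nonvanishing degree of the Artinian algebra R/I_{a,b} is ⌊(b+2)/2⌋·(a−1), so the Castelnuovo–Mumford regularity of I_{a,b} equals ⌊(b+2)/2⌋·a − ⌊b/2⌋; Theorem 1.3.) -/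
open MvPolynomial

/-- The ideal `I_{a,b} ⊆ R` generated by the coefficients `c_0, …, c_d` of `G^a`,
where `d = ab`. -/
noncomputable def Iab (a b : ℕ) : Ideal (MvPolynomial (Fin (b + 1)) ℂ) :=
  Ideal.span (Set.range fun j : Fin (a * b + 1) => coeffC a b (j : ℕ))

section ContractionAction

variable {σ : Type*} {k : Type*} [Field k]

theorem pderiv_comm (i j : σ) (p : MvPolynomial σ k) :
    pderiv i (pderiv j p) = pderiv j (pderiv i p) := by
  classical
  have h : ⁅(pderiv i : Derivation k (MvPolynomial σ k) (MvPolynomial σ k)),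
      (pderiv j : Derivation k (MvPolynomial σ k) (MvPolynomial σ k))⁆ = 0 := by
    refine MvPolynomial.derivation_ext fun l => ?_
    simp only [Derivation.commutator_apply, pderiv_X, Derivation.zero_apply, Pi.single_apply]
    split_ifs <;> simp
  have h1 := congrArg (fun D => D p) h
  simpa [Derivation.commutator_apply, sub_eq_zero] using h1

/-- Polynomials act on polynomials as constant-coefficient differential operators. -/
theorem exists_algHom_pderiv (σ k : Type*) [Field k] :
    ∃ D : MvPolynomial σ k →ₐ[k] Module.End k (MvPolynomial σ k),
      ∀ i p, D (X i) p = pderiv i p := by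
  let s : Set (Module.End k (MvPolynomial σ k)) :=
    Set.range fun i => (pderiv i : Derivation k (MvPolynomial σ k) _).toLinearMap
  have hs : ∀ f ∈ s, ∀ g ∈ s, f * g = g * f := by
    rintro _ ⟨i, rfl⟩ _ ⟨j, rfl⟩
    exact LinearMap.ext fun p => pderiv_comm i j p
  have hcomm := Algebra.isMulCommutative_adjoin k hs
  let _ : CommRing (Algebra.adjoin k s) :=
    { (Algebra.adjoin k s).toRing with mul_comm := hcomm.is_comm.comm }
  refine ⟨(Algebra.adjoin k s).val.comp
    (aeval (S₁ := Algebra.adjoin k s) fun i => ⟨_, Algebra.subset_adjoin (Set.mem_range_self i)⟩),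
    fun i p => ?_⟩
  simp

/-- A nonzero form of degree `n` is not annihilated by all operators of degree `n`. -/
theorem exists_isHomogeneous_apply_ne_zero [Fintype σ] [CharZero k]
    (D : MvPolynomial σ k →ₐ[k] Module.End k (MvPolynomial σ k))
    (hD : ∀ i p, D (X i) p = pderiv i p) (n : ℕ) (F : MvPolynomial σ k)
    (hF : F.IsHomogeneous n) (hF0 : F ≠ 0) :
    ∃ P : MvPolynomial σ k, P.IsHomogeneous n ∧ D P F ≠ 0 := by
  induction n generalizing F with
  | zero => exact ⟨1, isHomogeneous_one _ _, by simpa using hF0⟩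
  | succ n ih =>
    obtain ⟨i, hi⟩ : ∃ i, pderiv i F ≠ 0 := by
      by_contra! h
      have h1 := hF.sum_X_mul_pderiv
      simp only [h, mul_zero, Finset.sum_const_zero] at h1
      rw [eq_comm, smul_eq_zero] at h1
      exact h1.elim (by simp) hF0
    obtain ⟨P, hP, hPF⟩ := ih (pderiv i F) (by simpa using hF.pderiv (i := i)) hi
    refine ⟨P * X i, hP.mul (isHomogeneous_X _ _), ?_⟩
    simpa [hD] using hPF

end ContractionAction

section DerivationDet

variable {k A : Type*} [CommRing k] [CommRing A] [Algebra k A]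

theorem Derivation.leibniz_finset_prod {ι : Type*} [DecidableEq ι] (δ : Derivation k A A)
    (s : Finset ι) (f : ι → A) :
    δ (∏ i ∈ s, f i) = ∑ j ∈ s, (∏ i ∈ s.erase j, f i) * δ (f j) := by
  induction s using Finset.induction_on with
  | empty => simp
  | insert a s ha ih =>
    rw [Finset.prod_insert ha, δ.leibniz, ih, Finset.sum_insert ha, Finset.erase_insert ha,
      smul_eq_mul, smul_eq_mul, add_comm, Finset.mul_sum]
    refine congrArg₂ _ rfl (Finset.sum_congr rfl fun j hj => ?_)
    rw [Finset.erase_insert_of_ne (by rintro rfl; exact ha hj),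
      Finset.prod_insert (fun h => ha (Finset.mem_of_mem_erase h)), mul_assoc]

theorem Derivation.map_det {n : Type*} [DecidableEq n] [Fintype n] (δ : Derivation k A A)
    (M : Matrix n n A) :
    δ M.det = ∑ j, (M.updateCol j fun i => δ (M i j)).det := by
  simp only [Matrix.det_apply, map_sum]
  rw [Finset.sum_comm]
  refine Finset.sum_congr rfl fun τ _ => ?_
  rw [← Finset.smul_sum, Units.smul_def, map_zsmul, δ.leibniz_finset_prod, Units.smul_def]
  refine congrArg _ (Finset.sum_congr rfl fun j _ => ?_)
  rw [← Finset.mul_prod_erase _ _ (Finset.mem_univ j), mul_comm, Matrix.updateCol_self]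
  refine congrArg _ (Finset.prod_congr rfl fun i hi => ?_)
  rw [Matrix.updateCol_ne (Finset.ne_of_mem_erase hi)]

/-- A derivation that sends `M` to a constant matrix of rank at most one kills `det M` in two
steps. -/
theorem Derivation.det_of_rank_one {n : Type*} [DecidableEq n] [Fintype n] (δ : Derivation k A A)
    (M : Matrix n n A) (u v : n → A) (hM : ∀ i j, δ (M i j) = u i * v j)
    (hu : ∀ i, δ (u i) = 0) (hv : ∀ i, δ (v i) = 0) :
    δ (δ M.det) = 0 := by
  rw [δ.map_det, map_sum]
  refine Finset.sum_eq_zero fun j _ => ?_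
  rw [δ.map_det]
  refine Finset.sum_eq_zero fun l _ => ?_
  simp only [hM]
  by_cases h : l = j
  · subst h
    refine Matrix.det_eq_zero_of_column_eq_zero l fun i => ?_
    simp [hu, hv]
  · have h1 : (fun i => δ ((M.updateCol j fun i => u i * v j) i l)) = v l • u := by
      funext i
      rw [Matrix.updateCol_ne h, hM, Pi.smul_apply, smul_eq_mul, mul_comm]
    have h2 : (fun i => u i * v j) = v j • u := by
      funext i
      rw [Pi.smul_apply, smul_eq_mul, mul_comm]
    rw [h1, h2, Matrix.det_updateCol_smul, Matrix.updateCol_comm _ (Ne.symm h),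
      Matrix.det_updateCol_smul,
      Matrix.det_zero_of_column_eq h fun i => ?_, mul_zero, mul_zero]
    rw [Matrix.updateCol_ne h, Matrix.updateCol_self, Matrix.updateCol_self]

theorem Derivation.iterate_pow_mul_eq_zero (δ : Derivation k A A) {h : A} (hh : δ (δ h) = 0)
    (n : ℕ) (w : A) (hw : δ w = 0) : δ^[n + 1] (h ^ n * w) = 0 := by
  induction n generalizing w with
  | zero => simpa using hw
  | succ n ih =>
    rw [Function.iterate_succ_apply]
    have h1 : δ (h ^ (n + 1) * w) = h ^ n * (((n + 1 : ℕ) : A) * w * δ h) := by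
      simp only [Derivation.leibniz, Derivation.leibniz_pow, hw, smul_eq_mul, nsmul_eq_mul,
        Nat.add_sub_cancel]
      ring
    rw [h1]
    refine ih _ ?_
    simp [Derivation.leibniz, hw, hh]

end DerivationDet

theorem genForm_pow (a b : ℕ) :
    genForm b ^ a = ∑ k ∈ Finset.piAntidiag (Finset.univ : Finset (Fin (b + 1))) a,
      monomial (Finsupp.single (0 : Fin 2) (∑ i : Fin (b + 1), (i : ℕ) * k i) +
          Finsupp.single (1 : Fin 2) (∑ i : Fin (b + 1), (b - (i : ℕ)) * k i))
        (monomial (Finsupp.equivFunOnFinite.symm k)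
          (Nat.multinomial Finset.univ k : ℂ)) := by
  rw [genForm, Finset.sum_pow_eq_sum_piAntidiag]
  refine Finset.sum_congr rfl fun k _ => ?_
  simp only [mul_pow, Finset.prod_mul_distrib, ← pow_mul, Finset.prod_pow_eq_pow_sum, ← map_pow,
    ← map_prod]
  have h1 : (monomial (Finsupp.equivFunOnFinite.symm k) (Nat.multinomial Finset.univ k : ℂ)) =
      (Nat.multinomial Finset.univ k : MvPolynomial (Fin (b + 1)) ℂ) * ∏ i, X i ^ k i := by
    rw [monomial_eq, Finsupp.prod_fintype _ _ (by simp)]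
    simp
  rw [h1, X_pow_eq_monomial, X_pow_eq_monomial, mul_assoc (C _), monomial_mul, C_mul_monomial,
    ← map_natCast (C (σ := Fin 2)), C_mul_monomial]
  simp

/-- The multinomial expansion of `c_j`. -/
theorem coeffC_eq (a b j : ℕ) :
    coeffC a b j = ∑ k ∈ Finset.piAntidiag (Finset.univ : Finset (Fin (b + 1))) a with
        ∑ i : Fin (b + 1), (i : ℕ) * k i = j,
      monomial (Finsupp.equivFunOnFinite.symm k) (Nat.multinomial Finset.univ k : ℂ) := by
  rw [coeffC, genForm_pow, coeff_sum, Finset.sum_filter]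
  refine Finset.sum_congr rfl fun k hk => ?_
  rw [coeff_monomial]
  refine if_congr ⟨fun h => ?_, fun h => ?_⟩ rfl rfl
  · simpa using DFunLike.congr_fun h 0
  · have hs : ∑ i, k i = a := (Finset.mem_piAntidiag.1 hk).1
    have h2 : ∑ i : Fin (b + 1), (b - (i : ℕ)) * k i + ∑ i : Fin (b + 1), (i : ℕ) * k i =
        a * b := by
      rw [← Finset.sum_add_distrib, ← hs, Finset.sum_mul]
      refine Finset.sum_congr rfl fun i _ => ?_
      rw [← add_mul, Nat.sub_add_cancel (Nat.lt_succ_iff.1 i.2), mul_comm]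
    rw [h, show ∑ i : Fin (b + 1), (b - (i : ℕ)) * k i = a * b - j by omega]

theorem coeffC_mem_Iab (a b j : ℕ) (hj : j ≤ a * b) : coeffC a b j ∈ Iab a b :=
  Ideal.subset_span ⟨⟨j, Nat.lt_succ_of_le hj⟩, rfl⟩

theorem sum_coeffC_mul_pow (a b : ℕ) (z : ℂ) :
    ∑ j ∈ Finset.range (a * b + 1), C (z ^ j) * coeffC a b j =
      (∑ i : Fin (b + 1), C (z ^ (i : ℕ)) * X i) ^ a := by
  rw [Finset.sum_pow_eq_sum_piAntidiag]
  simp only [coeffC_eq, Finset.mul_sum, Finset.sum_filter]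
  rw [Finset.sum_comm]
  refine Finset.sum_congr rfl fun k hk => ?_
  have hs : ∑ i, k i = a := (Finset.mem_piAntidiag.1 hk).1
  have h2 : ∑ i : Fin (b + 1), (i : ℕ) * k i ≤ a * b := by
    rw [← hs, Finset.sum_mul]
    refine Finset.sum_le_sum fun i _ => ?_
    rw [mul_comm]
    exact Nat.mul_le_mul_left _ (Nat.lt_succ_iff.1 i.2)
  simp only [mul_ite, mul_zero]
  rw [Finset.sum_ite_eq, if_pos (Finset.mem_range.2 (Nat.lt_succ_of_le h2)), monomial_eq,
    Finsupp.prod_fintype _ _ (by simp)]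
  simp only [mul_pow, Finset.prod_mul_distrib, ← map_pow, ← map_prod, ← pow_mul,
    Finset.prod_pow_eq_pow_sum, Finsupp.equivFunOnFinite_symm_apply_apply, map_natCast]
  ring

/-- The generic `m × m` Hankel matrix. -/
noncomputable def hankel (b m : ℕ) : Matrix (Fin m) (Fin m) (MvPolynomial (Fin (b + 1)) ℂ) :=
  Matrix.of fun i j => X (Fin.ofNat (b + 1) (i + j))

theorem hankel_det_isHomogeneous (b m : ℕ) : (hankel b m).det.IsHomogeneous m := by
  rw [Matrix.det_apply]
  refine IsHomogeneous.sum _ _ _ fun τ _ => ?_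
  have h : (∏ i, hankel b m (τ i) i).IsHomogeneous (∑ _i : Fin m, 1) :=
    IsHomogeneous.prod _ _ _ fun i _ => isHomogeneous_X _ _
  rw [Units.smul_def, ← Int.cast_smul_eq_zsmul ℂ, smul_eq_C_mul]
  exact IsHomogeneous.C_mul (by simpa using h) _

theorem hankel_det_ne_zero (b m : ℕ) (hm : 2 * m ≤ b + 2) : (hankel b m).det ≠ 0 := by
  intro h
  have h1 := congrArg (eval fun l : Fin (b + 1) => ∑ p : Fin m, ((p : ℕ) : ℂ) ^ (l : ℕ)) h
  rw [map_zero, RingHom.map_det] at h1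
  let V : Matrix (Fin m) (Fin m) ℂ := Matrix.vandermonde fun p => ((p : ℕ) : ℂ)
  have h2 : (eval fun l : Fin (b + 1) => ∑ p : Fin m, ((p : ℕ) : ℂ) ^ (l : ℕ)).mapMatrix
      (hankel b m) = V.transpose * V := by
    ext i j
    have hij : ((i : ℕ) + j) % (b + 1) = i + j := Nat.mod_eq_of_lt (by omega)
    simp [hankel, V, Matrix.mul_apply, Matrix.vandermonde_apply, hij, pow_add]
  rw [h2, Matrix.det_mul, Matrix.det_transpose, mul_self_eq_zero] at h1
  refine Matrix.det_vandermonde_ne_zero_iff.2 (fun p q hpq => ?_) h1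
  exact Fin.ext (by simpa using hpq)

/-- The forms `c_j(∂)` annihilate the `(a-1)`-st power of the Hankel determinant. -/
theorem coeffC_apply_hankel_det_pow (a b m j : ℕ) (ha : 1 ≤ a) (hm : 2 * m ≤ b + 2)
    (hj : j ≤ a * b)
    (D : MvPolynomial (Fin (b + 1)) ℂ →ₐ[ℂ] Module.End ℂ (MvPolynomial (Fin (b + 1)) ℂ))
    (hD : ∀ i p, D (X i) p = pderiv i p) :
    D (coeffC a b j) ((hankel b m).det ^ (a - 1)) = 0 := by
  set F := (hankel b m).det ^ (a - 1) with hF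
  have hC : ∀ (c : ℂ) (Q p : MvPolynomial (Fin (b + 1)) ℂ), D (C c * Q) p = c • D Q p := by
    intro c Q p
    rw [← smul_eq_C_mul, map_smul, LinearMap.smul_apply]
  have key : ∀ z : ℂ, ∑ j ∈ Finset.range (a * b + 1), z ^ j • D (coeffC a b j) F = 0 := by
    intro z
    let δ : Derivation ℂ (MvPolynomial (Fin (b + 1)) ℂ) (MvPolynomial (Fin (b + 1)) ℂ) :=
      mkDerivation ℂ fun i => C (z ^ (i : ℕ))
    have hδ : ∀ p, D (∑ i : Fin (b + 1), C (z ^ (i : ℕ)) * X i) p = δ p := by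
      intro p
      have hsum : ∀ q, (∑ i : Fin (b + 1), z ^ (i : ℕ) • pderiv i :
          Derivation ℂ (MvPolynomial (Fin (b + 1)) ℂ) (MvPolynomial (Fin (b + 1)) ℂ)) q =
          ∑ i : Fin (b + 1), z ^ (i : ℕ) • pderiv i q := by
        intro q
        rw [← Derivation.coeFnAddMonoidHom_apply, map_sum, Finset.sum_apply]
        rfl
      have : δ = ∑ i : Fin (b + 1), z ^ (i : ℕ) • pderiv i := by
        refine MvPolynomial.derivation_ext fun l => ?_
        classical
        simp only [hsum, δ, mkDerivation_X, pderiv_X, Pi.single_apply, smul_ite, smul_zero]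
        simp [smul_eq_C_mul]
      rw [this, map_sum, LinearMap.sum_apply, hsum]
      exact Finset.sum_congr rfl fun i _ => by rw [hC, hD]
    have hit : ∀ n p, (D (∑ i : Fin (b + 1), C (z ^ (i : ℕ)) * X i) ^ n) p = δ^[n] p := by
      intro n p
      rw [Module.End.pow_apply]
      exact congrFun (congrArg (fun f => f^[n]) (funext hδ)) p
    have hdet : δ (δ (hankel b m).det) = 0 := by
      refine δ.det_of_rank_one _ (fun i => C (z ^ (i : ℕ))) (fun i => C (z ^ (i : ℕ)))
        (fun i j => ?_) (fun i => ?_) (fun i => ?_)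
      · have hij : ((i : ℕ) + j) % (b + 1) = i + j := Nat.mod_eq_of_lt (by omega)
        simp only [hankel, Matrix.of_apply, δ, mkDerivation_X, Fin.val_ofNat, hij, pow_add,
          map_mul]
      · exact δ.map_algebraMap _
      · exact δ.map_algebraMap _
    have h0 := δ.iterate_pow_mul_eq_zero hdet (a - 1) 1 (by simp)
    rw [mul_one, Nat.sub_add_cancel ha, ← hF, ← hit, ← map_pow, ← sum_coeffC_mul_pow, map_sum,
      LinearMap.sum_apply] at h0
    simpa only [hC] using h0
  ext e
  let p : Polynomial ℂ := ∑ j ∈ Finset.range (a * b + 1),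
    Polynomial.monomial j (coeff e (D (coeffC a b j) F))
  have hp : p = 0 := by
    refine Polynomial.funext fun z => ?_
    have h1 := congrArg (coeff e) (key z)
    simp only [coeff_sum, coeff_smul, coeff_zero, smul_eq_mul] at h1
    simp only [p, Polynomial.eval_finsetSum, Polynomial.eval_monomial, Polynomial.eval_zero]
    rw [← h1]
    exact Finset.sum_congr rfl fun _ _ => mul_comm _ _
  have h2 := congrArg (fun q => q.coeff j) hp
  simpa [p, Polynomial.coeff_monomial, Nat.lt_succ_of_le hj] using h2

theorem exists_isHomogeneous_notMem_Iab (a b m : ℕ) (ha : 1 ≤ a) (hm : 2 * m ≤ b + 2) :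
    ∃ P : MvPolynomial (Fin (b + 1)) ℂ, P.IsHomogeneous (m * (a - 1)) ∧ P ∉ Iab a b := by
  obtain ⟨D, hD⟩ := exists_algHom_pderiv (Fin (b + 1)) ℂ
  obtain ⟨P, hP, hPF⟩ := exists_isHomogeneous_apply_ne_zero D hD (m * (a - 1))
    ((hankel b m).det ^ (a - 1)) ((hankel_det_isHomogeneous b m).pow _)
    (pow_ne_zero _ (hankel_det_ne_zero b m hm))
  refine ⟨P, hP, fun hmem => hPF ?_⟩
  refine Submodule.span_induction (p := fun Q _ => D Q ((hankel b m).det ^ (a - 1)) = 0)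
    ?_ ?_ ?_ ?_ hmem
  · rintro _ ⟨j, rfl⟩
    exact coeffC_apply_hankel_det_pow a b m j ha hm (Nat.lt_succ_iff.1 j.2) D hD
  · simp
  · intro Q₁ Q₂ _ _ h₁ h₂
    simp [h₁, h₂]
  · intro c Q _ h
    simp [h]

theorem sum_le_of_adjacent_le (g : ℕ → ℕ) (c b : ℕ) (h1 : ∀ l ≤ b, g l ≤ c)
    (h2 : ∀ l < b, g l + g (l + 1) ≤ c) :
    ∑ l ∈ Finset.range (b + 1), g l ≤ (b + 2) / 2 * c := by
  induction b using Nat.twoStepInduction with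
  | zero => simpa using h1 0 le_rfl
  | one => simpa [Finset.sum_range_succ] using h2 0 one_pos
  | more b ih _ =>
    rw [Finset.sum_range_succ, Finset.sum_range_succ,
      show (b + 2 + 2) / 2 = (b + 2) / 2 + 1 by omega, add_mul, one_mul]
    have h3 := ih (fun l hl => h1 l (by omega)) (fun l hl => h2 l (by omega))
    have h4 : g (b + 1) + g (b + 2) ≤ c := h2 (b + 1) (by omega)
    have h5 : b + 1 + 1 = b + 2 := rfl
    rw [h5]
    omega

theorem exists_adjacent_ge (a b : ℕ) (hb : 1 ≤ b) (e : Fin (b + 1) → ℕ)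
    (he : (b + 2) / 2 * (a - 1) < ∑ i, e i) :
    ∃ i : Fin b, a ≤ e i.castSucc + e i.succ := by
  by_contra! h
  let g : ℕ → ℕ := fun l => e (Fin.ofNat (b + 1) l)
  have h2 : ∀ l < b, g l + g (l + 1) ≤ a - 1 := by
    intro l hl
    have h3 := h ⟨l, hl⟩
    have e1 : Fin.ofNat (b + 1) l = Fin.castSucc ⟨l, hl⟩ :=
      Fin.ext (Nat.mod_eq_of_lt (by omega))
    have e2 : Fin.ofNat (b + 1) (l + 1) = Fin.succ ⟨l, hl⟩ :=
      Fin.ext (Nat.mod_eq_of_lt (by omega))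
    simp only [g, e1, e2]
    omega
  have h1 : ∀ l ≤ b, g l ≤ a - 1 := by
    intro l hl
    rcases hl.lt_or_eq with hl | rfl
    · have := h2 l hl
      omega
    · have := h2 (l - 1) (by omega)
      rw [Nat.sub_add_cancel hb] at this
      omega
  have h3 := sum_le_of_adjacent_le g (a - 1) b h1 h2
  rw [← Fin.sum_univ_eq_sum_range] at h3
  simp only [g, Fin.ofNat_eq_cast, Fin.cast_val_eq_self] at h3
  omega

/-- Among exponent vectors with given sum and first moment, the one concentrated at two adjacent
indices is the unique minimizer of the second moment. -/
theorem second_moment_lt {b : ℕ} (i : Fin b) (f k : Fin (b + 1) → ℕ)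
    (hf : ∀ l, l ≠ i.castSucc → l ≠ i.succ → f l = 0)
    (h0 : ∑ l, k l = ∑ l, f l)
    (h1 : ∑ l : Fin (b + 1), (l : ℕ) * k l = ∑ l : Fin (b + 1), (l : ℕ) * f l) (hk : k ≠ f) :
    ∑ l : Fin (b + 1), (l : ℕ) ^ 2 * f l < ∑ l : Fin (b + 1), (l : ℕ) ^ 2 * k l := by
  have hq : ∀ l : Fin (b + 1), 0 ≤ ((l : ℤ) - i) * ((l : ℤ) - (i + 1)) := by
    intro l
    rcases le_or_gt (l : ℤ) i with h | h
    · exact mul_nonneg_of_nonpos_of_nonpos (by omega) (by omega)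
    · exact mul_nonneg (by omega) (by omega)
  have expand : ∀ g : Fin (b + 1) → ℕ,
      ∑ l : Fin (b + 1), ((l : ℤ) - i) * ((l : ℤ) - (i + 1)) * (g l : ℤ) =
        ((∑ l : Fin (b + 1), (l : ℕ) ^ 2 * g l : ℕ) : ℤ) -
          (2 * i + 1) * ((∑ l : Fin (b + 1), (l : ℕ) * g l : ℕ) : ℤ) +
          i * (i + 1) * ((∑ l, g l : ℕ) : ℤ) := by
    intro g
    push_cast
    rw [Finset.mul_sum, Finset.mul_sum, ← Finset.sum_sub_distrib, ← Finset.sum_add_distrib]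
    exact Finset.sum_congr rfl fun l _ => by ring
  have hf0 : ∑ l : Fin (b + 1), ((l : ℤ) - i) * ((l : ℤ) - (i + 1)) * (f l : ℤ) = 0 := by
    refine Finset.sum_eq_zero fun l _ => ?_
    by_cases e1 : l = i.castSucc
    · simp [e1]
    by_cases e2 : l = i.succ
    · simp [e2]
    simp [hf l e1 e2]
  have hknn : ∀ l ∈ Finset.univ,
      0 ≤ ((l : Fin (b + 1)) - (i : ℤ)) * ((l : ℤ) - (i + 1)) * (k l : ℤ) :=
    fun l _ => mul_nonneg (hq l) (Int.natCast_nonneg _)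
  have hfe := expand f
  have hke := expand k
  rw [h0, h1] at hke
  by_contra! hle
  have hle' : ((∑ l : Fin (b + 1), (l : ℕ) ^ 2 * k l : ℕ) : ℤ) ≤
      (∑ l : Fin (b + 1), (l : ℕ) ^ 2 * f l : ℕ) :=
    Int.ofNat_le.2 hle
  have hk0 : ∑ l : Fin (b + 1), ((l : ℤ) - i) * ((l : ℤ) - (i + 1)) * (k l : ℤ) = 0 :=
    le_antisymm (by linarith) (Finset.sum_nonneg hknn)
  rw [Finset.sum_eq_zero_iff_of_nonneg hknn] at hk0
  have hksupp : ∀ l, l ≠ i.castSucc → l ≠ i.succ → k l = 0 := by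
    intro l e1 e2
    have e3 : (l : ℤ) - i ≠ 0 := fun h => e1 (Fin.ext (by simp; omega))
    have e4 : (l : ℤ) - (i + 1) ≠ 0 := fun h => e2 (Fin.ext (by simp; omega))
    simpa [e3, e4] using hk0 l (Finset.mem_univ l)
  have hne : i.castSucc ≠ i.succ := Fin.castSucc_lt_succ.ne
  have two : ∀ g c : Fin (b + 1) → ℕ, (∀ l, l ≠ i.castSucc → l ≠ i.succ → g l = 0) →
      ∑ l, c l * g l = c i.castSucc * g i.castSucc + c i.succ * g i.succ := by
    intro g c hg
    exact Fintype.sum_eq_add _ _ hne fun l hl => by rw [hg l hl.1 hl.2, mul_zero]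
  have t0k := two k (fun _ => 1) hksupp
  have t0f := two f (fun _ => 1) hf
  have t1k := two k (fun l => l) hksupp
  have t1f := two f (fun l => l) hf
  simp only [one_mul, Fin.val_castSucc, Fin.val_succ, add_mul] at t0k t0f t1k t1f
  have m0 : k i.castSucc + k i.succ = f i.castSucc + f i.succ := by omega
  have m1 : (i : ℕ) * (k i.castSucc + k i.succ) = i * (f i.castSucc + f i.succ) := by rw [m0]
  rw [mul_add, mul_add] at m1
  refine hk (funext fun l => ?_)
  by_cases e1 : l = i.castSucc
  · subst e1
    omega
  by_cases e2 : l = i.succ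
  · subst e2
    omega
  rw [hf l e1 e2, hksupp l e1 e2]

theorem monomial_mem_Iab (a b : ℕ) (hb : 1 ≤ b) (w : ℕ) (e : Fin (b + 1) →₀ ℕ)
    (he : (b + 2) / 2 * (a - 1) < ∑ i, e i)
    (hw : b ^ 2 * ∑ i, e i - ∑ i : Fin (b + 1), (i : ℕ) ^ 2 * e i = w) :
    (monomial e 1 : MvPolynomial (Fin (b + 1)) ℂ) ∈ Iab a b := by
  induction w using Nat.strong_induction_on generalizing e with
  | _ w ih =>
  obtain ⟨i, hi⟩ := exists_adjacent_ge a b hb e he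
  have hne : i.castSucc ≠ i.succ := Fin.castSucc_lt_succ.ne
  let f : Fin (b + 1) →₀ ℕ := Finsupp.single i.castSucc (min (e i.castSucc) a) +
    Finsupp.single i.succ (a - min (e i.castSucc) a)
  have hf1 : f i.castSucc = min (e i.castSucc) a := by simp [f, hne]
  have hf2 : f i.succ = a - min (e i.castSucc) a := by simp [f, hne.symm]
  have hf : ∀ l, l ≠ i.castSucc → l ≠ i.succ → f l = 0 := by
    intro l e1 e2
    simp [f, e1, e2]
  have hfe : f ≤ e := by
    intro l
    by_cases e1 : l = i.castSucc
    · rw [e1, hf1]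
      exact min_le_left _ _
    by_cases e2 : l = i.succ
    · rw [e2, hf2]
      omega
    simp [hf l e1 e2]
  have hfsum : ∑ l, f l = a := by
    rw [Fintype.sum_eq_add _ _ hne fun l hl => hf l hl.1 hl.2, hf1, hf2]
    omega
  obtain ⟨e', he'⟩ : ∃ e', e = f + e' := ⟨e - f, (add_tsub_cancel_of_le hfe).symm⟩
  clear_value f
  subst he'
  have hj : ∑ l : Fin (b + 1), (l : ℕ) * f l ≤ a * b := by
    rw [← hfsum, Finset.sum_mul]
    refine Finset.sum_le_sum fun l _ => ?_
    rw [mul_comm]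
    exact Nat.mul_le_mul_left _ (Nat.lt_succ_iff.1 l.2)
  have hmem := Ideal.mul_mem_right (monomial e' (1 : ℂ)) _ (coeffC_mem_Iab a b _ hj)
  have hfmem : (f : Fin (b + 1) → ℕ) ∈
      (Finset.piAntidiag (Finset.univ : Finset (Fin (b + 1))) a).filter
        fun k => ∑ l : Fin (b + 1), (l : ℕ) * k l = ∑ l : Fin (b + 1), (l : ℕ) * f l := by
    simp [Finset.mem_piAntidiag, hfsum]
  rw [coeffC_eq, ← Finset.add_sum_erase _ _ hfmem, add_mul] at hmem
  have hrest : (∑ k ∈ ((Finset.piAntidiag (Finset.univ : Finset (Fin (b + 1))) a).filter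
        fun k => ∑ l : Fin (b + 1), (l : ℕ) * k l = ∑ l : Fin (b + 1), (l : ℕ) * f l).erase f,
      monomial (Finsupp.equivFunOnFinite.symm k) (Nat.multinomial Finset.univ k : ℂ)) *
        monomial e' (1 : ℂ) ∈ Iab a b := by
    rw [Finset.sum_mul]
    refine Ideal.sum_mem _ fun k hk => ?_
    obtain ⟨hkf, hk⟩ := Finset.mem_erase.1 hk
    obtain ⟨hka, hk1⟩ := Finset.mem_filter.1 hk
    have hk0 : ∑ l, k l = a := (Finset.mem_piAntidiag.1 hka).1
    have hlt := second_moment_lt i f k hf (hk0.trans hfsum.symm) hk1 hkf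
    rw [monomial_mul, mul_one, ← mul_one (Nat.multinomial Finset.univ k : ℂ), ← C_mul_monomial]
    have hsum : ∑ l, (Finsupp.equivFunOnFinite.symm k + e') l = ∑ l, (f + e') l := by
      simp [Finset.sum_add_distrib, hk0, hfsum]
    refine Ideal.mul_mem_left _ _ (ih _ ?_ _ (by rwa [hsum]) rfl)
    rw [← hw, hsum]
    have hbound : ∑ l : Fin (b + 1), (l : ℕ) ^ 2 * (Finsupp.equivFunOnFinite.symm k + e') l ≤
        b ^ 2 * ∑ l, (f + e') l := by
      rw [← hsum, Finset.mul_sum]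
      exact Finset.sum_le_sum fun l _ =>
        Nat.mul_le_mul_right _ (Nat.pow_le_pow_left (Nat.lt_succ_iff.1 l.2) 2)
    have hmom : ∑ l : Fin (b + 1), (l : ℕ) ^ 2 * (f + e') l <
        ∑ l : Fin (b + 1), (l : ℕ) ^ 2 * (Finsupp.equivFunOnFinite.symm k + e') l := by
      simpa [mul_add, Finset.sum_add_distrib] using hlt
    omega
  have hlead := (Ideal.add_mem_iff_left _ hrest).1 hmem
  rw [Finsupp.equivFunOnFinite_symm_coe, monomial_mul, mul_one] at hlead
  have hmn : (Nat.multinomial Finset.univ f : ℂ) ≠ 0 :=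
    Nat.cast_ne_zero.2 (Nat.multinomial_pos _ _).ne'
  have := Ideal.mul_mem_left _ (C (Nat.multinomial Finset.univ f : ℂ)⁻¹) hlead
  rwa [C_mul_monomial, inv_mul_cancel₀ hmn] at this

/-- Every homogeneous polynomial of degree `> ⌊(b+2)/2⌋·(a−1)` lies in `I_{a,b}`, and
there is a homogeneous polynomial of degree exactly `⌊(b+2)/2⌋·(a−1)` not in `I_{a,b}`.
Hence `reg(I_{a,b}) = ⌊(b+2)/2⌋·a − ⌊b/2⌋`. -/
theorem top_degree_of_Iab (a b : ℕ) (ha : 1 ≤ a) (hb : 1 ≤ b) :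
    (∀ (n : ℕ) (P : MvPolynomial (Fin (b + 1)) ℂ), P.IsHomogeneous n →
      (b + 2) / 2 * (a - 1) < n → P ∈ Iab a b) ∧
    (∃ P : MvPolynomial (Fin (b + 1)) ℂ,
      P.IsHomogeneous ((b + 2) / 2 * (a - 1)) ∧ P ∉ Iab a b) := by
  refine ⟨fun n P hP hn => ?_,
    exists_isHomogeneous_notMem_Iab a b _ ha (Nat.mul_div_le (b + 2) 2)⟩
  rw [P.as_sum]
  refine Ideal.sum_mem _ fun e he => ?_
  rw [← mul_one (coeff e P), ← C_mul_monomial]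
  refine Ideal.mul_mem_left _ _ (monomial_mem_Iab a b hb _ e ?_ rfl)
  rwa [← Finsupp.degree_eq_sum, Finsupp.degree_apply, ← hP.degree_eq_sum_deg_support he]
end
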